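/- Let K be a number field of degree d. Then for every ε > 0 there exists a constant C = C(K, ε) such that for all real σ with 1/2 ≤ σ ≤ 1 and all real t with |t| ≥ 1, one has |ζ_K(σ + it)| ≤ C·(1 + |t|)^{(d/3)(1−σ) + ε}. -/

import Mathlib

open NumberField Filter

/-- `aK K n` is the ideal counting function `a_K(n)`: the number of nonzero ideals of the
ring of integers of `K` with absolute norm `n`. -/
noncomputable def aK (K : Type) [Field K] [NumberField K] (n : ℕ) : ℕ :=
  Nat.card {I : Ideal (𝓞 K) // I ≠ ⊥ ∧ I.absNorm = n}
section
open MeasureTheory Filter Topology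
open scoped ContDiff

namespace DZ
set_option linter.unusedSectionVars false

section Poisson
variable {κ : Type*} [Fintype κ]

/-- integer vector as a real vector -/
def zr (n : κ → ℤ) : κ → ℝ := fun i => (n i : ℝ)

/-- additive character -/
noncomputable def ech (k : κ → ℤ) (u : κ → ℝ) : ℂ :=
  Complex.exp (-(2 * Real.pi * ∑ i, (k i : ℝ) * u i : ℝ) * Complex.I)

lemma zr_add (m n : κ → ℤ) : zr (m + n) = zr m + zr n := by
  funext i; simp [zr]

lemma ech_continuous (k : κ → ℤ) : Continuous (ech k) := by
  unfold ech; fun_prop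

lemma ech_add_zr (k n : κ → ℤ) (u : κ → ℝ) : ech k (u + zr n) = ech k u := by
  unfold ech zr
  rw [Complex.exp_eq_exp_iff_exists_int]
  refine ⟨-∑ i, k i * n i, ?_⟩
  simp only [Pi.add_apply, mul_add, Finset.sum_add_distrib]
  push_cast
  ring

lemma ech_mFourier (k : κ → ℤ) (u : κ → ℝ) :
    UnitAddTorus.mFourier (-k) (fun i => (u i : UnitAddCircle)) = ech k u := by
  unfold ech UnitAddTorus.mFourier
  simp only [ContinuousMap.coe_mk, Pi.neg_apply, fourier_coe_apply]
  rw [← Complex.exp_sum]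
  congr 1
  push_cast
  rw [← neg_mul, ← neg_mul, Finset.mul_sum, Finset.sum_mul]
  refine Finset.sum_congr rfl fun i _ => ?_
  simp; ring

lemma exists_box (f : (κ → ℝ) → ℂ) (hc : HasCompactSupport f) (T : ℝ) :
    ∃ S : Finset (κ → ℤ), ∀ x : κ → ℝ, ‖x‖ < T → ∀ n ∉ S, f (x + zr n) = 0 := by
  classical
  obtain ⟨R, hR⟩ := hc.isCompact.isBounded.exists_norm_le
  refine ⟨Fintype.piFinset fun _ => Finset.Icc (-⌈R + T⌉) ⌈R + T⌉, fun x hx n hn => ?_⟩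
  by_contra h
  apply hn
  have h1 := hR _ (subset_tsupport f h)
  have hn1 : ‖zr n‖ ≤ R + T := by
    have : zr n = (x + zr n) - x := by simp
    rw [this]
    refine (norm_sub_le _ _).trans ?_
    linarith
  rw [Fintype.mem_piFinset]
  intro i
  have h2 : |(n i : ℝ)| ≤ R + T := (norm_le_pi_norm (zr n) i).trans hn1
  have h3 : ((|n i| : ℤ) : ℝ) ≤ (⌈R + T⌉ : ℤ) := by
    push_cast; exact h2.trans (Int.le_ceil _)
  have h4 : |n i| ≤ ⌈R+T⌉ := by exact_mod_cast h3
  rw [Finset.mem_Icc]; exact abs_le.mp h4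

/-- periodization -/
noncomputable def perz (f : (κ → ℝ) → ℂ) (x : κ → ℝ) : ℂ := ∑' n : κ → ℤ, f (x + zr n)

lemma perz_continuous (f : (κ → ℝ) → ℂ) (hf : Continuous f) (hc : HasCompactSupport f) :
    Continuous (perz f) := by
  rw [continuous_iff_continuousAt]
  intro x
  obtain ⟨S, hS⟩ := exists_box f hc (‖x‖ + 1)
  have : perz f =ᶠ[𝓝 x] fun x => ∑ n ∈ S, f (x + zr n) := by
    have : ∀ᶠ y in 𝓝 x, ‖y‖ < ‖x‖ + 1 :=
      (continuous_norm.tendsto x).eventually (gt_mem_nhds (by linarith))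
    filter_upwards [this] with y hy
    exact tsum_eq_sum (fun n hn => hS y hy n hn)
  refine ContinuousAt.congr ?_ this.symm
  fun_prop

lemma perz_periodic (f : (κ → ℝ) → ℂ) (m : κ → ℤ) (x : κ → ℝ) : perz f (x + zr m) = perz f x := by
  unfold perz
  rw [← (Equiv.addLeft m).tsum_eq (fun n => f (x + zr n))]
  simp [zr_add, add_assoc]

lemma perz_unfold (h : (κ → ℝ) → ℂ) (hf : Continuous h) (hc : HasCompactSupport h) :
    ∫ x in {x : κ → ℝ | ∀ i, x i ∈ Set.Ioc (0:ℝ) (0 + 1)}, perz h x = ∫ x, h x := by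
  set Q : Set (κ → ℝ) := {x | ∀ i, x i ∈ Set.Ioc (0:ℝ) (0 + 1)} with hQ
  have hQm : ∀ n : κ → ℤ, MeasurableSet {x : κ → ℝ | ∀ i, x i ∈ Set.Ioc (n i:ℝ) (n i + 1)} := by
    intro n
    have : {x : κ → ℝ | ∀ i, x i ∈ Set.Ioc (n i:ℝ) (n i + 1)}
        = Set.univ.pi fun i => Set.Ioc (n i:ℝ) (n i + 1) := by ext x; simp
    rw [this]
    exact MeasurableSet.univ_pi fun i => measurableSet_Ioc
  have hintg := hf.integrable_of_hasCompactSupport (μ := volume) hc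
  have H := hasSum_integral_iUnion (μ := (volume : Measure (κ → ℝ))) (f := h)
    (s := fun n : κ → ℤ => {x : κ → ℝ | ∀ i, x i ∈ Set.Ioc (n i:ℝ) (n i + 1)}) hQm ?_ hintg.integrableOn
  · have hU : (⋃ n : κ → ℤ, {x : κ → ℝ | ∀ i, x i ∈ Set.Ioc (n i:ℝ) (n i + 1)}) = Set.univ := by
      rw [Set.eq_univ_iff_forall]
      intro x
      rw [Set.mem_iUnion]
      refine ⟨fun i => ⌈x i⌉ - 1, fun i => ?_⟩
      push_cast
      exact ⟨by linarith [Int.ceil_lt_add_one (x i)], by linarith [Int.le_ceil (x i)]⟩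
    rw [hU, setIntegral_univ] at H
    rw [← H.tsum_eq]
    have e1 : ∀ n : κ → ℤ, ∫ x in {x : κ → ℝ | ∀ i, x i ∈ Set.Ioc (n i:ℝ) (n i + 1)}, h x
        = ∫ x in Q, h (x + zr n) := by
      intro n
      have hp : MeasurePreserving (fun x : κ → ℝ => x + zr n) volume volume :=
        measurePreserving_add_right volume (zr n)
      have he : MeasurableEmbedding (fun x : κ → ℝ => x + zr n) := measurableEmbedding_addRight _
      rw [← hp.setIntegral_preimage_emb he]
      congr 2
      ext x
      simp only [hQ, zr, Set.mem_preimage, Set.mem_ofPred_eq, Set.mem_Ioc, Pi.add_apply]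
      refine forall_congr' fun i => ?_
      constructor <;> rintro ⟨h1, h2⟩ <;> constructor <;> linarith
    simp_rw [e1]
    obtain ⟨S, hS⟩ := exists_box h hc 2
    have hQb : ∀ x ∈ Q, ‖x‖ < 2 := by
      intro x hx
      refine lt_of_le_of_lt ((pi_norm_le_iff_of_nonneg zero_le_one).2 fun i => ?_) one_lt_two
      have := hx i
      rw [Real.norm_eq_abs, abs_le]
      constructor <;> linarith [this.1, this.2]
    have hQm' : MeasurableSet Q := by
      have := hQm 0
      simpa only [Pi.zero_apply, Int.cast_zero] using this
    rw [tsum_eq_sum (s := S)]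
    · rw [← integral_finsetSum]
      · refine setIntegral_congr_fun hQm' fun x hx => ?_
        exact tsum_eq_sum (fun n hn => hS x (hQb x hx) n hn)
      · intro n _
        exact (hintg.comp_add_right _).integrableOn
    · intro n hn
      rw [setIntegral_congr_fun hQm' (g := fun _ => 0) (fun x hx => hS x (hQb x hx) n hn)]
      simp
  · intro m n hmn
    rw [Function.onFun, Set.disjoint_left]
    intro x hx hx'
    apply hmn
    funext i
    have h1 := hx i
    have h2 := hx' i
    have h3 : (m i : ℝ) < n i + 1 := by linarith [h1.1, h2.2]
    have h4 : (n i : ℝ) < m i + 1 := by linarith [h1.2, h2.1]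
    have h3' : m i < n i + 1 := by exact_mod_cast h3
    have h4' : n i < m i + 1 := by exact_mod_cast h4
    omega

theorem poisson (f : (κ → ℝ) → ℂ) (hf : Continuous f) (hc : HasCompactSupport f)
    (hs : Summable fun k : κ → ℤ => ∫ u, f u * ech k u) :
    ∑' n : κ → ℤ, f (zr n) = ∑' k : κ → ℤ, ∫ u, f u * ech k u := by
  have hq : IsOpenQuotientMap (fun (x : κ → ℝ) (i : κ) => (x i : UnitAddCircle)) :=
    IsOpenQuotientMap.piMap (f := fun _ (x:ℝ) => (x : UnitAddCircle))
      (fun _ => QuotientAddGroup.isOpenQuotientMap_mk)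
  let p : C(κ → ℝ, UnitAddTorus κ) := ⟨fun x i => (x i : UnitAddCircle), hq.continuous⟩
  let g : C(κ → ℝ, ℂ) := ⟨perz f, perz_continuous f hf hc⟩
  have hfac : Function.FactorsThrough g p := by
    intro a b hab
    have : ∀ i, ∃ m : ℤ, (m : ℝ) = -a i + b i := by
      intro i
      have := congrFun hab i
      have h2 := QuotientAddGroup.eq.1 this
      rw [AddSubgroup.mem_zmultiples_iff] at h2
      obtain ⟨m, hm⟩ := h2
      exact ⟨m, by simpa using hm⟩
    choose m hm using this
    have hb : b = a + zr m := by
      funext i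
      simp [zr, hm]
    change perz f a = perz f b
    rw [hb, perz_periodic]
  have hq' : IsQuotientMap p := hq.isQuotientMap
  let G : C(UnitAddTorus κ, ℂ) := hq'.lift g hfac
  have hG : ∀ x : κ → ℝ, G (fun i => (x i : UnitAddCircle)) = perz f x := by
    intro x
    have := hq'.lift_comp g hfac
    exact congrArg (fun F : C(κ → ℝ, ℂ) => F x) this
  have hcoef : ∀ k, UnitAddTorus.mFourierCoeff G k = ∫ u, f u * ech k u := by
    intro k
    rw [UnitAddTorus.mFourierCoeff_eq_integral G k 0]
    rw [← perz_unfold (fun u => f u * ech k u) (hf.mul (ech_continuous k)) hc.mul_right]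
    congr 1
    funext x
    rw [ech_mFourier, hG, perz, perz, smul_eq_mul, ← tsum_mul_left]
    refine tsum_congr fun n => ?_
    rw [ech_add_zr, mul_comm]
  have H := UnitAddTorus.hasSum_mFourier_series_apply_of_summable (f := G)
    (by simp_rw [funext hcoef]; exact hs) (fun i => ((0:ℝ) : UnitAddCircle))
  rw [hG (fun _ => 0)] at H
  have h0 := H.tsum_eq
  simp only [hcoef] at h0
  have e0 : perz f (fun _ => 0) = ∑' n : κ → ℤ, f (zr n) := by
    unfold perz
    refine tsum_congr fun n => ?_
    congr 1; funext i; simp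
  rw [← e0, ← h0]
  refine tsum_congr fun k => ?_
  have : UnitAddTorus.mFourier k (fun i : κ => ((0:ℝ) : UnitAddCircle)) = 1 := by
    have := ech_mFourier (-k) (fun _ : κ => (0:ℝ))
    rw [neg_neg] at this
    rw [this]; simp [ech]
  rw [this]; simp

end Poisson
end DZ
end

section
open MeasureTheory Filter Topology
open scoped ContDiff

namespace DZ

section NSP
variable {E Pm ι : Type*} [NormedAddCommGroup E] [NormedSpace ℝ E] [FiniteDimensional ℝ E]
  [MeasurableSpace E] [BorelSpace E] [NormedAddCommGroup Pm] [NormedSpace ℝ Pm] [Fintype ι]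

/-- integral of a directional derivative of a compactly supported function vanishes -/
theorem integral_fderiv_zero (μ : Measure E) [μ.IsAddHaarMeasure] (u : E → ℂ) (hu : ContDiff ℝ 1 u)
    (hc : HasCompactSupport u) (v : E) : ∫ x, fderiv ℝ u x v ∂μ = 0 := by
  have h1 : Continuous fun x => fderiv ℝ u x v := by
    have := hu.continuous_fderiv (by norm_num)
    fun_prop
  have h2 : HasCompactSupport fun x => fderiv ℝ u x v := hc.fderiv_apply (𝕜 := ℝ) v
  have i1 : Integrable (fun x => fderiv ℝ u x v) μ := h1.integrable_of_hasCompactSupport h2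
  have i2 : Integrable u μ := hu.continuous.integrable_of_hasCompactSupport hc
  have := integral_bilinear_fderiv_right_eq_neg_left_of_integrable (μ := μ) (B := ContinuousLinearMap.mul ℝ ℂ)
    (f := u) (g := fun _ => (1 : ℂ)) (v := v)
    (by simpa using i1) (by simp) (by simpa using i2) (fun x _ => (hu.differentiable (by norm_num)) x) (fun x _ => by fun_prop)
  simpa using this.symm

theorem nsp (μ : Measure E) [μ.IsAddHaarMeasure] (e : ι → E) (Ω : Set (E × Pm)) (hΩ : IsOpen Ω)
    (S : Set E) (hS : IsCompact S) (KK : Set Pm) (hK : IsCompact KK) (hSK : S ×ˢ KK ⊆ Ω)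
    (q : E × Pm → ℝ) (hq : ContDiffOn ℝ ∞ q Ω)
    (hq0 : ∀ z ∈ Ω, ∑ j, (fderiv ℝ q z (e j, 0)) ^ 2 ≠ 0) (N : ℕ) :
    ∀ a : E × Pm → ℂ, ContDiffOn ℝ ∞ a Ω → (∀ x p, x ∉ S → a (x, p) = 0) →
      ∃ C, ∀ p ∈ KK, ∀ τ : ℝ,
        |τ| ^ N * ‖∫ x, a (x, p) * Complex.exp (Complex.I * (τ * q (x, p))) ∂μ‖ ≤ C := by
  induction N with
  | zero =>
    intro a ha haS
    obtain ⟨M, hM⟩ := (hS.prod hK).exists_bound_of_continuousOn (ha.continuousOn.mono hSK)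
    refine ⟨M * μ.real S, fun p hp τ => ?_⟩
    simp only [pow_zero, one_mul]
    rw [← setIntegral_eq_integral_of_forall_compl_eq_zero (s := S) (by
      intro x hx; simp [haS x p hx])]
    refine norm_setIntegral_le_of_norm_le_const hS.measure_lt_top fun x hx => ?_
    have : ‖Complex.exp (Complex.I * (τ * q (x, p)))‖ = 1 := by
      rw [mul_comm, ← Complex.ofReal_mul]; exact Complex.norm_exp_ofReal_mul_I _
    rw [norm_mul, this, mul_one]
    exact hM _ ⟨hx, hp⟩
  | succ N ih =>
    intro a ha haS
    set D : E × Pm → ℝ := fun z => ∑ j, (fderiv ℝ q z (e j, 0)) ^ 2 with hD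
    have hdq : ∀ j, ContDiffOn ℝ ∞ (fun z => fderiv ℝ q z (e j, 0)) Ω := fun j =>
      (hq.fderiv_of_isOpen hΩ (m := ∞) (by simp)).clm_apply contDiffOn_const
    have hDs : ContDiffOn ℝ ∞ D Ω := ContDiffOn.sum fun j _ => (hdq j).pow 2
    set aj : ι → E × Pm → ℂ := fun j z => a z * ((fderiv ℝ q z (e j, 0) / D z : ℝ) : ℂ) with haj
    have hajs : ∀ j, ContDiffOn ℝ ∞ (aj j) Ω := fun j =>
      ha.mul (Complex.ofRealCLM.contDiff.comp_contDiffOn ((hdq j).div hDs hq0))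
    have haj0 : ∀ j x p, x ∉ S → aj j (x, p) = 0 := fun j x p hx => by simp [haj, haS x p hx]
    set T : E × Pm → ℂ := fun z => ∑ j, fderiv ℝ (aj j) z (e j, 0) with hT
    have hTs : ContDiffOn ℝ ∞ T Ω := ContDiffOn.sum fun j _ =>
      ((hajs j).fderiv_of_isOpen hΩ (m := ∞) (by simp)).clm_apply contDiffOn_const
    have hT0 : ∀ x p, x ∉ S → T (x, p) = 0 := by
      intro x p hx
      refine Finset.sum_eq_zero fun j _ => ?_
      have : aj j =ᶠ[𝓝 (x, p)] fun _ => 0 := by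
        have : (Sᶜ ×ˢ (Set.univ : Set Pm)) ∈ 𝓝 (x, p) :=
          (hS.isClosed.isOpen_compl.prod isOpen_univ).mem_nhds ⟨hx, trivial⟩
        filter_upwards [this] with z hz
        exact haj0 j z.1 z.2 hz.1
      rw [this.fderiv_eq]; simp
    obtain ⟨C, hC⟩ := ih T hTs hT0
    refine ⟨C, fun p hp τ => ?_⟩
    suffices h : ∫ x, T (x, p) * Complex.exp (Complex.I * (τ * q (x, p))) ∂μ
        = -(Complex.I * τ) * ∫ x, a (x, p) * Complex.exp (Complex.I * (τ * q (x, p))) ∂μ by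
      have h2 := hC p hp τ
      rw [h, norm_mul] at h2
      simp only [norm_neg, norm_mul, Complex.norm_I, one_mul, Complex.norm_real, Real.norm_eq_abs] at h2
      rw [pow_succ, mul_assoc]; exact h2
    set ex : E × Pm → ℂ := fun z => Complex.exp (Complex.I * (τ * q z)) with hex
    have hexs : ContDiffOn ℝ ∞ ex Ω := by
      refine ContDiffOn.cexp (contDiffOn_const.mul (contDiffOn_const.mul ?_))
      exact Complex.ofRealCLM.contDiff.comp_contDiffOn hq
    have key : ∀ j, ContDiff ℝ 1 (fun x => aj j (x, p) * ex (x, p)) ∧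
        HasCompactSupport (fun x => aj j (x, p) * ex (x, p)) := by
      intro j
      constructor
      · rw [contDiff_iff_contDiffAt]
        intro x
        by_cases hx : x ∈ S
        · have h1 : ContDiffAt ℝ 1 (fun z => aj j z * ex z) (x, p) :=
            (((hajs j).mul hexs).contDiffAt (hΩ.mem_nhds (hSK ⟨hx, hp⟩))).of_le (by simp)
          exact h1.comp x (f := fun x => (x, p)) (by fun_prop)
        · refine (contDiffAt_const (c := (0 : ℂ))).congr_of_eventuallyEq ?_
          filter_upwards [hS.isClosed.isOpen_compl.mem_nhds hx] with y hy
          simp [haj0 j y p hy]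
      · exact HasCompactSupport.intro hS fun x hx => by simp [haj0 j x p hx]
    have hsum : ∀ x, ∑ j, fderiv ℝ (fun x => aj j (x, p) * ex (x, p)) x (e j)
        = T (x, p) * ex (x, p) + (Complex.I * τ) * (a (x, p) * ex (x, p)) := by
      intro x
      by_cases hx : x ∈ S
      · have hm : (x, p) ∈ Ω := hSK ⟨hx, hp⟩
        have hn := hΩ.mem_nhds hm
        have dq : HasFDerivAt q (fderiv ℝ q (x, p)) (x, p) :=
          ((hq.contDiffAt hn).differentiableAt (by simp)).hasFDerivAt
        have hi : HasFDerivAt (fun x : E => (x, p)) (ContinuousLinearMap.inl ℝ E Pm) x :=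
          hasFDerivAt_prodMk_left x p
        have dq2 : HasFDerivAt (fun x => q (x, p)) _ x := dq.comp x hi
        have dex : HasFDerivAt (fun x => ex (x, p)) _ x :=
          ((Complex.ofRealCLM.hasFDerivAt.comp x dq2).const_mul (τ : ℂ)).const_mul Complex.I |>.cexp
        have hD0 : (D (x, p) : ℂ) ≠ 0 := by exact_mod_cast hq0 _ hm
        have : ∀ j, fderiv ℝ (fun x => aj j (x, p) * ex (x, p)) x (e j)
            = fderiv ℝ (aj j) (x, p) (e j, 0) * ex (x, p)
              + (Complex.I * τ * a (x, p) * ex (x, p) / D (x, p)) * ((fderiv ℝ q (x, p) (e j, 0)) ^ 2 : ℝ) := by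
          intro j
          have da : HasFDerivAt (aj j) (fderiv ℝ (aj j) (x, p)) (x, p) :=
            (((hajs j).contDiffAt hn).differentiableAt (by simp)).hasFDerivAt
          have da2 : HasFDerivAt (fun x => aj j (x, p))
              ((fderiv ℝ (aj j) (x, p)).comp (ContinuousLinearMap.inl ℝ E Pm)) x :=
            HasFDerivAt.comp (g := aj j) x da hi
          rw [show (fun x => aj j (x, p) * ex (x, p)) = (fun x => aj j (x, p)) * fun x => ex (x, p) from rfl,
            (da2.mul dex).fderiv]
          simp [haj, hex]
          ring
        rw [Finset.sum_congr rfl fun j _ => this j, Finset.sum_add_distrib, ← Finset.sum_mul,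
          ← Finset.mul_sum, ← Complex.ofReal_sum]
        change _ + _ / _ * ((D (x, p) : ℝ) : ℂ) = _
        rw [div_mul_cancel₀ _ hD0]; ring
      · rw [hT0 x p hx, haS x p hx]
        simp only [zero_mul, mul_zero, add_zero]
        refine Finset.sum_eq_zero fun j _ => ?_
        have : (fun x => aj j (x, p) * ex (x, p)) =ᶠ[𝓝 x] fun _ => 0 := by
          filter_upwards [hS.isClosed.isOpen_compl.mem_nhds hx] with y hy
          simp [haj0 j y p hy]
        rw [this.fderiv_eq]; simp
    have hintg : ∀ b : E × Pm → ℂ, ContDiffOn ℝ ∞ b Ω → (∀ x p, x ∉ S → b (x, p) = 0) →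
        Integrable (fun x => b (x, p) * ex (x, p)) μ := by
      intro b hb hb0
      refine Continuous.integrable_of_hasCompactSupport ?_
        (HasCompactSupport.intro hS fun x hx => by simp [hb0 x p hx])
      rw [continuous_iff_continuousAt]
      intro x
      by_cases hx : x ∈ S
      · have h1 : ContinuousAt (fun z => b z * ex z) (x, p) :=
          ((hb.mul hexs).contDiffAt (hΩ.mem_nhds (hSK ⟨hx, hp⟩))).continuousAt
        exact h1.comp (f := fun x => (x, p)) (by fun_prop)
      · refine (continuousAt_const (y := (0 : ℂ))).congr ?_
        filter_upwards [hS.isClosed.isOpen_compl.mem_nhds hx] with y hy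
        simp [hb0 y p hy]
    have h0 : ∫ x, (∑ j, fderiv ℝ (fun x => aj j (x, p) * ex (x, p)) x (e j)) ∂μ = 0 := by
      rw [integral_finsetSum]
      · exact Finset.sum_eq_zero fun j _ => integral_fderiv_zero μ _ (key j).1 (key j).2 _
      · intro j _
        have h1 := (key j).1.continuous_fderiv (by norm_num)
        exact Continuous.integrable_of_hasCompactSupport (by fun_prop)
          ((key j).2.fderiv_apply (𝕜 := ℝ) (e j))
    simp_rw [hsum] at h0
    rw [integral_add (hintg T hTs hT0) ((hintg a ha haS).const_mul _), integral_const_mul] at h0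
    linear_combination h0

end NSP
end DZ
end

section
open MeasureTheory Filter Topology
open scoped ContDiff

namespace DZ

section Loc
variable {𝕜 : Type*} [RCLike 𝕜]

/-- embedding of `𝕜` in `ℂ` -/
noncomputable def emb : 𝕜 →+* ℂ where
  toFun x := ⟨RCLike.re x, RCLike.im x⟩
  map_one' := by apply Complex.ext <;> simp
  map_zero' := by apply Complex.ext <;> simp
  map_mul' x y := by apply Complex.ext <;> simp [RCLike.mul_re, RCLike.mul_im]
  map_add' x y := by apply Complex.ext <;> simp

theorem emb_re (x : 𝕜) : (emb x).re = RCLike.re x := rfl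
theorem emb_im (x : 𝕜) : (emb x).im = RCLike.im x := rfl

theorem norm_emb (x : 𝕜) : ‖emb x‖ = ‖x‖ := by
  have h1 : ‖emb x‖ ^ 2 = ‖x‖ ^ 2 := by
    rw [RCLike.norm_sq_eq_def (z := x), ← Complex.normSq_eq_norm_sq, Complex.normSq_apply]
    simp [emb_re, emb_im]
  exact (pow_left_inj₀ (norm_nonneg _) (norm_nonneg _) two_ne_zero).1 h1

theorem emb_smul (r : ℝ) (x : 𝕜) : emb (r • x) = r • emb x := by
  apply Complex.ext <;> simp [emb_re, emb_im, RCLike.smul_re, RCLike.smul_im]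

/-- `emb` as a continuous linear map -/
noncomputable def embL : 𝕜 →L[ℝ] ℂ :=
  LinearMap.mkContinuous ⟨⟨emb, fun x y => map_add emb x y⟩, fun r x => emb_smul r x⟩ 1
    (fun x => by simp [norm_emb])

theorem embL_apply (x : 𝕜) : embL x = emb x := rfl

/-- log(1+z)/z -/
noncomputable def gl : ℂ → ℂ := dslope (fun z => Complex.log (1 + z)) 0

theorem one_add_mem_slit {z : ℂ} (hz : ‖z‖ < 1) : 1 + z ∈ Complex.slitPlane :=
  Complex.mem_slitPlane_of_norm_lt_one hz

theorem gl_smooth : ContDiffOn ℝ ∞ gl (Metric.ball 0 1) := by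
  have h1 : DifferentiableOn ℂ (fun z => Complex.log (1 + z)) (Metric.ball 0 1) := by
    intro z hz
    have : ‖z‖ < 1 := by simpa using hz
    have h := one_add_mem_slit this
    exact (DifferentiableAt.clog (by fun_prop) h).differentiableWithinAt
  have h2 : DifferentiableOn ℂ gl (Metric.ball 0 1) :=
    (Complex.differentiableOn_dslope (Metric.ball_mem_nhds _ one_pos)).2 h1
  exact (h2.contDiffOn Metric.isOpen_ball).restrict_scalars ℝ

/-- log(1+cw)/c -/
noncomputable def Lq (c : ℝ) (w : ℂ) : ℂ := w * gl (c * w)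

theorem mul_gl {z : ℂ} : z * gl z = Complex.log (1 + z) := by
  by_cases h : z = 0
  · simp [h]
  · rw [gl, dslope_of_ne _ h, slope_def_field]; simp; field_simp

theorem c_mul_Lq (c : ℝ) (w : ℂ) : c * Lq c w = Complex.log (1 + c * w) := by
  rw [Lq, ← mul_assoc, mul_gl]

theorem c_mul_Lq_re (c : ℝ) (w : ℂ) : c * (Lq c w).re = Real.log ‖1 + c * w‖ := by
  rw [← Complex.log_re, ← c_mul_Lq]; simp

theorem Lq_smooth : ContDiffOn ℝ ∞ (fun z : ℝ × ℂ => Lq z.1 z.2) {z | ‖(z.1 : ℂ) * z.2‖ < 1} := by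
  have h : ContDiff ℝ ∞ fun z : ℝ × ℂ => (z.1 : ℂ) * z.2 :=
    (Complex.ofRealCLM.contDiff.comp contDiff_fst).mul contDiff_snd
  refine contDiff_snd.contDiffOn.mul (gl_smooth.comp h.contDiffOn ?_)
  intro z hz; simpa using hz

theorem Lq_deriv (c : ℝ) (w : ℂ) (h : ‖(c : ℂ) * w‖ < 1) : HasDerivAt (Lq c) (1 / (1 + c * w)) w := by
  by_cases hc : c = 0
  · subst hc
    have : Lq 0 = fun w => w := by
      funext w
      simp [Lq, gl, dslope_same]
      have : HasDerivAt (fun z : ℂ => Complex.log (1 + z)) (1 / (1 + 0)) 0 :=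
        HasDerivAt.clog ((hasDerivAt_id _).const_add 1) (by simp)
      rw [this.deriv]; simp
    rw [this]; simpa using hasDerivAt_id' w
  · have : Lq c = fun w => Complex.log (1 + c * w) / c := by
      funext w
      have hc' : (c : ℂ) ≠ 0 := by exact_mod_cast hc
      rw [← c_mul_Lq]; field_simp
    rw [this]
    have hc' : (c : ℂ) ≠ 0 := by exact_mod_cast hc
    have h1 : HasDerivAt (fun w : ℂ => 1 + c * w) c w := by
      simpa using ((hasDerivAt_id w).const_mul (c : ℂ)).const_add 1
    exact ((h1.clog (one_add_mem_slit h)).div_const (c : ℂ)).congr_deriv (by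
      rw [div_right_comm, div_self hc'])

theorem grad_phase (c : ℝ) (u : 𝕜 → 𝕜) (u' x : 𝕜) (hu : HasDerivAt u u' x)
    (h : ‖c • u x‖ < 1) (e : 𝕜) :
    HasDerivAt (fun s : ℝ => (Lq c (emb (u (x + s • e)))).re)
      (RCLike.re (u' / (1 + c * u x) * e)) 0 := by
  have h1 : HasDerivAt (fun s : ℝ => x + s • e) e 0 := by
    simpa using ((hasDerivAt_id (0 : ℝ)).smul_const e).const_add x
  have h2 : HasFDerivAt u (ContinuousLinearMap.restrictScalars ℝ
    (ContinuousLinearMap.toSpanSingleton 𝕜 u')) (x + (0 : ℝ) • e) := by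
    have := hu.hasFDerivAt.restrictScalars ℝ
    simpa using this
  have h3 := h2.comp_hasDerivAt (0 : ℝ) h1
  have h4 : HasDerivAt (fun s : ℝ => emb (u (x + s • e))) (emb (e * u')) 0 := by
    have := (embL (𝕜 := 𝕜)).hasFDerivAt.comp_hasDerivAt (0 : ℝ) h3
    simpa [embL_apply, Function.comp_def] using this
  have h5 : ‖(c : ℂ) * emb (u x)‖ < 1 := by
    rw [← Complex.real_smul, ← emb_smul, norm_emb]; exact h
  have h6 : HasDerivAt (Lq c) (1 / (1 + c * emb (u x))) (emb (u (x + (0 : ℝ) • e))) := by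
    simpa using Lq_deriv c _ h5
  have h7 := h6.scomp (0 : ℝ) h4
  have h8 := Complex.reCLM.hasFDerivAt.comp_hasDerivAt (0 : ℝ) h7
  refine h8.congr_deriv ?_
  change Complex.re _ = _
  rw [← emb_re]
  congr 1
  have : emb ((c : 𝕜)) = (c : ℂ) := by apply Complex.ext <;> simp [emb_re, emb_im]
  simp only [map_mul, map_div₀, map_add, map_one, this, smul_eq_mul]
  ring

theorem sum_re_sq (v : 𝕜) : ∑ j : Fin 2, (RCLike.re (v * (![1, RCLike.I] : Fin 2 → 𝕜) j)) ^ 2 = ‖v‖ ^ 2 := by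
  rw [RCLike.norm_sq_eq_def (z := v)]
  rcases RCLike.I_eq_zero_or_im_I_eq_one (K := 𝕜) with h | h
  · have : RCLike.im v = 0 := by
      have := RCLike.im_eq_zero h v; exact this
    simp [h, this]; ring
  · simp [Fin.sum_univ_two, RCLike.mul_re, h]; ring

variable {Pm : Type*} [NormedAddCommGroup Pm] [NormedSpace ℝ Pm]
  [MeasurableSpace 𝕜] [BorelSpace 𝕜]

theorem fderiv_line {q : 𝕜 × Pm → ℝ} {z : 𝕜 × Pm} (hq : DifferentiableAt ℝ q z) (e : 𝕜) {d : ℝ}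
    (h : HasDerivAt (fun s : ℝ => q (z.1 + s • e, z.2)) d 0) : fderiv ℝ q z (e, 0) = d := by
  have h1 := (hq.hasFDerivAt.hasLineDerivAt (e, 0))
  unfold HasLineDerivAt at h1
  have h2 : (fun s : ℝ => q (z + s • (e, (0 : Pm)))) = fun s : ℝ => q (z.1 + s • e, z.2) := by
    funext s; congr 1; ext <;> simp
  rw [h2] at h1
  exact h1.unique h

/-- Fourier decay -/
theorem nsp_fourier (μ : Measure 𝕜) [μ.IsAddHaarMeasure] (Ω : Set (𝕜 × Pm)) (hΩ : IsOpen Ω)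
    (S : Set 𝕜) (hS : IsCompact S) (KK : Set Pm) (hK : IsCompact KK) (hSK : S ×ˢ KK ⊆ Ω)
    (q : 𝕜 × Pm → ℝ) (hq : ContDiffOn ℝ ∞ q Ω)
    (hq0 : ∀ z ∈ S ×ˢ KK, ∑ j : Fin 2, (fderiv ℝ q z ((![1, RCLike.I] : Fin 2 → 𝕜) j, 0)) ^ 2 < 39)
    (N : ℕ) (a : 𝕜 × Pm → ℂ) (ha : ContDiffOn ℝ ∞ a Ω) (haS : ∀ x p, x ∉ S → a (x, p) = 0) :
      ∃ C, ∀ p ∈ KK, ∀ τ : ℝ, ∀ η : 𝕜, |τ| ≤ ‖η‖ → η ≠ 0 →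
        ‖η‖ ^ N * ‖∫ x, a (x, p) * Complex.exp (Complex.I * (τ * q (x, p)))
          * Complex.exp (-(2 * Real.pi * RCLike.re (η * x) : ℝ) * Complex.I) ∂μ‖ ≤ C := by
  set e : Fin 2 → 𝕜 := ![1, RCLike.I] with he
  set q' : 𝕜 × (Pm × ℝ × 𝕜) → ℝ := fun z => z.2.2.1 * q (z.1, z.2.1) - 2 * Real.pi * RCLike.re (z.2.2.2 * z.1)
    with hq'
  set Ω0 : Set (𝕜 × (Pm × ℝ × 𝕜)) := {z | (z.1, z.2.1) ∈ Ω} with hΩ0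
  have hΩ0o : IsOpen Ω0 := hΩ.preimage (f := fun z : 𝕜 × (Pm × ℝ × 𝕜) => (z.1, z.2.1)) (by fun_prop)
  have hpr : ContDiff ℝ ∞ (fun z : 𝕜 × (Pm × ℝ × 𝕜) => (z.1, z.2.1)) := by fun_prop
  have hq's : ContDiffOn ℝ ∞ q' Ω0 := by
    refine ContDiffOn.sub ?_ ?_
    · exact ContDiffOn.mul (by fun_prop) (hq.comp hpr.contDiffOn fun z hz => hz)
    · refine ContDiffOn.mul contDiffOn_const ?_
      have h1 : ContDiff ℝ ∞ fun z : 𝕜 × (Pm × ℝ × 𝕜) => z.2.2.2 * z.1 :=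
        (contDiff_snd.comp (contDiff_snd.comp contDiff_snd)).mul contDiff_fst
      exact ((RCLike.reCLM (K := 𝕜)).contDiff.comp h1).contDiffOn
  have hder : ∀ z ∈ Ω0, ∀ v : 𝕜, fderiv ℝ q' z (v, 0)
      = z.2.2.1 * fderiv ℝ q (z.1, z.2.1) (v, 0) - 2 * Real.pi * RCLike.re (z.2.2.2 * v) := by
    intro z hz v
    have d1 := (hq.contDiffAt (hΩ.mem_nhds hz)).differentiableAt (by simp)
    apply fderiv_line ((hq's.contDiffAt (hΩ0o.mem_nhds hz)).differentiableAt (by simp))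
    have h1 := d1.hasFDerivAt.hasLineDerivAt (v, 0)
    unfold HasLineDerivAt at h1
    have h2 : (fun s : ℝ => q ((z.1, z.2.1) + s • (v, (0 : Pm)))) = fun s : ℝ => q (z.1 + s • v, z.2.1) := by
      funext s; congr 1; ext <;> simp
    rw [h2] at h1
    have h3 : HasDerivAt (fun s : ℝ => RCLike.re (z.2.2.2 * (z.1 + s • v))) (RCLike.re (z.2.2.2 * v)) 0 := by
      have : (fun s : ℝ => RCLike.re (z.2.2.2 * (z.1 + s • v))) =
          fun s : ℝ => RCLike.re (z.2.2.2 * z.1) + s * RCLike.re (z.2.2.2 * v) := by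
        funext s
        rw [mul_add, map_add, mul_smul_comm, RCLike.smul_re]
      rw [this]
      simpa using ((hasDerivAt_id (0 : ℝ)).mul_const (RCLike.re (z.2.2.2 * v))).const_add
        (RCLike.re (z.2.2.2 * z.1))
    exact HasDerivAt.fun_sub (h1.const_mul z.2.2.1) (h3.const_mul _)
  set Ω' : Set (𝕜 × (Pm × ℝ × 𝕜)) := Ω0 ∩ {z | ∑ j, (fderiv ℝ q' z (e j, 0)) ^ 2 ≠ 0} with hΩ'
  have hΩ'o : IsOpen Ω' := by
    refine ContinuousOn.isOpen_inter_preimage (t := {0}ᶜ)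
      (f := fun z => ∑ j, (fderiv ℝ q' z (e j, 0)) ^ 2) ?_ hΩ0o isOpen_compl_singleton
    refine continuousOn_finsetSum _ fun j _ => ContinuousOn.pow ?_ 2
    exact ((hq's.fderiv_of_isOpen hΩ0o (m := ∞) (by simp)).clm_apply contDiffOn_const).continuousOn
  obtain ⟨C, hC⟩ := nsp μ e Ω' hΩ'o S hS
    (KK ×ˢ (Set.Icc (-1 : ℝ) 1 ×ˢ Metric.sphere (0 : 𝕜) 1))
    (hK.prod (isCompact_Icc.prod (isCompact_sphere _ _))) (by
      rintro ⟨x, p, κ, w⟩ ⟨hx, hp, hκ, hw⟩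
      have hm : (x, (p, κ, w)) ∈ Ω0 := hSK ⟨hx, hp⟩
      refine ⟨hm, ?_⟩
      simp only [Set.mem_ofPred_eq]
      intro h0
      rw [Finset.sum_eq_zero_iff_of_nonneg (fun _ _ => sq_nonneg _)] at h0
      have h1 : ∀ j, κ * fderiv ℝ q (x, p) (e j, 0) = 2 * Real.pi * RCLike.re (w * e j) := by
        intro j
        have := h0 j (Finset.mem_univ _)
        rw [hder _ hm] at this
        have := pow_eq_zero_iff (two_ne_zero) |>.1 this
        simp only at this
        linarith
      have h2 : κ ^ 2 * ∑ j, (fderiv ℝ q (x, p) (e j, 0)) ^ 2 = (2 * Real.pi) ^ 2 * ‖w‖ ^ 2 := by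
        rw [← sum_re_sq w, Finset.mul_sum, Finset.mul_sum]
        refine Finset.sum_congr rfl fun j _ => ?_
        rw [← mul_pow, ← mul_pow, h1 j]
      have h3 := hq0 (x, p) ⟨hx, hp⟩
      have h4 : ‖w‖ = 1 := by simpa using hw
      have h5 : κ ^ 2 ≤ 1 := by
        have := hκ.1; have := hκ.2; simp only at *; nlinarith
      have h6 : 0 ≤ ∑ j, (fderiv ℝ q (x, p) (e j, 0)) ^ 2 := Finset.sum_nonneg fun _ _ => sq_nonneg _
      rw [h4] at h2
      nlinarith [Real.pi_gt_d2])
    q' (hq's.mono Set.inter_subset_left) (fun z hz => hz.2) N (fun z => a (z.1, z.2.1))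
    ((ha.comp hpr.contDiffOn fun z hz => hz).mono Set.inter_subset_left)
    (fun x p hx => haS x p.1 hx)
  refine ⟨C, fun p hp τ η hτ hη => ?_⟩
  have hn : 0 < ‖η‖ := norm_pos_iff.2 hη
  have h := hC (p, τ / ‖η‖, ‖η‖⁻¹ • η) ⟨hp, ⟨by
    rw [le_div_iff₀ hn]; have := abs_le.1 hτ; linarith [this.1], by
    rw [div_le_iff₀ hn]; have := abs_le.1 hτ; linarith [this.2]⟩, by
    simp [norm_smul, hn.ne']⟩ ‖η‖
  rw [abs_of_pos hn] at h
  refine le_trans (le_of_eq ?_) h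
  congr 2
  refine integral_congr_ae (Eventually.of_forall fun x => ?_)
  simp only
  rw [mul_assoc, ← Complex.exp_add]
  congr 2
  have : ‖η‖ * q' (x, (p, τ / ‖η‖, ‖η‖⁻¹ • η)) = τ * q (x, p) - 2 * Real.pi * RCLike.re (η * x) := by
    simp only [hq', smul_mul_assoc, RCLike.smul_re]
    field_simp
  rw [← Complex.ofReal_mul ‖η‖, this]
  push_cast; ring

end Loc
end DZ
end

section
open MeasureTheory Filter Topology
open scoped ContDiff

namespace DZ

theorem cs_integral {A : Type*} [MeasurableSpace A] (μ : Measure A) (f : A → ℂ) (hf : StronglyMeasurable f)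
    (M : ℝ) (hM : ∀ a, ‖f a‖ ≤ M) (W : Set A) (hW : MeasurableSet W) (hWf : μ W < ⊤)
    (hs : ∀ a, a ∉ W → f a = 0) : ‖∫ a, f a ∂μ‖ ^ 2 ≤ μ.real W * ∫ a, ‖f a‖ ^ 2 ∂μ := by
  have hM0 : ∀ a, ‖f a‖ ^ 2 ≤ M ^ 2 := fun a => by gcongr; exact hM a
  have e1 : ∫ a, f a ∂μ = ∫ a in W, f a ∂μ :=
    (setIntegral_eq_integral_of_forall_compl_eq_zero hs).symm
  have e2 : ∫ a, ‖f a‖ ^ 2 ∂μ = ∫ a in W, ‖f a‖ ^ 2 ∂μ :=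
    (setIntegral_eq_integral_of_forall_compl_eq_zero (fun a ha => by simp [hs a ha])).symm
  have : IsFiniteMeasure (μ.restrict W) := ⟨by simpa using hWf⟩
  have i1 : Integrable (fun a => ‖f a‖) (μ.restrict W) :=
    Integrable.of_bound hf.norm.aestronglyMeasurable M (Eventually.of_forall fun a => by simpa using hM a)
  have i2 : Integrable (fun a => ‖f a‖ ^ 2) (μ.restrict W) :=
    Integrable.of_bound (hf.norm.pow 2).aestronglyMeasurable (M ^ 2)
      (Eventually.of_forall fun a => by simpa using hM0 a)
  rw [e1, e2]
  set I1 := ∫ a in W, ‖f a‖ ∂μ with hI1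
  set I2 := ∫ a in W, ‖f a‖ ^ 2 ∂μ with hI2
  have hI1n : ‖∫ a in W, f a ∂μ‖ ≤ I1 := norm_integral_le_integral_norm _
  have hI1p : 0 ≤ I1 := integral_nonneg fun _ => norm_nonneg _
  have hq : ∀ x : ℝ, 0 ≤ I2 - 2 * x * I1 + x ^ 2 * μ.real W := by
    intro x
    have : 0 ≤ ∫ a in W, (‖f a‖ - x) ^ 2 ∂μ := integral_nonneg fun _ => sq_nonneg _
    have e : ∫ a in W, (‖f a‖ - x) ^ 2 ∂μ = I2 - 2 * x * I1 + x ^ 2 * μ.real W := by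
      have : ∀ a, (‖f a‖ - x) ^ 2 = ‖f a‖ ^ 2 - 2 * x * ‖f a‖ + x ^ 2 := fun a => by ring
      simp_rw [this]
      have i3 : Integrable (fun a => ‖f a‖ ^ 2 - 2 * x * ‖f a‖) (μ.restrict W) := i2.sub (i1.const_mul _)
      rw [integral_add i3 (integrable_const _), integral_sub i2 (i1.const_mul _),
        integral_const_mul]
      simp [mul_comm, hI1, hI2]
    linarith
  have hd := discrim_le_zero (a := μ.real W) (b := -2 * I1) (c := I2) (fun x => by linarith [hq x])
  unfold discrim at hd
  calc ‖∫ a in W, f a ∂μ‖ ^ 2 ≤ I1 ^ 2 := by gcongr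
    _ ≤ _ := by nlinarith

theorem vdc {A : Type*} [AddCommGroup A] [MeasurableSpace A] [MeasurableAdd₂ A] [MeasurableNeg A]
    (μ : Measure A)
    [SFinite μ] [μ.IsAddLeftInvariant] (F : A → ℂ) (hF : StronglyMeasurable F) (M : ℝ)
    (hM : ∀ a, ‖F a‖ ≤ M) (U W D : Set A) (hU : MeasurableSet U) (hW : MeasurableSet W)
    (hD : MeasurableSet D) (hUf : μ U < ⊤) (hWf : μ W < ⊤) (hDf : μ D < ⊤)
    (hsupp : ∀ a, ∀ b ∈ U, F (a + b) ≠ 0 → a ∈ W) (hUD : ∀ b ∈ U, ∀ c ∈ U, b - c ∈ D) :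
    ‖∫ a, F a ∂μ‖ ^ 2 * μ.real U ≤
      μ.real W * ∫ b in D, ‖∫ a, F (a + b) * (starRingEnd ℂ) (F a) ∂μ‖ ∂μ := by
  have hM0 : 0 ≤ M := (norm_nonneg _).trans (hM 0)
  set T : A → ℂ := fun b => ∫ a, F (a + b) * (starRingEnd ℂ) (F a) ∂μ with hT
  set f : A → ℂ := fun a => ∫ b in U, F (a + b) ∂μ with hf
  have : IsFiniteMeasure (μ.restrict U) := ⟨by simpa using hUf⟩
  have : IsFiniteMeasure (μ.restrict W) := ⟨by simpa using hWf⟩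
  have : IsFiniteMeasure (μ.restrict D) := ⟨by simpa using hDf⟩
  have hFadd : StronglyMeasurable fun p : A × A => F (p.1 + p.2) :=
    hF.comp_measurable (measurable_fst.add measurable_snd)
  have hfm : StronglyMeasurable f := hFadd.integral_prod_right
  have hfb : ∀ a, ‖f a‖ ≤ M * μ.real U := fun a => by
    have := norm_setIntegral_le_of_norm_le_const (μ := μ) (s := U) (f := fun b => F (a + b)) (C := M) hUf
      (fun b _ => hM _)
    simpa using this
  have hfs : ∀ a, a ∉ W → f a = 0 := fun a ha => by
    refine setIntegral_eq_zero_of_forall_eq_zero fun b hb => ?_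
    by_contra h
    exact ha (hsupp a b hb h)
  have hcs := cs_integral μ f hfm _ hfb W hW hWf hfs
  -- ∫ f = μ U * ∫ F
  have e1 : ∫ a, f a ∂μ = μ.real U * ∫ a, F a ∂μ := by
    have : ∫ a, f a ∂μ = ∫ a in W, f a ∂μ :=
      (setIntegral_eq_integral_of_forall_compl_eq_zero hfs).symm
    rw [this, hf]
    rw [integral_integral_swap]
    · have : ∀ b ∈ U, ∫ a in W, F (a + b) ∂μ = ∫ a, F a ∂μ := by
        intro b hb
        rw [setIntegral_eq_integral_of_forall_compl_eq_zero]
        · exact integral_add_right_eq_self (μ := μ) F b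
        · intro a ha; by_contra h; exact ha (hsupp a b hb h)
      rw [setIntegral_congr_fun hU this]
      simp
    · refine Integrable.of_bound ?_ M (Eventually.of_forall fun p => hM _)
      exact hFadd.aestronglyMeasurable
  have e2 : ∫ a, ‖f a‖ ^ 2 ∂μ ≤ μ.real U * ∫ b in D, ‖T b‖ ∂μ := by
    have hTm : StronglyMeasurable T := by
      have : StronglyMeasurable fun p : A × A => F (p.2 + p.1) * (starRingEnd ℂ) (F p.2) := by
        refine StronglyMeasurable.mul (hF.comp_measurable (measurable_snd.add measurable_fst)) ?_
        exact (RCLike.continuous_conj).comp_stronglyMeasurable (hF.comp_measurable measurable_snd)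
      exact this.integral_prod_right
    have h1 : ∀ a, ((‖f a‖ ^ 2 : ℝ) : ℂ) = ∫ c in U, ∫ b in U, F (a + b) * (starRingEnd ℂ) (F (a + c)) ∂μ ∂μ := by
      intro a
      simp_rw [integral_mul_const]
      rw [integral_const_mul, integral_conj, Complex.mul_conj, Complex.normSq_eq_norm_sq]
    have h2 : ((∫ a, ‖f a‖ ^ 2 ∂μ : ℝ) : ℂ) = ∫ c in U, ∫ b in U, T (b - c) ∂μ ∂μ := by
      have : ∫ a, ‖f a‖ ^ 2 ∂μ = ∫ a in W, ‖f a‖ ^ 2 ∂μ :=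
        (setIntegral_eq_integral_of_forall_compl_eq_zero (fun a ha => by simp [hfs a ha])).symm
      rw [this, ← integral_complex_ofReal]
      simp_rw [h1]
      have hm3 : StronglyMeasurable fun p : A × A × A => F (p.1 + p.2.1) * (starRingEnd ℂ) (F (p.1 + p.2.2)) := by
        refine StronglyMeasurable.mul (hF.comp_measurable (measurable_fst.add measurable_snd.fst)) ?_
        exact (RCLike.continuous_conj).comp_stronglyMeasurable
          (hF.comp_measurable (measurable_fst.add measurable_snd.snd))
      have hb3 : ∀ a b c, ‖F (a + b) * (starRingEnd ℂ) (F (a + c))‖ ≤ M * M := fun a b c => by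
        rw [norm_mul, RCLike.norm_conj]
        exact mul_le_mul (hM _) (hM _) (norm_nonneg _) hM0
      rw [integral_integral_swap]
      · refine setIntegral_congr_fun hU fun c hc => ?_
        rw [integral_integral_swap]
        · refine setIntegral_congr_fun hU fun b hb => ?_
          simp only [hT]
          rw [setIntegral_eq_integral_of_forall_compl_eq_zero]
          · rw [← integral_add_right_eq_self (μ := μ) (fun a => F (a + (b - c)) * (starRingEnd ℂ) (F a)) c]
            refine integral_congr_ae (Eventually.of_forall fun a => ?_)
            dsimp only
            rw [show a + c + (b - c) = a + b by abel]
          · intro a ha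
            have : F (a + b) = 0 := by by_contra h; exact ha (hsupp a b hb h)
            simp [this]
        · refine Integrable.of_bound ?_ (M * M) (Eventually.of_forall fun p => hb3 _ _ _)
          exact (hm3.comp_measurable (g := fun p : A × A => (p.1, p.2, c)) (by fun_prop)).aestronglyMeasurable
      · refine Integrable.of_bound ?_ (M * M * μ.real U) (Eventually.of_forall fun p => ?_)
        · have : StronglyMeasurable fun q : (A × A) × A => F (q.1.1 + q.2) * (starRingEnd ℂ) (F (q.1.1 + q.1.2)) :=
            hm3.comp_measurable (g := fun q : (A × A) × A => (q.1.1, q.2, q.1.2)) (by fun_prop)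
          exact (this.integral_prod_right (ν := μ.restrict U)).aestronglyMeasurable
        · have := norm_setIntegral_le_of_norm_le_const (μ := μ) (s := U)
            (f := fun c => F (p.1 + c) * (starRingEnd ℂ) (F (p.1 + p.2))) (C := M * M) hUf
            (fun c _ => hb3 _ _ _)
          simpa [Function.uncurry] using this
    rcases U.eq_empty_or_nonempty with hU0 | ⟨c0, hc0⟩
    · have : f = fun _ => 0 := by funext a; simp [hf, hU0]
      simp [this, hU0]
    have hTW : ∀ b, ‖T b‖ ≤ M * M * μ.real ((fun a => a + -c0) ⁻¹' W) := by
      intro b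
      have e : T b = ∫ a in (fun a => a + -c0) ⁻¹' W, F (a + b) * (starRingEnd ℂ) (F a) ∂μ := by
        rw [setIntegral_eq_integral_of_forall_compl_eq_zero]
        intro a ha
        have : F a = 0 := by
          by_contra h
          exact ha (hsupp (a + -c0) c0 hc0 (by simpa using h))
        simp [this]
      rw [e]
      refine norm_setIntegral_le_of_norm_le_const ?_ (fun a _ => ?_)
      · rw [measure_preimage_add_right]; exact hWf
      · rw [norm_mul, RCLike.norm_conj]
        exact mul_le_mul (hM _) (hM _) (norm_nonneg _) hM0
    have hTi : Integrable (D.indicator fun b => ‖T b‖) μ := by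
      rw [integrable_indicator_iff hD]
      exact Integrable.of_bound hTm.norm.aestronglyMeasurable _
        (Eventually.of_forall fun b => by simpa using hTW b)
    have h3 : ∀ c ∈ U, ∫ b in U, ‖T (b - c)‖ ∂μ ≤ ∫ b in D, ‖T b‖ ∂μ := by
      intro c hc
      rw [← integral_indicator hU, ← integral_indicator hD,
        ← integral_sub_right_eq_self (μ := μ) (D.indicator fun b => ‖T b‖) c]
      refine integral_mono_of_nonneg (Eventually.of_forall fun b => ?_) (hTi.comp_sub_right c)
        (Eventually.of_forall fun b => ?_)
      · exact Set.indicator_nonneg (fun _ _ => norm_nonneg _) _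
      · by_cases hb : b ∈ U
        · simp [hb, hUD b hb c hc]
        · simp only [Set.indicator_of_notMem hb]
          exact Set.indicator_nonneg (fun _ _ => norm_nonneg _) _
    have h4 : ∫ a, ‖f a‖ ^ 2 ∂μ = ‖((∫ a, ‖f a‖ ^ 2 ∂μ : ℝ) : ℂ)‖ := by
      rw [Complex.norm_real, Real.norm_of_nonneg]
      exact integral_nonneg fun _ => sq_nonneg _
    rw [h4, h2, mul_comm]
    refine norm_setIntegral_le_of_norm_le_const hUf fun c hc => ?_
    exact (norm_integral_le_integral_norm _).trans (h3 c hc)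
  rw [e1, norm_mul, Complex.norm_real, Real.norm_of_nonneg measureReal_nonneg, mul_pow] at hcs
  rcases (measureReal_nonneg (μ := μ) (s := U)).eq_or_lt with h0 | h0
  · rw [← h0, mul_zero]
    exact mul_nonneg measureReal_nonneg (integral_nonneg fun _ => norm_nonneg _)
  · have : μ.real U * (‖∫ a, F a ∂μ‖ ^ 2 * μ.real U) ≤ μ.real U * (μ.real W * ∫ b in D, ‖T b‖ ∂μ) := by
      have := mul_le_mul_of_nonneg_left e2 (measureReal_nonneg (μ := μ) (s := W))
      nlinarith
    exact le_of_mul_le_mul_left this h0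

end DZ
end

section
open MeasureTheory Filter Topology
open scoped ContDiff

namespace DZ

/-- the basic bump function -/
noncomputable def bmp : ContDiffBump (1 : ℝ) := ⟨1 / 10, 9 / 25, by norm_num, by norm_num⟩

theorem bmp_supp {y : ℝ} (h : bmp y ≠ 0) : 16 / 25 < y ∧ y < 34 / 25 := by
  have : y ∈ Function.support bmp := h
  rw [ContDiffBump.support_eq] at this
  have h2 : |y - 1| < 9 / 25 := by simpa [Real.dist_eq, bmp] using this
  rw [abs_lt] at h2
  constructor <;> linarith [h2.1, h2.2]

set_option linter.unusedSectionVars false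

section Loc
variable {𝕜 : Type*} [RCLike 𝕜]

theorem contDiff_nsq : ContDiff ℝ ∞ fun x : 𝕜 => ‖x‖ ^ 2 := by
  have : (fun x : 𝕜 => ‖x‖ ^ 2) = fun x : 𝕜 => RCLike.reCLM x * RCLike.reCLM x + RCLike.imCLM x * RCLike.imCLM x := by
    funext x; rw [RCLike.norm_sq_eq_def]; rfl
  rw [this]
  have h1 := (RCLike.reCLM (K := 𝕜)).contDiff (n := ∞)
  have h2 := (RCLike.imCLM (K := 𝕜)).contDiff (n := ∞)
  exact (h1.mul h1).add (h2.mul h2)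

/-- amplitude -/
noncomputable def phi (σ : ℝ) (x : 𝕜) : ℝ := bmp (‖x‖ ^ 2) * Real.exp (-(σ / 2) * Real.log (‖x‖ ^ 2))

/-- local test function -/
noncomputable def Fl (σ t : ℝ) (x : 𝕜) : ℂ :=
  (phi σ x : ℂ) * Complex.exp (Complex.I * ((-t : ℝ) * (Real.log ‖x‖ : ℝ)))

variable (𝕜) in
/-- annulus -/
def Ann : Set 𝕜 := {x | 4 / 5 ≤ ‖x‖ ∧ ‖x‖ ≤ 6 / 5}

theorem ann_compact : IsCompact (Ann 𝕜) := by
  have h1 : IsClosed (Ann 𝕜) :=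
    (isClosed_le continuous_const continuous_norm).inter (isClosed_le continuous_norm continuous_const)
  refine (isCompact_closedBall (0 : 𝕜) (6 / 5)).of_isClosed_subset h1 ?_
  intro x hx; simpa using hx.2

theorem phi_supp {σ : ℝ} {x : 𝕜} (h : phi σ x ≠ 0) : x ∈ Ann 𝕜 := by
  have := bmp_supp (left_ne_zero_of_mul h)
  have hx := norm_nonneg x
  constructor <;> nlinarith [this.1, this.2]

theorem phi_nonneg (σ : ℝ) (x : 𝕜) : 0 ≤ phi σ x := mul_nonneg bmp.nonneg (Real.exp_pos _).le

theorem phi_le {σ : ℝ} (h0 : 0 ≤ σ) (h4 : σ ≤ 4) (x : 𝕜) : phi σ x ≤ 3 := by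
  by_cases h : phi σ x = 0
  · rw [h]; norm_num
  have := bmp_supp (left_ne_zero_of_mul h)
  have h1 : bmp (‖x‖ ^ 2) ≤ 1 := bmp.le_one
  have h2 : -(σ / 2) * Real.log (‖x‖ ^ 2) ≤ 1 := by
    have : -(1 / 2) ≤ Real.log (‖x‖ ^ 2) := by
      have h3 : -Real.log (‖x‖ ^ 2) ≤ 1 / 2 := by
        rw [← Real.log_inv]
        refine (Real.log_le_log (inv_pos.2 (by linarith [this.1])) (?_ : (‖x‖ ^ 2)⁻¹ ≤ 25 / 16)).trans ?_
        · rw [inv_le_comm₀ (by linarith) (by norm_num)]; norm_num; linarith [this.1]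
        · rw [Real.log_le_iff_le_exp (by norm_num)]
          have := Real.add_one_le_exp (1/4 : ℝ)
          have h5 : Real.exp (1/2) = Real.exp (1/4) ^ 2 := by rw [← Real.exp_nat_mul]; norm_num
          rw [h5]; nlinarith
      linarith
    nlinarith
  have h3 : Real.exp (-(σ / 2) * Real.log (‖x‖ ^ 2)) ≤ 3 :=
    (Real.exp_le_exp.2 h2).trans (by linarith [Real.exp_one_lt_d9])
  have h6 : 0 ≤ bmp (‖x‖ ^ 2) := bmp.nonneg
  unfold phi
  have := Real.exp_pos (-(σ / 2) * Real.log (‖x‖ ^ 2))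
  nlinarith

theorem Fl_norm (σ t : ℝ) (x : 𝕜) : ‖Fl σ t x‖ = phi σ x := by
  rw [Fl, norm_mul, Complex.norm_real, Real.norm_of_nonneg (phi_nonneg _ _),
    ← Complex.ofReal_mul, mul_comm Complex.I, Complex.norm_exp_ofReal_mul_I, mul_one]

theorem phi_smooth : ContDiffOn ℝ ∞ (fun z : 𝕜 × ℝ => phi z.2 z.1) {z | z.1 ≠ 0} := by
  have h : ContDiffOn ℝ ∞ (fun z : 𝕜 × ℝ => ‖z.1‖ ^ 2) {z | z.1 ≠ 0} :=
    (contDiff_nsq.comp contDiff_fst).contDiffOn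
  refine (bmp.contDiff.comp_contDiffOn h).mul (Real.contDiff_exp.comp_contDiffOn ?_)
  refine ContDiffOn.mul (by fun_prop) (h.log ?_)
  intro z hz
  have : z.1 ≠ 0 := hz
  simpa using this

theorem phi_continuous (σ : ℝ) : Continuous (phi σ : 𝕜 → ℝ) := by
  rw [continuous_iff_continuousAt]
  intro x
  by_cases hx : x = 0
  · have : ∀ᶠ y in 𝓝 x, phi σ y = 0 := by
      have : ∀ᶠ y in 𝓝 x, ‖y‖ < 4 / 5 := by
        subst hx
        exact continuous_norm.continuousAt.eventually_lt continuousAt_const (by norm_num)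
      filter_upwards [this] with y hy
      by_contra h
      have := (phi_supp h).1
      linarith
    refine ContinuousAt.congr (f := fun _ => 0) continuousAt_const ?_
    filter_upwards [this] with y hy using hy.symm
  · have hc := (phi_smooth (𝕜 := 𝕜)).continuousOn.continuousAt (x := (x, σ))
      ((isOpen_ne.preimage continuous_fst).mem_nhds hx)
    exact hc.comp (f := fun y : 𝕜 => (y, σ)) (by fun_prop)

theorem Fl_continuous (σ t : ℝ) : Continuous (Fl σ t : 𝕜 → ℂ) := by
  rw [continuous_iff_continuousAt]
  intro x
  by_cases hx : x = 0
  · have : ∀ᶠ y in 𝓝 x, Fl σ t y = 0 := by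
      have : ∀ᶠ y in 𝓝 x, ‖y‖ < 4 / 5 := by
        subst hx
        exact continuous_norm.continuousAt.eventually_lt continuousAt_const (by norm_num)
      filter_upwards [this] with y hy
      by_contra h
      have := (phi_supp (σ := σ) (x := y) (by rw [← Fl_norm σ t]; simpa using h)).1
      linarith
    refine ContinuousAt.congr (f := fun _ => 0) continuousAt_const ?_
    filter_upwards [this] with y hy using hy.symm
  · refine ContinuousAt.mul (Complex.continuous_ofReal.continuousAt.comp (phi_continuous σ).continuousAt) ?_
    refine ContinuousAt.cexp (ContinuousAt.mul continuousAt_const (ContinuousAt.mul continuousAt_const ?_))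
    refine Complex.continuous_ofReal.continuousAt.comp ?_
    exact ContinuousAt.log continuous_norm.continuousAt (by simpa using hx)

theorem Fl_supp {σ t : ℝ} {x : 𝕜} (h : Fl σ t x ≠ 0) : x ∈ Ann 𝕜 := by
  apply phi_supp (σ := σ); rw [← Fl_norm σ t]; simpa using h

variable [MeasurableSpace 𝕜] [BorelSpace 𝕜]

/-- character -/
noncomputable def chr (η x : 𝕜) : ℂ := Complex.exp (-(2 * Real.pi * RCLike.re (η * x) : ℝ) * Complex.I)

theorem combine_decay {I : ℝ} {C0 C1 τ y : ℝ} {N : ℕ} (hI : 0 ≤ I) (h0 : I ≤ C0) (hy : 0 ≤ y)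
    (h1 : |τ| ≤ y → 0 < y → y ^ N * I ≤ C1) (hC1 : 0 ≤ C1) : (1 + y / (1 + |τ|)) ^ N * I ≤ 2 ^ N * (C0 + C1) := by
  have hτ := abs_nonneg τ
  have hp : 0 < 1 + |τ| := by positivity
  rcases le_total y (1 + |τ|) with h | h
  · have : y / (1 + |τ|) ≤ 1 := (div_le_one hp).2 h
    calc (1 + y / (1 + |τ|)) ^ N * I ≤ 2 ^ N * C0 := by
          gcongr
          linarith
      _ ≤ _ := by gcongr; linarith
  · have h3 : 1 + y / (1 + |τ|) ≤ 2 * y := by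
      have : y / (1 + |τ|) ≤ y := div_le_self hy (by linarith)
      linarith
    calc (1 + y / (1 + |τ|)) ^ N * I ≤ (2 * y) ^ N * I := by gcongr
      _ = 2 ^ N * (y ^ N * I) := by rw [mul_pow]; ring
      _ ≤ 2 ^ N * C1 := by gcongr; exact h1 (by linarith) (by linarith)
      _ ≤ _ := by gcongr; linarith

theorem triv_bound (μ : Measure 𝕜) [μ.IsAddHaarMeasure] {f : 𝕜 → ℂ} {M : ℝ} (h : ∀ x, ‖f x‖ ≤ M)
    (hs : ∀ x, x ∉ Ann 𝕜 → f x = 0) : ‖∫ x, f x ∂μ‖ ≤ M * μ.real (Ann 𝕜) := by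
  rw [← setIntegral_eq_integral_of_forall_compl_eq_zero (s := Ann 𝕜) hs]
  exact norm_setIntegral_le_of_norm_le_const ann_compact.measure_lt_top fun x _ => h x

theorem norm_chr (η x : 𝕜) : ‖chr η x‖ = 1 := by
  rw [chr, ← Complex.ofReal_neg, Complex.norm_exp_ofReal_mul_I]

/-- L0 -/
theorem L0 (μ : Measure 𝕜) [μ.IsAddHaarMeasure] (N : ℕ) : ∃ C, ∀ σ ∈ Set.Icc (0 : ℝ) 4, ∀ t : ℝ, ∀ η : 𝕜,
    (1 + ‖η‖ / (1 + |t|)) ^ N * ‖∫ x, Fl σ t x * chr η x ∂μ‖ ≤ C := by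
  have hO : IsOpen {z : 𝕜 × ℝ | z.1 ≠ 0} := isOpen_ne.preimage continuous_fst
  have hqs : ContDiffOn ℝ ∞ (fun z : 𝕜 × ℝ => Real.log ‖z.1‖) {z | z.1 ≠ 0} := by
    have : (fun z : 𝕜 × ℝ => Real.log ‖z.1‖) = fun z => (1 / 2) * Real.log (‖z.1‖ ^ 2) := by
      funext z; rw [Real.log_pow]; push_cast; ring
    rw [this]
    refine ContDiffOn.mul (by fun_prop) (ContDiffOn.log (contDiff_nsq.comp contDiff_fst).contDiffOn ?_)
    intro z hz
    have : z.1 ≠ 0 := hz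
    simpa using this
  obtain ⟨C, hC⟩ := nsp_fourier μ {z : 𝕜 × ℝ | z.1 ≠ 0} hO (Ann 𝕜)
    ann_compact (Set.Icc (0 : ℝ) 4) isCompact_Icc (by
      rintro ⟨x, p⟩ ⟨hx, -⟩ h0
      have : x = 0 := h0
      have := hx.1
      simp_all; norm_num at this) (fun z => Real.log ‖z.1‖) hqs (by
      rintro ⟨x, p⟩ ⟨hx, -⟩
      have hx1 : 4 / 5 ≤ ‖x‖ := hx.1
      have hx0 : x ≠ 0 := by intro h; rw [h, norm_zero] at hx1; linarith
      have : ∀ e : 𝕜, fderiv ℝ (fun z : 𝕜 × ℝ => Real.log ‖z.1‖) (x, p) (e, 0) = RCLike.re (x⁻¹ * e) := by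
        intro e
        apply fderiv_line ((hqs.contDiffAt (hO.mem_nhds hx0)).differentiableAt (by simp))
        have h1 := grad_phase 1 (fun y : 𝕜 => (y - x) / x) x⁻¹ x (by
          have h2 : HasDerivAt (fun y : 𝕜 => (y - x) / x) (1 / x) x :=
            ((hasDerivAt_id' x).sub_const x).div_const x
          simpa using h2) (by simp) e
        have h3 : ∀ᶠ s : ℝ in 𝓝 0, x + s • e ≠ 0 := by
          refine ContinuousAt.eventually_ne (g := fun s : ℝ => x + s • e) ?_ (by simpa using hx0)
          fun_prop
        have h4 := h1.add_const (Real.log ‖x‖)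
        refine (h4.congr_of_eventuallyEq ?_).congr_deriv (by simp)
        filter_upwards [h3] with s hs
        have h5 := c_mul_Lq_re 1 (emb ((x + s • e - x) / x))
        rw [one_mul] at h5
        rw [h5, Complex.ofReal_one, one_mul, ← map_one (emb : 𝕜 →+* ℂ), ← map_add, norm_emb]
        have : 1 + (x + s • e - x) / x = (x + s • e) / x := by field_simp; ring
        rw [this, norm_div, Real.log_div (by simpa using hs) (by simpa using hx0)]
        simp
      simp_rw [this]
      rw [sum_re_sq, norm_inv]
      have : ‖x‖⁻¹ ≤ 5 / 4 := by
        rw [inv_le_comm₀ (by linarith) (by norm_num)]; norm_num; linarith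
      have h0 : 0 ≤ ‖x‖⁻¹ := by positivity
      nlinarith) N (fun z => (phi z.2 z.1 : ℂ))
    (Complex.ofRealCLM.contDiff.comp_contDiffOn phi_smooth)
    (fun x p hx => by by_contra h; exact hx (phi_supp (by exact_mod_cast h)))
  refine ⟨2 ^ N * (3 * μ.real (Ann 𝕜) + |C|), fun σ hσ t η => ?_⟩
  refine combine_decay (norm_nonneg _) ?_ (norm_nonneg _) ?_ (abs_nonneg _)
  · refine triv_bound μ (fun x => ?_) fun x hx => ?_
    · rw [norm_mul, norm_chr, mul_one, Fl_norm]; exact phi_le hσ.1 hσ.2 x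
    · have : Fl σ t x = 0 := by by_contra h; exact hx (Fl_supp h)
      simp [this]
  · intro h1 h2
    have := hC σ hσ (-t) η (by simpa using h1) (norm_pos_iff.1 h2)
    exact this.trans (le_abs_self C)

end Loc
end DZ
end

section
open MeasureTheory Filter Topology
open scoped ContDiff

namespace DZ

set_option linter.unusedSectionVars false

section Loc
variable {𝕜 : Type*} [RCLike 𝕜]

/-- differenced function -/
noncomputable def Gl (σ t : ℝ) (b x : 𝕜) : ℂ := Fl σ t (x + b) * (starRingEnd ℂ) (Fl σ t x)

theorem polar (b : 𝕜) : ∃ w : 𝕜, ‖w‖ = 1 ∧ b = ‖b‖ • w := by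
  by_cases h : b = 0
  · exact ⟨1, by simp, by simp [h]⟩
  · have : ‖b‖ ≠ 0 := by simpa using h
    refine ⟨‖b‖⁻¹ • b, by simp [norm_smul, this], by rw [smul_smul, mul_inv_cancel₀ this, one_smul]⟩

theorem Fl_mul_conj (σ t : ℝ) (x y : 𝕜) : Fl σ t x * (starRingEnd ℂ) (Fl σ t y) =
    ((phi σ y * phi σ x : ℝ) : ℂ) *
      Complex.exp (Complex.I * ((-t : ℝ) * (Real.log ‖x‖ - Real.log ‖y‖ : ℝ))) := by
  rw [Fl, Fl, map_mul, ← Complex.exp_conj, map_mul, map_mul, Complex.conj_I, Complex.conj_ofReal,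
    Complex.conj_ofReal, Complex.conj_ofReal]
  rw [mul_mul_mul_comm, ← Complex.exp_add]
  push_cast
  congr 1
  · ring
  · congr 1; ring

theorem Gl_supp {σ t : ℝ} {b x : 𝕜} (h : Gl σ t b x ≠ 0) : x ∈ Ann 𝕜 ∧ x + b ∈ Ann 𝕜 :=
  ⟨Fl_supp (σ := σ) (t := t) fun h0 => h (by simp [Gl, h0]), Fl_supp (σ := σ) (t := t) fun h0 => h (by simp [Gl, h0])⟩

theorem Gl_norm {σ t : ℝ} (hσ : σ ∈ Set.Icc (0 : ℝ) 4) (b x : 𝕜) : ‖Gl σ t b x‖ ≤ 9 := by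
  rw [Gl, norm_mul, RCLike.norm_conj, Fl_norm, Fl_norm]
  have := phi_le hσ.1 hσ.2 x
  have := phi_le hσ.1 hσ.2 (x + b)
  have := phi_nonneg σ x
  have := phi_nonneg σ (x + b)
  nlinarith

theorem Gl_continuous (σ t : ℝ) (b : 𝕜) : Continuous (Gl σ t b) := by
  have := Fl_continuous (𝕜 := 𝕜) σ t
  exact (this.comp (by fun_prop)).mul (RCLike.continuous_conj.comp this)

/-- phase for the first difference -/
noncomputable def q1 (z : 𝕜 × ℝ × ℝ × 𝕜) : ℝ := (Lq z.2.2.1 (emb (z.2.2.2 / z.1))).re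

/-- domain -/
def Om1 (𝕜 : Type*) [RCLike 𝕜] : Set (𝕜 × ℝ × ℝ × 𝕜) :=
  {z | z.1 ≠ 0 ∧ z.2.2.2 ≠ 0 ∧ z.1 + z.2.2.1 • z.2.2.2 ≠ 0 ∧ ‖z.2.2.1 • z.2.2.2‖ < ‖z.1‖}

theorem Om1_open : IsOpen (Om1 𝕜) := by
  refine IsOpen.inter ?_ (IsOpen.inter ?_ (IsOpen.inter ?_ ?_))
  · exact isOpen_ne_fun (by fun_prop) (by fun_prop)
  · exact isOpen_ne_fun (by fun_prop) (by fun_prop)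
  · exact isOpen_ne_fun (by fun_prop) (by fun_prop)
  · exact isOpen_lt (f := fun z : 𝕜 × ℝ × ℝ × 𝕜 => ‖z.2.2.1 • z.2.2.2‖) (g := fun z => ‖z.1‖) (by fun_prop) (by fun_prop)

theorem emb_smooth : ContDiff ℝ ∞ (emb : 𝕜 → ℂ) := (embL (𝕜 := 𝕜)).contDiff

theorem q1_smooth : ContDiffOn ℝ ∞ (q1 (𝕜 := 𝕜)) (Om1 𝕜) := by
  refine Complex.reCLM.contDiff.comp_contDiffOn (f := fun z : 𝕜 × ℝ × ℝ × 𝕜 => Lq z.2.2.1 (emb (z.2.2.2 / z.1))) ?_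
  refine Lq_smooth.comp (g := fun z : ℝ × ℂ => Lq z.1 z.2)
    (f := fun z : 𝕜 × ℝ × ℝ × 𝕜 => (z.2.2.1, emb (z.2.2.2 / z.1))) ?_ ?_
  · refine ContDiffOn.prodMk (by fun_prop) (emb_smooth.comp_contDiffOn ?_)
    have h1 : ContDiffOn ℝ ∞ (fun z : 𝕜 × ℝ × ℝ × 𝕜 => z.2.2.2) (Om1 𝕜) := by fun_prop
    have h2 : ContDiffOn ℝ ∞ (fun z : 𝕜 × ℝ × ℝ × 𝕜 => z.1) (Om1 𝕜) := by fun_prop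
    have h3 := h1.mul (h2.inv fun z hz => hz.1)
    simpa [div_eq_mul_inv] using h3
  · rintro ⟨x, σ, r, w⟩ ⟨h1, h2, h3, h4⟩
    simp only [Set.mem_ofPred_eq] at *
    rw [← Complex.real_smul, ← emb_smul, norm_emb, ← smul_div_assoc, norm_div, div_lt_one (norm_pos_iff.2 h1)]
    exact h4

theorem q1_grad (z : 𝕜 × ℝ × ℝ × 𝕜) (hz : z ∈ Om1 𝕜) :
    ∑ j : Fin 2, (fderiv ℝ q1 z ((![1, RCLike.I] : Fin 2 → 𝕜) j, 0)) ^ 2 =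
      (‖z.2.2.2‖ / (‖z.1‖ * ‖z.1 + z.2.2.1 • z.2.2.2‖)) ^ 2 := by
  obtain ⟨x, σ, r, w⟩ := z
  have hz' := hz
  obtain ⟨h1, h2, h3, h4⟩ := hz
  simp only at *
  have : ∀ e : 𝕜, fderiv ℝ q1 (x, σ, r, w) (e, 0) = RCLike.re (-w / (x * (x + r • w)) * e) := by
    intro e
    apply fderiv_line ((q1_smooth.contDiffAt (Om1_open.mem_nhds hz')).differentiableAt (by simp))
    have hu : HasDerivAt (fun y : 𝕜 => w / y) (-w / x ^ 2) x := by
      have := (hasDerivAt_inv h1).const_mul w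
      simp only [div_eq_mul_inv]
      exact this.congr_deriv (by ring)
    have h5 := grad_phase r (fun y : 𝕜 => w / y) (-w / x ^ 2) x hu (by
      rw [← smul_div_assoc, norm_div, div_lt_one (norm_pos_iff.2 h1)]
      exact h4) e
    refine h5.congr_deriv ?_
    congr 2
    rw [RCLike.real_smul_eq_coe_mul] at h3 ⊢
    have : 1 + (r : 𝕜) * (w / x) = (x + r * w) / x := by field_simp
    rw [this]
    field_simp
  simp_rw [this]
  rw [sum_re_sq]
  simp

theorem G_eq (σ t r : ℝ) (w : 𝕜) (x : 𝕜) : Gl σ t (r • w) x =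
    ((phi σ x * phi σ (x + r • w) : ℝ) : ℂ) *
      Complex.exp (Complex.I * ((-(t * r) : ℝ) * (q1 (x, σ, r, w) : ℝ))) := by
  rw [Gl, Fl_mul_conj]
  by_cases h0 : phi σ x * phi σ (x + r • w) = 0
  · rw [h0]; simp
  congr 3
  have hx := (phi_supp (left_ne_zero_of_mul h0)).1
  have hx' := (phi_supp (right_ne_zero_of_mul h0)).1
  have e1 : r * q1 (x, σ, r, w) = Real.log ‖x + r • w‖ - Real.log ‖x‖ := by
    simp only [q1]
    rw [c_mul_Lq_re, ← Real.log_div (by linarith) (by linarith), ← norm_div, ← Complex.real_smul,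
      ← emb_smul, ← map_one (emb : 𝕜 →+* ℂ), ← map_add, norm_emb]
    have hx0 : x ≠ 0 := by intro h; rw [h, norm_zero] at hx; linarith
    congr 2
    rw [add_div, div_self hx0, smul_div_assoc]
  rw [← e1]
  push_cast; ring

theorem G_eq2 (σ t : ℝ) (b w : 𝕜) (h : b = ‖b‖ • w) : Gl σ t b = fun x =>
    ((phi σ x * phi σ (x + ‖b‖ • w) : ℝ) : ℂ) *
      Complex.exp (Complex.I * ((-(t * ‖b‖) : ℝ) * (q1 (x, σ, ‖b‖, w) : ℝ))) := by
  funext x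
  rw [← G_eq, ← h]

variable [MeasurableSpace 𝕜] [BorelSpace 𝕜]

theorem K1_sub {x w : 𝕜} {r : ℝ} (hx : x ∈ Ann 𝕜) (hr : r ∈ Set.Icc (0 : ℝ) (1 / 10)) (hw : ‖w‖ = 1) :
    ‖r • w‖ ≤ 1 / 10 ∧ 7 / 10 ≤ ‖x + r • w‖ := by
  have h1 : ‖r • w‖ ≤ 1 / 10 := by rw [norm_smul, hw, Real.norm_of_nonneg hr.1, mul_one]; exact hr.2
  refine ⟨h1, ?_⟩
  have := norm_sub_le (x + r • w) (r • w)
  rw [add_sub_cancel_right] at this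
  linarith [hx.1]

theorem pow_one_add_le {N : ℕ} {y I C0 C1 : ℝ} (hy : 0 ≤ y) (hI : 0 ≤ I) (h0 : I ≤ C0) (h1 : y ^ N * I ≤ C1) :
    (1 + y) ^ N * I ≤ 2 ^ N * (C0 + C1) := by
  have : 0 ≤ y ^ N * I := by positivity
  rcases le_total y 1 with h | h
  · calc (1 + y) ^ N * I ≤ 2 ^ N * C0 := by gcongr; linarith
      _ ≤ _ := by gcongr; linarith
  · calc (1 + y) ^ N * I ≤ (2 * y) ^ N * I := by gcongr; linarith
      _ = 2 ^ N * (y ^ N * I) := by rw [mul_pow]; ring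
      _ ≤ _ := by gcongr; linarith

theorem a1_smooth : ContDiffOn ℝ ∞ (fun z : 𝕜 × ℝ × ℝ × 𝕜 =>
    ((phi z.2.1 z.1 * phi z.2.1 (z.1 + z.2.2.1 • z.2.2.2) : ℝ) : ℂ)) (Om1 𝕜) := by
  refine Complex.ofRealCLM.contDiff.comp_contDiffOn (ContDiffOn.mul ?_ ?_)
  · exact phi_smooth.comp (f := fun z : 𝕜 × ℝ × ℝ × 𝕜 => (z.1, z.2.1)) (by fun_prop) fun z hz => hz.1
  · exact phi_smooth.comp (f := fun z : 𝕜 × ℝ × ℝ × 𝕜 => (z.1 + z.2.2.1 • z.2.2.2, z.2.1))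
      (by fun_prop) fun z hz => hz.2.2.1

theorem K1_mem : Ann 𝕜 ×ˢ (Set.Icc (0 : ℝ) 4 ×ˢ Set.Icc (0 : ℝ) (1 / 10) ×ˢ Metric.sphere (0 : 𝕜) 1) ⊆ Om1 𝕜 := by
  rintro ⟨x, σ, r, w⟩ ⟨hx, hσ, hr, hw⟩
  have hw1 : ‖w‖ = 1 := by simpa using hw
  obtain ⟨h1, h2⟩ := K1_sub hx hr hw1
  have := hx.1
  refine ⟨?_, ?_, ?_, ?_⟩ <;> simp only at *
  · intro h; rw [h, norm_zero] at this; linarith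
  · intro h; rw [h, norm_zero] at hw1; linarith
  · intro h; rw [h, norm_zero] at h2; linarith
  · linarith

/-- L1 -/
theorem L1 (μ : Measure 𝕜) [μ.IsAddHaarMeasure] (N : ℕ) : ∃ C, ∀ σ ∈ Set.Icc (0 : ℝ) 4, ∀ t : ℝ, ∀ b : 𝕜,
    ‖b‖ ≤ 1 / 10 → (1 + |t| * ‖b‖) ^ N * ‖∫ x, Gl σ t b x ∂μ‖ ≤ C := by
  obtain ⟨C, hC⟩ := nsp μ (![1, RCLike.I] : Fin 2 → 𝕜) (Om1 𝕜) Om1_open (Ann 𝕜) ann_compact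
    (Set.Icc (0 : ℝ) 4 ×ˢ Set.Icc (0 : ℝ) (1 / 10) ×ˢ Metric.sphere (0 : 𝕜) 1)
    (isCompact_Icc.prod (isCompact_Icc.prod (isCompact_sphere _ _))) K1_mem q1 q1_smooth
    (fun z hz => by
      rw [q1_grad z hz]
      obtain ⟨h1, h2, h3, h4⟩ := hz
      simp [h1, h2, h3]) N _ a1_smooth
    (fun x p hx => by
      have : phi p.1 x = 0 := by by_contra h; exact hx (phi_supp h)
      simp [this])
  refine ⟨2 ^ N * (9 * μ.real (Ann 𝕜) + C), fun σ hσ t b hb => ?_⟩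
  refine pow_one_add_le (by positivity) (norm_nonneg _) ?_ ?_
  · refine triv_bound μ (fun x => Gl_norm hσ b x) fun x hx => ?_
    by_contra h; exact hx (Gl_supp h).1
  · obtain ⟨w, hw, hbw⟩ := polar b
    have := hC (σ, ‖b‖, w) ⟨hσ, ⟨norm_nonneg _, hb⟩, by simpa using hw⟩ (-(t * ‖b‖))
    rw [abs_neg, abs_mul, abs_norm] at this
    rw [G_eq2 σ t b w hbw]; exact this

/-- far Fourier decay of G -/
theorem L1f (μ : Measure 𝕜) [μ.IsAddHaarMeasure] (N : ℕ) : ∃ C, ∀ σ ∈ Set.Icc (0 : ℝ) 4, ∀ t : ℝ, ∀ b : 𝕜,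
    ‖b‖ ≤ 1 / 10 → ∀ η : 𝕜, |t| * ‖b‖ ≤ ‖η‖ → η ≠ 0 → ‖η‖ ^ N * ‖∫ x, Gl σ t b x * chr η x ∂μ‖ ≤ C := by
  obtain ⟨C, hC⟩ := nsp_fourier μ (Om1 𝕜) Om1_open (Ann 𝕜) ann_compact
    (Set.Icc (0 : ℝ) 4 ×ˢ Set.Icc (0 : ℝ) (1 / 10) ×ˢ Metric.sphere (0 : 𝕜) 1)
    (isCompact_Icc.prod (isCompact_Icc.prod (isCompact_sphere _ _))) K1_mem q1 q1_smooth
    (fun z hz => by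
      rw [q1_grad z (K1_mem hz)]
      obtain ⟨x, σ, r, w⟩ := z
      obtain ⟨hx, hσ, hr, hw⟩ := hz
      have hw1 : ‖w‖ = 1 := by simpa using hw
      obtain ⟨h1, h2⟩ := K1_sub hx hr hw1
      have h3 := hx.1
      simp only at *
      rw [hw1]
      have : 1 / (‖x‖ * ‖x + r • w‖) ≤ 2 := by
        rw [div_le_iff₀ (by nlinarith)]; nlinarith
      have h0 : 0 ≤ 1 / (‖x‖ * ‖x + r • w‖) := by positivity
      nlinarith) N _ a1_smooth
    (fun x p hx => by
      have : phi p.1 x = 0 := by by_contra h; exact hx (phi_supp h)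
      simp [this])
  refine ⟨C, fun σ hσ t b hb η hη hη0 => ?_⟩
  obtain ⟨w, hw, hbw⟩ := polar b
  have := hC (σ, ‖b‖, w) ⟨hσ, ⟨norm_nonneg _, hb⟩, by simpa using hw⟩ (-(t * ‖b‖)) η
    (by rw [abs_neg, abs_mul, abs_norm]; exact hη) hη0
  rw [G_eq2 σ t b w hbw]; exact this

end Loc
end DZ
end

section
open MeasureTheory Filter Topology
open scoped ContDiff

namespace DZ

set_option linter.unusedSectionVars false

section Loc
variable {𝕜 : Type*} [RCLike 𝕜]

/-- parameters for the second difference: σ, r, w, ρ, ν -/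
abbrev P2t (𝕜 : Type*) := ℝ × ℝ × 𝕜 × ℝ × 𝕜

/-- first shift -/
def sA (p : P2t 𝕜) : 𝕜 := p.2.1 • p.2.2.1
/-- second shift -/
def sB (p : P2t 𝕜) : 𝕜 := p.2.2.2.1 • p.2.2.2.2

theorem sA_smooth : ContDiff ℝ ∞ (fun z : 𝕜 × P2t 𝕜 => sA z.2) := by unfold sA; fun_prop
theorem sB_smooth : ContDiff ℝ ∞ (fun z : 𝕜 × P2t 𝕜 => sB z.2) := by unfold sB; fun_prop

/-- phase for the second difference -/
noncomputable def q2 (z : 𝕜 × P2t 𝕜) : ℝ :=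
  (Lq (z.2.2.1 * z.2.2.2.2.1) (emb (-(z.2.2.2.1 * z.2.2.2.2.2) / ((z.1 + sA z.2) * (z.1 + sB z.2))))).re

/-- domain -/
def Om2 (𝕜 : Type*) [RCLike 𝕜] : Set (𝕜 × P2t 𝕜) :=
  {z | z.1 ≠ 0 ∧ z.2.2.2.1 ≠ 0 ∧ z.2.2.2.2.2 ≠ 0 ∧ z.1 + sA z.2 ≠ 0 ∧ z.1 + sB z.2 ≠ 0 ∧
    z.1 + sB z.2 + sA z.2 ≠ 0 ∧ 2 * z.1 + sA z.2 + sB z.2 ≠ 0 ∧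
    ‖sA z.2‖ * ‖sB z.2‖ < ‖z.1 + sA z.2‖ * ‖z.1 + sB z.2‖}

theorem Om2_open : IsOpen (Om2 𝕜) := by
  have hA := (sA_smooth (𝕜 := 𝕜)).continuous
  have hB := (sB_smooth (𝕜 := 𝕜)).continuous
  refine IsOpen.inter ?_ (IsOpen.inter ?_ (IsOpen.inter ?_ (IsOpen.inter ?_
    (IsOpen.inter ?_ (IsOpen.inter ?_ (IsOpen.inter ?_ ?_))))))
  · exact isOpen_ne_fun (by fun_prop) (by fun_prop)
  · exact isOpen_ne_fun (by fun_prop) (by fun_prop)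
  · exact isOpen_ne_fun (by fun_prop) (by fun_prop)
  · exact isOpen_ne_fun (by fun_prop) (by fun_prop)
  · exact isOpen_ne_fun (by fun_prop) (by fun_prop)
  · exact isOpen_ne_fun (by fun_prop) (by fun_prop)
  · exact isOpen_ne_fun (by fun_prop) (by fun_prop)
  · exact isOpen_lt (f := fun z : 𝕜 × P2t 𝕜 => ‖sA z.2‖ * ‖sB z.2‖)
      (g := fun z => ‖z.1 + sA z.2‖ * ‖z.1 + sB z.2‖) (by fun_prop) (by fun_prop)

theorem q2_arg (z : 𝕜 × P2t 𝕜) : (z.2.2.1 * z.2.2.2.2.1) • (-(z.2.2.2.1 * z.2.2.2.2.2) / ((z.1 + sA z.2) * (z.1 + sB z.2)))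
    = -(sA z.2 * sB z.2) / ((z.1 + sA z.2) * (z.1 + sB z.2)) := by
  rw [← smul_div_assoc]
  congr 1
  simp only [sA, sB, RCLike.real_smul_eq_coe_mul]; push_cast; ring

theorem q2_dom {z : 𝕜 × P2t 𝕜} (hz : z ∈ Om2 𝕜) :
    ‖(z.2.2.1 * z.2.2.2.2.1) • (-(z.2.2.2.1 * z.2.2.2.2.2) / ((z.1 + sA z.2) * (z.1 + sB z.2)))‖ < 1 := by
  obtain ⟨h1, h2, h3, h4, h5, h6, h7, h8⟩ := hz
  rw [q2_arg, norm_div, norm_neg, norm_mul, norm_mul, div_lt_one]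
  · exact h8
  · have := norm_pos_iff.2 h4
    have := norm_pos_iff.2 h5
    positivity

theorem q2_smooth : ContDiffOn ℝ ∞ (q2 (𝕜 := 𝕜)) (Om2 𝕜) := by
  refine Complex.reCLM.contDiff.comp_contDiffOn (f := fun z : 𝕜 × P2t 𝕜 =>
    Lq (z.2.2.1 * z.2.2.2.2.1) (emb (-(z.2.2.2.1 * z.2.2.2.2.2) / ((z.1 + sA z.2) * (z.1 + sB z.2))))) ?_
  refine Lq_smooth.comp (g := fun z : ℝ × ℂ => Lq z.1 z.2)
    (f := fun z : 𝕜 × P2t 𝕜 => (z.2.2.1 * z.2.2.2.2.1,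
      emb (-(z.2.2.2.1 * z.2.2.2.2.2) / ((z.1 + sA z.2) * (z.1 + sB z.2))))) ?_ ?_
  · refine ContDiffOn.prodMk (by fun_prop) (emb_smooth.comp_contDiffOn ?_)
    have h0 : ContDiffOn ℝ ∞ (fun z : 𝕜 × P2t 𝕜 => z.1) (Om2 𝕜) := by fun_prop
    have hA := (sA_smooth (𝕜 := 𝕜)).contDiffOn (s := Om2 𝕜)
    have hB := (sB_smooth (𝕜 := 𝕜)).contDiffOn (s := Om2 𝕜)
    have h1 : ContDiffOn ℝ ∞ (fun z : 𝕜 × P2t 𝕜 => z.2.2.2.1) (Om2 𝕜) := by fun_prop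
    have h2 : ContDiffOn ℝ ∞ (fun z : 𝕜 × P2t 𝕜 => z.2.2.2.2.2) (Om2 𝕜) := by fun_prop
    have h3 := (h1.mul h2).neg.mul (((h0.add hA).mul (h0.add hB)).inv
      fun z hz => mul_ne_zero hz.2.2.2.1 hz.2.2.2.2.1)
    simp only [div_eq_mul_inv]
    exact h3
  · intro z hz
    have := q2_dom hz
    rw [← norm_emb, emb_smul, Complex.real_smul] at this
    exact this

theorem q2_grad (z : 𝕜 × P2t 𝕜) (hz : z ∈ Om2 𝕜) :
    ∑ j : Fin 2, (fderiv ℝ q2 z ((![1, RCLike.I] : Fin 2 → 𝕜) j, 0)) ^ 2 ≠ 0 := by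
  have hd := q2_dom hz
  have hz' := hz
  obtain ⟨h1, h2, h3, h4, h5, h6, h7, h8⟩ := hz
  set A := sA z.2 with hA
  set B := sB z.2 with hB
  set w := z.2.2.2.1 with hw
  set ν := z.2.2.2.2.2 with hν
  set x := z.1 with hx
  set c := z.2.2.1 * z.2.2.2.2.1 with hc
  have hcc : (c : 𝕜) * (w * ν) = A * B := by
    simp only [hA, hB, sA, sB, hc, RCLike.real_smul_eq_coe_mul, hw, hν]; push_cast; ring
  have : ∀ e : 𝕜, fderiv ℝ q2 z (e, 0) =
      RCLike.re (w * ν * (2 * x + A + B) / ((x + A) * (x + B) * (x * (x + B + A))) * e) := by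
    intro e
    apply fderiv_line ((q2_smooth.contDiffAt (Om2_open.mem_nhds hz')).differentiableAt (by simp))
    have hu : HasDerivAt (fun y : 𝕜 => -(w * ν) / ((y + A) * (y + B)))
        (w * ν * (2 * x + A + B) / ((x + A) * (x + B)) ^ 2) x := by
      have hm : HasDerivAt (fun y : 𝕜 => (y + A) * (y + B)) (1 * (x + B) + (x + A) * 1) x :=
        ((hasDerivAt_id' x).add_const A).fun_mul ((hasDerivAt_id' x).add_const B)
      have := (hm.fun_inv (mul_ne_zero h4 h5)).const_mul (-(w * ν))
      simp only [div_eq_mul_inv]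
      exact this.congr_deriv (by field_simp; ring)
    have hg := grad_phase c (fun y : 𝕜 => -(w * ν) / ((y + A) * (y + B))) _ x hu hd e
    refine hg.congr_deriv ?_
    congr 2
    have : 1 + (c : 𝕜) * (-(w * ν) / ((x + A) * (x + B))) = x * (x + B + A) / ((x + A) * (x + B)) := by
      rw [mul_div_assoc', mul_neg, hcc]
      field_simp; ring
    rw [this]
    field_simp
  simp_rw [this]
  rw [sum_re_sq]
  simp [h1, h2, h3, h4, h5, h6, h7]

theorem G_G_eq (t : ℝ) (p : P2t 𝕜) (x : 𝕜) :
    Gl p.1 t (sA p) (x + sB p) * (starRingEnd ℂ) (Gl p.1 t (sA p) x) =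
    ((phi p.1 x * phi p.1 (x + sA p) * (phi p.1 (x + sB p) * phi p.1 (x + sB p + sA p)) : ℝ) : ℂ) *
      Complex.exp (Complex.I * ((-(t * (p.2.1 * p.2.2.2.1)) : ℝ) * (q2 (x, p) : ℝ))) := by
  rw [Gl, Gl, Fl_mul_conj, Fl_mul_conj, map_mul, ← Complex.exp_conj, map_mul, map_mul, Complex.conj_I,
    Complex.conj_ofReal, Complex.conj_ofReal, Complex.conj_ofReal]
  rw [mul_mul_mul_comm, ← Complex.exp_add]
  by_cases h0 : phi p.1 x * phi p.1 (x + sA p) * (phi p.1 (x + sB p) * phi p.1 (x + sB p + sA p)) = 0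
  · rw [← Complex.ofReal_mul, mul_comm (phi p.1 (x + sB p) * _), h0]
    simp
  rw [← Complex.ofReal_mul, mul_comm (phi p.1 (x + sB p) * _)]
  congr 2
  have hx := (phi_supp (left_ne_zero_of_mul (left_ne_zero_of_mul h0))).1
  have hxA := (phi_supp (right_ne_zero_of_mul (left_ne_zero_of_mul h0))).1
  have hxB := (phi_supp (left_ne_zero_of_mul (right_ne_zero_of_mul h0))).1
  have hxAB := (phi_supp (right_ne_zero_of_mul (right_ne_zero_of_mul h0))).1
  have hn : ∀ y : 𝕜, 4 / 5 ≤ ‖y‖ → y ≠ 0 := fun y hy h => by rw [h, norm_zero] at hy; linarith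
  have e1 : (p.2.1 * p.2.2.2.1) * q2 (x, p) = (Real.log ‖x + sB p + sA p‖ - Real.log ‖x + sB p‖) -
      (Real.log ‖x + sA p‖ - Real.log ‖x‖) := by
    simp only [q2]
    rw [c_mul_Lq_re, ← Complex.real_smul,
      ← emb_smul, ← map_one (emb : 𝕜 →+* ℂ), ← map_add, norm_emb, q2_arg (x, p)]
    simp only
    have : 1 + -(sA p * sB p) / ((x + sA p) * (x + sB p)) = (x + sB p + sA p) * x / ((x + sA p) * (x + sB p)) := by
      have := hn _ hxA
      have := hn _ hxB
      field_simp; ring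
    rw [this, norm_div, norm_mul, norm_mul, Real.log_div (mul_ne_zero (by linarith) (by linarith))
      (mul_ne_zero (by linarith) (by linarith)), Real.log_mul (by linarith) (by linarith),
      Real.log_mul (by linarith) (by linarith)]
    ring
  have e2 : -(t * (p.2.1 * p.2.2.2.1)) * q2 (x, p) = -t * ((Real.log ‖x + sB p + sA p‖ - Real.log ‖x + sB p‖) -
      (Real.log ‖x + sA p‖ - Real.log ‖x‖)) := by rw [← e1]; ring
  rw [← Complex.ofReal_mul (-(t * (p.2.1 * p.2.2.2.1))), e2]
  push_cast; ring

/-- parameter compact set -/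
def K2 (𝕜 : Type*) [RCLike 𝕜] : Set (P2t 𝕜) := Set.Icc (0 : ℝ) 4 ×ˢ Set.Icc (0 : ℝ) (1 / 10) ×ˢ
  Metric.sphere (0 : 𝕜) 1 ×ˢ Set.Icc (0 : ℝ) (1 / 10) ×ˢ Metric.sphere (0 : 𝕜) 1

theorem K2_mem : Ann 𝕜 ×ˢ (K2 𝕜) ⊆ Om2 𝕜 := by
  rintro ⟨x, p⟩ ⟨hx, hσ, hr, hw, hρ, hν⟩
  have hw1 : ‖p.2.2.1‖ = 1 := by simpa using hw
  have hν1 : ‖p.2.2.2.2‖ = 1 := by simpa using hν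
  have hA : ‖sA p‖ ≤ 1 / 10 := by rw [sA, norm_smul, hw1, Real.norm_of_nonneg hr.1, mul_one]; exact hr.2
  have hB : ‖sB p‖ ≤ 1 / 10 := by rw [sB, norm_smul, hν1, Real.norm_of_nonneg hρ.1, mul_one]; exact hρ.2
  have hx1 : 4 / 5 ≤ ‖x‖ := hx.1
  have hxA : 7 / 10 ≤ ‖x + sA p‖ := by
    have := norm_sub_le (x + sA p) (sA p)
    rw [add_sub_cancel_right] at this; linarith
  have hxB : 7 / 10 ≤ ‖x + sB p‖ := by
    have := norm_sub_le (x + sB p) (sB p)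
    rw [add_sub_cancel_right] at this; linarith
  have hxAB : 6 / 10 ≤ ‖x + sB p + sA p‖ := by
    have := norm_sub_le (x + sB p + sA p) (sA p)
    rw [add_sub_cancel_right] at this; linarith
  have hn : ∀ y : 𝕜, 1 / 2 ≤ ‖y‖ → y ≠ 0 := fun y hy h => by rw [h, norm_zero] at hy; linarith
  refine ⟨hn _ (by simp only; linarith), hn _ (by simp only; linarith), hn _ (by simp only; linarith), hn _ (by simp only; linarith),
    hn _ (by simp only; linarith), hn _ (by simp only; linarith), hn _ ?_, ?_⟩
  · simp only
    have h1 := norm_sub_le (2 * x + sA p + sB p) (sA p + sB p)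
    have h2 : 2 * x + sA p + sB p - (sA p + sB p) = 2 * x := by ring
    have h3 := norm_add_le (sA p) (sB p)
    rw [h2, norm_mul, RCLike.norm_two] at h1
    linarith
  · simp only
    have := norm_nonneg (sA p)
    have := norm_nonneg (sB p)
    nlinarith

variable [MeasurableSpace 𝕜] [BorelSpace 𝕜]

theorem a2_smooth : ContDiffOn ℝ ∞ (fun z : 𝕜 × P2t 𝕜 =>
    ((phi z.2.1 z.1 * phi z.2.1 (z.1 + sA z.2) * (phi z.2.1 (z.1 + sB z.2) * phi z.2.1 (z.1 + sB z.2 + sA z.2)) : ℝ) : ℂ))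
    (Om2 𝕜) := by
  have hA := (sA_smooth (𝕜 := 𝕜))
  have hB := (sB_smooth (𝕜 := 𝕜))
  refine Complex.ofRealCLM.contDiff.comp_contDiffOn (ContDiffOn.mul (ContDiffOn.mul ?_ ?_) (ContDiffOn.mul ?_ ?_))
  · exact phi_smooth.comp (f := fun z : 𝕜 × P2t 𝕜 => (z.1, z.2.1)) (by fun_prop) fun z hz => hz.1
  · exact phi_smooth.comp (f := fun z : 𝕜 × P2t 𝕜 => (z.1 + sA z.2, z.2.1))
      (by fun_prop) fun z hz => hz.2.2.2.1
  · exact phi_smooth.comp (f := fun z : 𝕜 × P2t 𝕜 => (z.1 + sB z.2, z.2.1))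
      (by fun_prop) fun z hz => hz.2.2.2.2.1
  · exact phi_smooth.comp (f := fun z : 𝕜 × P2t 𝕜 => (z.1 + sB z.2 + sA z.2, z.2.1))
      (by fun_prop) fun z hz => hz.2.2.2.2.2.1

/-- second difference integral -/
theorem L2a (μ : Measure 𝕜) [μ.IsAddHaarMeasure] (N : ℕ) : ∃ C, ∀ σ ∈ Set.Icc (0 : ℝ) 4, ∀ t : ℝ, ∀ b B : 𝕜,
    ‖b‖ ≤ 1 / 10 → ‖B‖ ≤ 1 / 10 →
    (1 + |t| * ‖b‖ * ‖B‖) ^ N * ‖∫ x, Gl σ t b (x + B) * (starRingEnd ℂ) (Gl σ t b x) ∂μ‖ ≤ C := by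
  obtain ⟨C, hC⟩ := nsp μ (![1, RCLike.I] : Fin 2 → 𝕜) (Om2 𝕜) Om2_open (Ann 𝕜) ann_compact
    (K2 𝕜)
    (isCompact_Icc.prod (isCompact_Icc.prod ((isCompact_sphere _ _).prod (isCompact_Icc.prod (isCompact_sphere _ _)))))
    K2_mem q2 q2_smooth q2_grad N _ a2_smooth
    (fun x p hx => by
      have : phi p.1 x = 0 := by by_contra h; exact hx (phi_supp h)
      simp [this])
  refine ⟨2 ^ N * (81 * μ.real (Ann 𝕜) + C), fun σ hσ t b B hb hB => ?_⟩
  refine pow_one_add_le (by positivity) (norm_nonneg _) ?_ ?_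
  · refine triv_bound μ (fun x => ?_) fun x hx => ?_
    · rw [norm_mul, RCLike.norm_conj]
      have := Gl_norm (t := t) hσ b x
      have := Gl_norm (t := t) hσ b (x + B)
      have := norm_nonneg (Gl σ t b x)
      have := norm_nonneg (Gl σ t b (x + B))
      nlinarith
    · have : Gl σ t b x = 0 := by by_contra h; exact hx (Gl_supp h).1
      simp [this]
  · obtain ⟨w, hw, hbw⟩ := polar b
    obtain ⟨ν, hν, hBν⟩ := polar B
    have := hC (σ, ‖b‖, w, ‖B‖, ν) ⟨hσ, ⟨norm_nonneg _, hb⟩, by simpa using hw, ⟨norm_nonneg _, hB⟩, by simpa using hν⟩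
      (-(t * (‖b‖ * ‖B‖)))
    rw [abs_neg, abs_mul, abs_mul, abs_norm, abs_norm, ← mul_assoc] at this
    have hG : ∀ x, Gl σ t b (x + B) * (starRingEnd ℂ) (Gl σ t b x) = _ := fun x => by
      have := G_G_eq t (σ, ‖b‖, w, ‖B‖, ν) x
      simp only [sA, sB, ← hbw, ← hBν] at this
      exact this
    simp_rw [hG]
    simp only [sA, sB, ← hbw, ← hBν] at this
    exact this

end Loc
end DZ
end

section
open MeasureTheory Filter Topology
open scoped ContDiff

namespace DZ

set_option linter.unusedSectionVars false

section Loc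
variable {𝕜 : Type*} [RCLike 𝕜]

theorem chr_add (η x y : 𝕜) : chr η (x + y) = chr η x * chr η y := by
  rw [chr, chr, chr, ← Complex.exp_add, mul_add, map_add]
  congr 1; push_cast; ring

theorem chr_conj (η x : 𝕜) : chr η x * (starRingEnd ℂ) (chr η x) = 1 := by
  rw [Complex.mul_conj, Complex.normSq_eq_norm_sq, norm_chr]; simp

theorem chr_continuous (η : 𝕜) : Continuous (chr η) := by
  have : Continuous fun x : 𝕜 => RCLike.re (η * x) := RCLike.continuous_re.comp (by fun_prop)
  unfold chr; fun_prop

variable [MeasurableSpace 𝕜] [BorelSpace 𝕜]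

theorem dilate (μ : Measure 𝕜) [μ.IsAddHaarMeasure] : ∃ C, ∀ τ : ℝ, 0 ≤ τ →
    (1 + τ) ^ (Module.finrank ℝ 𝕜) *
      ∫ B in Metric.closedBall (0 : 𝕜) (1 / 10), ((1 + τ * ‖B‖) ^ (Module.finrank ℝ 𝕜 + 1))⁻¹ ∂μ ≤ C := by
  set n := Module.finrank ℝ 𝕜 with hn
  have hintg : Integrable (fun B : 𝕜 => ((1 + ‖B‖) ^ (n + 1))⁻¹) μ := by
    have := integrable_one_add_norm (E := 𝕜) (μ := μ) (r := (n + 1 : ℝ)) (by rw [hn]; linarith)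
    refine this.congr (Eventually.of_forall fun B => ?_)
    simp only
    rw [Real.rpow_neg (by positivity)]; norm_cast
  set I0 := ∫ B : 𝕜, ((1 + ‖B‖) ^ (n + 1))⁻¹ ∂μ with hI0
  have hI0p : 0 ≤ I0 := integral_nonneg fun B => by positivity
  refine ⟨2 ^ n * (μ.real (Metric.closedBall (0 : 𝕜) (1 / 10)) + I0), fun τ hτ => ?_⟩
  rcases le_total τ 1 with h | h
  · have h1 : ∫ B in Metric.closedBall (0 : 𝕜) (1 / 10), ((1 + τ * ‖B‖) ^ (n + 1))⁻¹ ∂μ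
        ≤ μ.real (Metric.closedBall (0 : 𝕜) (1 / 10)) := by
      have := norm_setIntegral_le_of_norm_le_const (μ := μ) (s := Metric.closedBall (0 : 𝕜) (1 / 10)) (C := 1)
        (f := fun B => ((1 + τ * ‖B‖) ^ (n + 1))⁻¹) (isCompact_closedBall _ _).measure_lt_top (fun B _ => by
          rw [norm_inv, norm_pow]
          refine inv_le_one_of_one_le₀ (one_le_pow₀ ?_)
          rw [Real.norm_of_nonneg (by positivity)]
          have : 0 ≤ τ * ‖B‖ := by positivity
          linarith)
      rw [one_mul] at this
      exact (le_abs_self _).trans this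
    have h2 : 0 ≤ ∫ B in Metric.closedBall (0 : 𝕜) (1 / 10), ((1 + τ * ‖B‖) ^ (n + 1))⁻¹ ∂μ :=
      integral_nonneg fun B => by positivity
    calc _ ≤ 2 ^ n * μ.real (Metric.closedBall (0 : 𝕜) (1 / 10)) := by
          gcongr; linarith
      _ ≤ _ := by gcongr; linarith
  · have hτ0 : 0 < τ := by linarith
    have e : ∫ B : 𝕜, ((1 + τ * ‖B‖) ^ (n + 1))⁻¹ ∂μ = (τ ^ n)⁻¹ * I0 := by
      have := Measure.integral_comp_smul μ (fun B : 𝕜 => ((1 + ‖B‖) ^ (n + 1))⁻¹) τ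
      simp only [norm_smul, Real.norm_of_nonneg hτ] at this
      rw [this, abs_of_nonneg (by positivity), smul_eq_mul]
    have hi : Integrable (fun B : 𝕜 => ((1 + τ * ‖B‖) ^ (n + 1))⁻¹) μ := by
      have := hintg.comp_smul hτ0.ne'
      simpa only [norm_smul, Real.norm_of_nonneg hτ] using this
    have h1 := setIntegral_le_integral (s := Metric.closedBall (0 : 𝕜) (1 / 10)) hi
      (Eventually.of_forall fun B => by simp only [Pi.zero_apply]; positivity)
    rw [e] at h1
    calc _ ≤ (2 * τ) ^ n * ((τ ^ n)⁻¹ * I0) := by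
          gcongr
          linarith
      _ = 2 ^ n * I0 := by rw [mul_pow]; field_simp
      _ ≤ _ := by
          gcongr
          have := measureReal_nonneg (μ := μ) (s := Metric.closedBall (0 : 𝕜) (1 / 10))
          linarith

theorem L2 (μ : Measure 𝕜) [μ.IsAddHaarMeasure] : ∃ C, 0 ≤ C ∧ ∀ σ ∈ Set.Icc (0 : ℝ) 4, ∀ t : ℝ, ∀ b : 𝕜,
    ‖b‖ ≤ 1 / 10 → ∀ η : 𝕜,
    (1 + |t| * ‖b‖) ^ (Module.finrank ℝ 𝕜) * ‖∫ x, Gl σ t b x * chr η x ∂μ‖ ^ 2 ≤ C := by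
  obtain ⟨C1, hC1⟩ := L2a μ (Module.finrank ℝ 𝕜 + 1)
  obtain ⟨C2, hC2⟩ := dilate μ
  set n := Module.finrank ℝ 𝕜 with hn
  set U := Metric.closedBall (0 : 𝕜) (1 / 20) with hU
  set W := Metric.closedBall (0 : 𝕜) 2 with hW
  set D := Metric.closedBall (0 : 𝕜) (1 / 10) with hD
  have hUp : 0 < μ.real U := by
    refine ENNReal.toReal_pos ?_ (isCompact_closedBall _ _).measure_lt_top.ne
    exact (Metric.measure_closedBall_pos μ _ (by norm_num)).ne'
  refine ⟨(μ.real U)⁻¹ * (μ.real W * (|C1| * |C2|)), by positivity, fun σ hσ t b hb η => ?_⟩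
  have hC1p : C1 ≤ |C1| := le_abs_self _
  set F : 𝕜 → ℂ := fun x => Gl σ t b x * chr η x with hF
  have hFc : Continuous F := (Gl_continuous σ t b).mul (chr_continuous η)
  have hv := vdc μ F hFc.stronglyMeasurable 9 (fun x => by
      rw [hF]; simp only; rw [norm_mul, norm_chr, mul_one]; exact Gl_norm hσ b x) U W D
    measurableSet_closedBall measurableSet_closedBall measurableSet_closedBall
    (isCompact_closedBall _ _).measure_lt_top (isCompact_closedBall _ _).measure_lt_top
    (isCompact_closedBall _ _).measure_lt_top (by
      intro x c hc h
      have h1 := (Gl_supp (left_ne_zero_of_mul h)).1.2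
      have h2 : ‖c‖ ≤ 1 / 20 := by simpa [hU] using hc
      have := norm_sub_le (x + c) c
      rw [add_sub_cancel_right] at this
      simp only [hW, mem_closedBall_zero_iff]
      linarith) (by
      intro x hx y hy
      simp only [hU, hD, mem_closedBall_zero_iff] at *
      exact (norm_sub_le _ _).trans (by linarith))
  have hT : ∀ B ∈ D, ‖∫ x, F (x + B) * (starRingEnd ℂ) (F x) ∂μ‖ ≤
      |C1| * ((1 + |t| * ‖b‖ * ‖B‖) ^ (n + 1))⁻¹ := by
    intro B hB
    have hB' : ‖B‖ ≤ 1 / 10 := by simpa [hD] using hB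
    have e : ∫ x, F (x + B) * (starRingEnd ℂ) (F x) ∂μ =
        chr η B * ∫ x, Gl σ t b (x + B) * (starRingEnd ℂ) (Gl σ t b x) ∂μ := by
      rw [← integral_const_mul]
      refine integral_congr_ae (Eventually.of_forall fun x => ?_)
      simp only [hF, chr_add, map_mul]
      linear_combination (chr η B * (Gl σ t b (x + B) * (starRingEnd ℂ) (Gl σ t b x))) * chr_conj η x
    rw [e, norm_mul, norm_chr, one_mul]
    have h1 := hC1 σ hσ t b B hb hB'
    rw [← div_eq_mul_inv, le_div_iff₀ (by positivity), mul_comm]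
    exact h1.trans hC1p
  have hT2 : ∫ B in D, ‖∫ x, F (x + B) * (starRingEnd ℂ) (F x) ∂μ‖ ∂μ ≤
      ∫ B in D, |C1| * ((1 + |t| * ‖b‖ * ‖B‖) ^ (n + 1))⁻¹ ∂μ := by
    refine integral_mono_of_nonneg (Eventually.of_forall fun _ => norm_nonneg _) ?_ ?_
    · refine ContinuousOn.integrableOn_compact (isCompact_closedBall _ _) (Continuous.continuousOn ?_)
      refine continuous_const.mul (Continuous.inv₀ (by fun_prop) fun x => ?_)
      positivity
    · exact (ae_restrict_iff' measurableSet_closedBall).2 (Eventually.of_forall hT)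
  rw [integral_const_mul] at hT2
  have h2 := hC2 (|t| * ‖b‖) (by positivity)
  rw [inv_mul_eq_div, le_div_iff₀ hUp]
  calc _ = (1 + |t| * ‖b‖) ^ n * (‖∫ x, F x ∂μ‖ ^ 2 * μ.real U) := by ring
    _ ≤ (1 + |t| * ‖b‖) ^ n * (μ.real W * (|C1| * ∫ B in D, ((1 + |t| * ‖b‖ * ‖B‖) ^ (n + 1))⁻¹ ∂μ)) := by
      refine mul_le_mul_of_nonneg_left (hv.trans ?_) (by positivity)
      gcongr
    _ = μ.real W * (|C1| * ((1 + |t| * ‖b‖) ^ n * ∫ B in D, ((1 + |t| * ‖b‖ * ‖B‖) ^ (n + 1))⁻¹ ∂μ)) := by ring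
    _ ≤ _ := by gcongr; exact h2.trans (le_abs_self _)

theorem finrank_le_two : Module.finrank ℝ 𝕜 ≤ 2 := by
  have h := LinearMap.finrank_le_finrank_of_injective
    (f := ((embL (𝕜 := 𝕜)) : 𝕜 →ₗ[ℝ] ℂ)) (fun x y h => (emb : 𝕜 →+* ℂ).injective h)
  simpa using h

/-- combined bound for the Fourier transform of G -/
theorem L2c (μ : Measure 𝕜) [μ.IsAddHaarMeasure] (N : ℕ) : ∃ C, 0 ≤ C ∧ ∀ σ ∈ Set.Icc (0 : ℝ) 4, ∀ t : ℝ, ∀ b : 𝕜,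
    ‖b‖ ≤ 1 / 10 → ∀ η : 𝕜,
    (1 + |t| * ‖b‖) ^ (Module.finrank ℝ 𝕜) * ((1 + ‖η‖ / (1 + |t| * ‖b‖)) ^ N *
      ‖∫ x, Gl σ t b x * chr η x ∂μ‖) ^ 2 ≤ C := by
  obtain ⟨C1, hC1, h1⟩ := L2 μ
  obtain ⟨C2, h2⟩ := L1f μ (N + 1)
  refine ⟨(2 ^ N) ^ 2 * C1 + (2 ^ N) ^ 2 * C2 ^ 2, by positivity, fun σ hσ t b hb η => ?_⟩
  have g1 := h1 σ hσ t b hb η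
  have g2 := h2 σ hσ t b hb η
  have hn := finrank_le_two (𝕜 := 𝕜)
  set n := Module.finrank ℝ 𝕜
  set J := ‖∫ x, Gl σ t b x * chr η x ∂μ‖ with hJ
  have hJ0 : 0 ≤ J := norm_nonneg _
  set m := 1 + |t| * ‖b‖ with hm
  have hm1 : 1 ≤ m := by have : 0 ≤ |t| * ‖b‖ := by positivity
                         linarith
  have hη := norm_nonneg η
  rcases le_total ‖η‖ m with h | h
  · have h3 : 1 + ‖η‖ / m ≤ 2 := by
      have := (div_le_one (by linarith : 0 < m)).2 h; linarith
    have h4 : 0 ≤ ‖η‖ / m := by positivity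
    calc m ^ n * ((1 + ‖η‖ / m) ^ N * J) ^ 2 ≤ m ^ n * (2 ^ N * J) ^ 2 := by gcongr
      _ = (2 ^ N) ^ 2 * (m ^ n * J ^ 2) := by ring
      _ ≤ (2 ^ N) ^ 2 * C1 := by gcongr
      _ ≤ _ := by nlinarith [sq_nonneg (2 ^ N * C2)]
  · have g3 := g2 (by linarith) (norm_pos_iff.1 (by linarith))
    have h4 : 0 ≤ ‖η‖ / m := by positivity
    have h3 : 1 + ‖η‖ / m ≤ 2 * ‖η‖ := by
      have : ‖η‖ / m ≤ ‖η‖ := div_le_self hη hm1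
      linarith
    have h5 : m ^ n ≤ ‖η‖ ^ 2 := (pow_le_pow_right₀ hm1 hn).trans (by gcongr)
    calc m ^ n * ((1 + ‖η‖ / m) ^ N * J) ^ 2 ≤ ‖η‖ ^ 2 * ((2 * ‖η‖) ^ N * J) ^ 2 := by gcongr
      _ = (2 ^ N) ^ 2 * (‖η‖ ^ (N + 1) * J) ^ 2 := by rw [mul_pow]; ring
      _ ≤ (2 ^ N) ^ 2 * C2 ^ 2 := by gcongr
      _ ≤ _ := by nlinarith [sq_nonneg ((2 : ℝ) ^ N)]

end Loc
end DZ
end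

section
open MeasureTheory Filter Topology
open scoped ContDiff

namespace DZ
set_option linter.unusedSectionVars false

lemma sum_nat_inv_sq (θ : ℝ) (h0 : 0 < θ) (h1 : θ ≤ 1) (N : ℕ) :
    ∑ j ∈ Finset.range (N+1), ((1 + θ * j)^2)⁻¹ ≤ 2 / θ - (1/θ) * (1 + θ * N)⁻¹ := by
  induction N with
  | zero =>
    simp
    rw [div_eq_mul_inv]
    have : 1 ≤ θ⁻¹ := (one_le_inv₀ h0).2 h1
    linarith
  | succ n ih =>
    rw [Finset.sum_range_succ]
    have hp : 0 < 1 + θ * n := by positivity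
    have hp' : 0 < 1 + θ * (n+1:ℕ) := by positivity
    have : ((1 + θ * (n+1:ℕ))^2)⁻¹ ≤ (1/θ) * (1 + θ * n)⁻¹ - (1/θ) * (1 + θ * (n+1:ℕ))⁻¹ := by
      have e : (1/θ) * (1 + θ * n)⁻¹ - (1/θ) * (1 + θ * (n+1:ℕ))⁻¹
          = ((1 + θ * n) * (1 + θ * (n+1:ℕ)))⁻¹ := by
        field_simp; push_cast; ring
      rw [e]
      apply inv_anti₀ (by positivity)
      rw [sq]
      gcongr
      simp
    linarith

lemma sum_nat_inv_sq' (θ : ℝ) (h0 : 0 < θ) (h1 : θ ≤ 1) (N : ℕ) :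
    ∑ j ∈ Finset.range (N+1), ((1 + θ * j)^2)⁻¹ ≤ 2 / θ := by
  have := sum_nat_inv_sq θ h0 h1 N
  have h2 : 0 ≤ (1/θ) * (1 + θ * N)⁻¹ := by positivity
  linarith

lemma sum_int_inv_sq (θ : ℝ) (h0 : 0 < θ) (h1 : θ ≤ 1) (s : Finset ℤ) :
    ∑ k ∈ s, ((1 + θ * |(k:ℝ)|)^2)⁻¹ ≤ 4 / θ := by
  classical
  obtain ⟨N, hN⟩ : ∃ N : ℕ, ∀ k ∈ s, k.natAbs ≤ N :=
    ⟨s.sup Int.natAbs, fun k hk => Finset.le_sup (f := Int.natAbs) hk⟩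
  have hsub : s ⊆ (Finset.range (N+1)).image (fun j : ℕ => (j:ℤ)) ∪
      (Finset.range (N+1)).image (fun j : ℕ => -(j:ℤ)) := by
    intro k hk
    have := hN k hk
    rw [Finset.mem_union, Finset.mem_image, Finset.mem_image]
    rcases Int.natAbs_eq k with h | h
    · left; exact ⟨k.natAbs, by simp; omega, h.symm⟩
    · right; exact ⟨k.natAbs, by simp; omega, h.symm⟩
  refine (Finset.sum_le_sum_of_subset_of_nonneg hsub (fun _ _ _ => by positivity)).trans ?_
  have hun := Finset.sum_union_inter (s₁ := (Finset.range (N+1)).image (fun j : ℕ => (j:ℤ)))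
    (s₂ := (Finset.range (N+1)).image (fun j : ℕ => -(j:ℤ)))
    (f := fun k : ℤ => ((1 + θ * |(k:ℝ)|)^2)⁻¹)
  have hin : 0 ≤ ∑ k ∈ (Finset.range (N+1)).image (fun j : ℕ => (j:ℤ)) ∩
      (Finset.range (N+1)).image (fun j : ℕ => -(j:ℤ)), ((1 + θ * |(k:ℝ)|)^2)⁻¹ :=
    Finset.sum_nonneg fun _ _ => by positivity
  rw [Finset.sum_image (by intro a _ b _ h; simpa using h),
    Finset.sum_image (by intro a _ b _ h; simpa using h)] at hun
  have := sum_nat_inv_sq' θ h0 h1 N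
  simp only [Int.cast_neg, Int.cast_natCast, abs_neg, Nat.abs_cast] at hun
  have h4 : 4 / θ = 2/θ + 2/θ := by ring
  linarith

lemma floor_weight (θ : ℝ) (h0 : 0 < θ) (h1 : θ ≤ 1) (x : ℝ) :
    ((1 + |x|)^2)⁻¹ ≤ 4 * ((1 + θ * |(⌊x / θ⌋ : ℝ)|)^2)⁻¹ := by
  have hx : θ * |(⌊x / θ⌋ : ℝ)| ≤ |x| + θ := by
    have h2 : |(⌊x / θ⌋ : ℝ)| ≤ |x / θ| + 1 := by
      have := Int.floor_le (x/θ)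
      have := Int.lt_floor_add_one (x/θ)
      have : |(⌊x / θ⌋ : ℝ) - x/θ| ≤ 1 := by rw [abs_le]; constructor <;> linarith
      have := abs_sub_abs_le_abs_sub (⌊x / θ⌋ : ℝ) (x/θ)
      linarith
    rw [abs_div, abs_of_pos h0] at h2
    calc θ * |(⌊x / θ⌋ : ℝ)| ≤ θ * (|x| / θ + 1) := by gcongr
      _ = |x| + θ := by field_simp
  have h3 : (1 + θ * |(⌊x / θ⌋ : ℝ)|) ≤ 2 * (1 + |x|) := by
    have := abs_nonneg x
    linarith
  have hp : 0 < 1 + θ * |(⌊x / θ⌋ : ℝ)| := by positivity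
  rw [← inv_inv (4:ℝ), ← mul_inv]
  apply inv_anti₀ (by positivity)
  calc (4:ℝ)⁻¹ * (1 + θ * |(⌊x / θ⌋ : ℝ)|)^2 ≤ 4⁻¹ * (2 * (1 + |x|))^2 := by gcongr
    _ = _ := by ring

section loc
variable {𝕜 : Type*} [RCLike 𝕜]

/-- cell map -/
noncomputable def cell (θ : ℝ) (x : 𝕜) : ℤ × ℤ := (⌊RCLike.re x / θ⌋, ⌊RCLike.im x / θ⌋)

lemma cell_eq (θ : ℝ) (h0 : 0 < θ) (x y : 𝕜) (h : cell θ x = cell θ y) : ‖x - y‖ ≤ 2 * θ := by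
  have key : ∀ a b : ℝ, ⌊a / θ⌋ = ⌊b / θ⌋ → |a - b| ≤ θ := by
    intro a b h
    have := Int.abs_sub_lt_one_of_floor_eq_floor h
    rw [← sub_div, abs_div, abs_of_pos h0, div_lt_one h0] at this
    exact this.le
  rw [cell, cell, Prod.mk.injEq] at h
  have h1 := key _ _ h.1
  have h2 := key _ _ h.2
  have h3 := RCLike.norm_sq_eq_def (z := x - y)
  rw [map_sub, map_sub] at h3
  have h4 : ‖x - y‖ ^ 2 ≤ (2 * θ) ^ 2 := by
    rw [h3, ← abs_mul_abs_self (RCLike.re x - RCLike.re y), ← abs_mul_abs_self (RCLike.im x - RCLike.im y)]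
    have := mul_le_mul h1 h1 (abs_nonneg _) h0.le
    have := mul_le_mul h2 h2 (abs_nonneg _) h0.le
    nlinarith
  exact (pow_le_pow_iff_left₀ (norm_nonneg _) (by positivity) (by norm_num)).1 h4

lemma finrank_one_or_two : (Module.finrank ℝ 𝕜 = 1 ∧ ∀ x : 𝕜, RCLike.im x = 0) ∨
    Module.finrank ℝ 𝕜 = 2 := by
  rcases RCLike.I_eq_zero_or_im_I_eq_one (K := 𝕜) with h | h
  · left
    refine ⟨?_, fun x => ?_⟩
    · have := (RCLike.realLinearIsometryEquiv h).toLinearEquiv.finrank_eq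
      simpa using this
    · exact RCLike.im_eq_zero h x
  · right
    have := (RCLike.complexLinearIsometryEquiv h).toLinearEquiv.finrank_eq
    simpa using this

lemma loc_weight (θ : ℝ) (h0 : 0 < θ) (h1 : θ ≤ 1) : ∃ W : ℤ × ℤ → ℝ, (∀ p, 0 ≤ W p) ∧
    (∀ s : Finset (ℤ × ℤ), ∑ p ∈ s, W p ≤ (16 / θ) ^ (Module.finrank ℝ 𝕜)) ∧
    ∀ x : 𝕜, ((1 + ‖x‖)^(2 * Module.finrank ℝ 𝕜))⁻¹ ≤ W (cell θ x) := by
  classical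
  rcases finrank_one_or_two (𝕜 := 𝕜) with ⟨h, him⟩ | h
  · rw [h]
    refine ⟨fun p => if p.2 = 0 then 4 * ((1 + θ * |(p.1:ℝ)|)^2)⁻¹ else 0, ?_, ?_, ?_⟩
    · intro p; positivity
    · intro s
      rw [← Finset.sum_filter, pow_one]
      have : ∑ p ∈ s.filter (fun p => p.2 = 0), 4 * ((1 + θ * |(p.1:ℝ)|)^2)⁻¹ =
          ∑ k ∈ (s.filter (fun p => p.2 = 0)).image Prod.fst, 4 * ((1 + θ * |(k:ℝ)|)^2)⁻¹ := by
        rw [Finset.sum_image]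
        intro a ha b hb hab
        simp at ha hb
        exact Prod.ext hab (by rw [ha.2, hb.2])
      rw [this, ← Finset.mul_sum]
      have := sum_int_inv_sq θ h0 h1 ((s.filter (fun p => p.2 = 0)).image Prod.fst)
      calc _ ≤ 4 * (4/θ) := by gcongr
        _ = _ := by ring
    · intro x
      have hx : (cell θ x).2 = 0 := by simp [cell, him]
      simp only [hx, if_true]
      refine le_trans ?_ (floor_weight θ h0 h1 (RCLike.re x))
      apply inv_anti₀ (by positivity)
      rw [mul_one]
      gcongr
      exact RCLike.abs_re_le_norm x
  · rw [h]
    refine ⟨fun p => (4 * ((1 + θ * |(p.1:ℝ)|)^2)⁻¹) * (4 * ((1 + θ * |(p.2:ℝ)|)^2)⁻¹), ?_, ?_, ?_⟩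
    · intro p; positivity
    · intro s
      have hsub : s ⊆ (s.image Prod.fst) ×ˢ (s.image Prod.snd) := Finset.subset_product
      refine (Finset.sum_le_sum_of_subset_of_nonneg hsub (fun _ _ _ => by positivity)).trans ?_
      rw [Finset.sum_product]
      simp only
      rw [← Finset.sum_mul_sum, ← Finset.mul_sum, ← Finset.mul_sum]
      have h3 := sum_int_inv_sq θ h0 h1 (s.image Prod.fst)
      have h4 := sum_int_inv_sq θ h0 h1 (s.image Prod.snd)
      calc _ ≤ (4 * (4/θ)) * (4 * (4/θ)) := by gcongr
        _ = _ := by ring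
    · intro x
      have e1 := floor_weight θ h0 h1 (RCLike.re x)
      have e2 := floor_weight θ h0 h1 (RCLike.im x)
      refine le_trans ?_ (mul_le_mul e1 e2 (by positivity) (by positivity))
      rw [← mul_inv]
      apply inv_anti₀ (by positivity)
      have : (1 + ‖x‖)^(2*2) = (1+‖x‖)^2 * (1+‖x‖)^2 := by ring
      rw [this]
      gcongr
      · exact RCLike.abs_re_le_norm x
      · exact RCLike.abs_im_le_norm x

end loc

section glob
variable {ι : Type*} [Fintype ι] {𝕜 : ι → Type*} [∀ v, RCLike (𝕜 v)]

/-- norm on the product -/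
noncomputable def nm (x : ∀ v, 𝕜 v) : ℝ := ∏ v, ‖x v‖ ^ (Module.finrank ℝ (𝕜 v))

variable (𝕜) in
/-- dimension -/
noncomputable def dg : ℕ := ∑ v, Module.finrank ℝ (𝕜 v)

lemma finrank_pos' (v : ι) : 1 ≤ Module.finrank ℝ (𝕜 v) := by
  rcases finrank_one_or_two (𝕜 := 𝕜 v) with ⟨h, _⟩ | h <;> omega

lemma dg_pos [Nonempty ι] : 1 ≤ dg 𝕜 := by
  obtain ⟨v⟩ := ‹Nonempty ι›
  exact (finrank_pos' v).trans (Finset.single_le_sum (f := fun v => Module.finrank ℝ (𝕜 v)) (fun _ _ => Nat.zero_le _) (Finset.mem_univ v))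

lemma nm_nonneg (x : ∀ v, 𝕜 v) : 0 ≤ nm x := Finset.prod_nonneg fun _ _ => by positivity

theorem cnt [Nonempty ι] {A : Type*} [AddCommGroup A] (σ : A →+ ∀ v, 𝕜 v) (ν : ℝ) (hν : 0 < ν)
    (hσ : ∀ a, a ≠ 0 → ν ≤ nm (σ a)) (R : ι → ℝ) (hR : ∀ v, 0 < R v) (s : Finset A) :
    ∑ a ∈ s, ∏ v, ((1 + ‖σ a v‖ / R v)^(2 * Module.finrank ℝ (𝕜 v)))⁻¹ ≤
      (64:ℝ)^(dg 𝕜) * (1 + (∏ v, R v ^ (Module.finrank ℝ (𝕜 v))) / ν) := by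
  classical
  set V := ∏ v, R v ^ (Module.finrank ℝ (𝕜 v)) with hV
  have hVp : 0 < V := Finset.prod_pos fun v _ => pow_pos (hR v) _
  have hd : 1 ≤ dg 𝕜 := dg_pos
  set m : ℝ := min 1 (ν / V) with hm
  have hmp : 0 < m := lt_min one_pos (by positivity)
  obtain ⟨δ, hδ0, hδ⟩ : ∃ δ : ℝ, 0 < δ ∧ δ ^ (dg 𝕜) = m :=
    ⟨m ^ ((dg 𝕜 : ℝ)⁻¹), by positivity, Real.rpow_inv_natCast_pow hmp.le (by omega)⟩
  have hδ1 : δ ≤ 1 := by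
    by_contra h
    push Not at h
    have : 1 < δ ^ (dg 𝕜) := one_lt_pow₀ h (by omega)
    rw [hδ] at this
    exact absurd (min_le_left 1 (ν/V)) (not_le.2 this)
  set θ := δ / 4 with hθ
  have hθ0 : 0 < θ := by positivity
  have hθ1 : θ ≤ 1 := by linarith
  choose W hW0 hWs hWx using fun v => loc_weight (𝕜 := 𝕜 v) θ hθ0 hθ1
  let q : A → (ι → ℤ × ℤ) := fun a v => cell θ (((R v)⁻¹ : ℝ) • σ a v)
  have hinj : Function.Injective q := by
    intro a b hab
    by_contra hne
    have h1 : ∀ v, ‖σ (a - b) v‖ ≤ R v * (δ / 2) := by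
      intro v
      have := cell_eq θ hθ0 _ _ (congrFun hab v)
      rw [← smul_sub, norm_smul, norm_inv, Real.norm_eq_abs, abs_of_pos (hR v)] at this
      rw [map_sub, Pi.sub_apply]
      have h2 := hR v
      rw [inv_mul_le_iff₀ h2] at this
      rw [hθ] at this
      refine this.trans (le_of_eq (by ring))
    have h2 := hσ (a - b) (sub_ne_zero.2 hne)
    have h3 : nm (σ (a-b)) ≤ V * (δ/2)^(dg 𝕜) := by
      unfold nm dg
      rw [hV, ← Finset.prod_pow_eq_pow_sum, ← Finset.prod_mul_distrib]
      refine Finset.prod_le_prod (fun _ _ => by positivity) fun v _ => ?_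
      rw [← mul_pow]
      exact pow_le_pow_left₀ (norm_nonneg _) (h1 v) _
    have h4 : (δ/2)^(dg 𝕜) < δ ^(dg 𝕜) := pow_lt_pow_left₀ (by linarith) (by positivity) (by omega)
    rw [hδ] at h4
    have h5 : V * m ≤ ν := by
      calc V * m ≤ V * (ν / V) := by gcongr; exact min_le_right _ _
        _ = ν := by field_simp
    have h6 : V * (δ/2)^(dg 𝕜) < V * m := by gcongr
    linarith
  have step1 : ∀ a, ∏ v, ((1 + ‖σ a v‖ / R v)^(2 * Module.finrank ℝ (𝕜 v)))⁻¹ ≤ ∏ v, W v (q a v) := by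
    intro a
    refine Finset.prod_le_prod (fun v _ => by have := (hR v).le; positivity) fun v _ => ?_
    have := hWx v (((R v)⁻¹ : ℝ) • σ a v)
    rw [norm_smul, norm_inv, Real.norm_eq_abs, abs_of_pos (hR v)] at this
    rw [div_eq_inv_mul]; exact this
  calc _ ≤ ∑ a ∈ s, ∏ v, W v (q a v) := Finset.sum_le_sum fun a _ => step1 a
    _ = ∑ p ∈ s.image q, ∏ v, W v (p v) := by rw [Finset.sum_image (fun a _ b _ h => hinj h)]
    _ ≤ ∑ p ∈ Fintype.piFinset (fun v => (s.image q).image (fun p => p v)), ∏ v, W v (p v) := by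
        refine Finset.sum_le_sum_of_subset_of_nonneg ?_ (fun p _ _ => Finset.prod_nonneg fun v _ => hW0 v _)
        intro p hp
        rw [Fintype.mem_piFinset]
        intro v
        exact Finset.mem_image_of_mem _ hp
    _ = ∏ v, ∑ p ∈ (s.image q).image (fun p => p v), W v p := by
        rw [Finset.prod_univ_sum]
    _ ≤ ∏ v, (16 / θ) ^ (Module.finrank ℝ (𝕜 v)) :=
        Finset.prod_le_prod (fun v _ => Finset.sum_nonneg fun _ _ => hW0 v _) fun v _ => hWs v _
    _ = (64:ℝ)^(dg 𝕜) * m⁻¹ := by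
        rw [Finset.prod_pow_eq_pow_sum, ← hδ, ← inv_pow, ← mul_pow]
        unfold dg
        congr 1
        rw [hθ]; field_simp; norm_num
    _ ≤ _ := by
        gcongr
        rcases min_choice 1 (ν / V) with h | h
        · rw [hm, h]; simp; positivity
        · rw [hm, h, inv_div]; linarith

end glob
end DZ
end

section
open MeasureTheory Filter Topology
open scoped ContDiff

namespace DZ
set_option linter.unusedSectionVars false

section glob
variable {ι : Type*} [Fintype ι] {𝕜 : ι → Type*} [∀ v, RCLike (𝕜 v)] [Nonempty ι]
  {A : Type*} [AddCommGroup A] (σ : A →+ ∀ v, 𝕜 v) (ν : ℝ) (hν : 0 < ν)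
    (hσ : ∀ a, a ≠ 0 → ν ≤ nm (σ a)) (R : ι → ℝ) (hR : ∀ v, 0 < R v)

/-- decay weight -/
noncomputable def wt (R : ι → ℝ) (N : ℕ) (x : ∀ v, 𝕜 v) : ℝ :=
  ∏ v, ((1 + ‖x v‖ / R v)^(N * Module.finrank ℝ (𝕜 v)))⁻¹

/-- volume of the box -/
noncomputable def bv (𝕜 : ι → Type*) [∀ v, RCLike (𝕜 v)] (R : ι → ℝ) : ℝ :=
  ∏ v, R v ^ (Module.finrank ℝ (𝕜 v))

include hR in
lemma bv_pos : 0 < bv 𝕜 R := Finset.prod_pos fun v _ => pow_pos (hR v) _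

include hR in
lemma wt_nonneg (N : ℕ) (x : ∀ v, 𝕜 v) : 0 ≤ wt R N x :=
  Finset.prod_nonneg fun v _ => by have := (hR v).le; positivity

include hν hσ hR in
lemma cnt' (s : Finset A) : ∑ a ∈ s, wt R 2 (σ a) ≤ (64:ℝ)^(dg 𝕜) * (1 + bv 𝕜 R / ν) :=
  cnt σ ν hν hσ R hR s

include hν hσ hR in
lemma wt_tail (M : ℕ) (a : A) (ha : a ≠ 0) : wt R (2 + M) (σ a) ≤ (bv 𝕜 R / ν)^M * wt R 2 (σ a) := by
  have hV := bv_pos (𝕜 := 𝕜) R hR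
  have e : wt R (2+M) (σ a) = wt R 2 (σ a) * (∏ v, ((1 + ‖σ a v‖ / R v)^(Module.finrank ℝ (𝕜 v)))⁻¹)^M := by
    rw [wt, wt, ← Finset.prod_pow, ← Finset.prod_mul_distrib]
    refine Finset.prod_congr rfl fun v _ => ?_
    rw [inv_pow, ← mul_inv, ← pow_mul, ← pow_add]
    congr 2; ring
  rw [e, mul_comm]
  refine mul_le_mul_of_nonneg_right ?_ (wt_nonneg R hR _ _)
  refine pow_le_pow_left₀ (Finset.prod_nonneg fun v _ => by have := (hR v).le; positivity) ?_ _
  rw [Finset.prod_inv_distrib, inv_le_comm₀ (Finset.prod_pos fun v _ => by have := (hR v).le; positivity)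
    (by positivity), inv_div]
  calc ν / bv 𝕜 R ≤ nm (σ a) / bv 𝕜 R := by gcongr; exact hσ a ha
    _ = ∏ v, (‖σ a v‖ / R v) ^ (Module.finrank ℝ (𝕜 v)) := by
        rw [nm, bv, ← Finset.prod_div_distrib]
        exact Finset.prod_congr rfl fun v _ => by rw [div_pow]
    _ ≤ _ := Finset.prod_le_prod (fun v _ => by have := (hR v).le; positivity) fun v _ => by
        have := (hR v).le
        refine pow_le_pow_left₀ (by positivity) (by linarith) _

include hR in
lemma wt_anti {N N' : ℕ} (h : N ≤ N') (x : ∀ v, 𝕜 v) : wt R N' x ≤ wt R N x := by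
  refine Finset.prod_le_prod (fun v _ => by have := (hR v).le; positivity) fun v _ => ?_
  have := (hR v).le
  have h1 : 0 ≤ ‖x v‖ / R v := by positivity
  refine inv_anti₀ (by positivity) (pow_le_pow_right₀ (by linarith) ?_)
  gcongr

include hν hσ hR in
lemma cnt_tail (M : ℕ) (s : Finset A) (hs : 0 ∉ s) :
    ∑ a ∈ s, wt R (2 + M) (σ a) ≤ (bv 𝕜 R / ν)^M * ((64:ℝ)^(dg 𝕜) * (1 + bv 𝕜 R / ν)) := by
  have hV := bv_pos (𝕜 := 𝕜) R hR
  calc _ ≤ ∑ a ∈ s, (bv 𝕜 R / ν)^M * wt R 2 (σ a) :=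
        Finset.sum_le_sum fun a ha => wt_tail σ ν hν hσ R hR M a (fun h => hs (h ▸ ha))
    _ = (bv 𝕜 R / ν)^M * ∑ a ∈ s, wt R 2 (σ a) := by rw [Finset.mul_sum]
    _ ≤ _ := by gcongr; exact cnt' σ ν hν hσ R hR s

include hν hσ hR in
lemma cnt_one (s : Finset A) (hs : 0 ∉ s) :
    ∑ a ∈ s, wt R 3 (σ a) ≤ 2 * (64:ℝ)^(dg 𝕜) * (bv 𝕜 R / ν) := by
  have hV := bv_pos (𝕜 := 𝕜) R hR
  have hq : 0 < bv 𝕜 R / ν := by positivity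
  rcases le_total (bv 𝕜 R / ν) 1 with h | h
  · refine (cnt_tail σ ν hν hσ R hR 1 s hs).trans ?_
    have : (64:ℝ)^(dg 𝕜) * (1 + bv 𝕜 R / ν) ≤ (64:ℝ)^(dg 𝕜) * 2 := by gcongr; linarith
    calc _ ≤ (bv 𝕜 R / ν)^1 * ((64:ℝ)^(dg 𝕜) * 2) := by gcongr
      _ = _ := by ring
  · calc _ ≤ ∑ a ∈ s, wt R 2 (σ a) := Finset.sum_le_sum fun a _ => wt_anti R hR (by norm_num) _
      _ ≤ _ := cnt' σ ν hν hσ R hR s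
      _ ≤ (64:ℝ)^(dg 𝕜) * (2 * (bv 𝕜 R / ν)) := by gcongr; linarith
      _ = _ := by ring

include hν hσ hR in
lemma box_card : {a | ∀ v, ‖σ a v‖ ≤ R v}.Finite ∧
    ({a | ∀ v, ‖σ a v‖ ≤ R v}.ncard : ℝ) ≤ (256:ℝ)^(dg 𝕜) * (1 + bv 𝕜 R / ν) := by
  have key : ∀ s : Finset A, (s : Set A) ⊆ {a | ∀ v, ‖σ a v‖ ≤ R v} →
      (s.card : ℝ) ≤ (256:ℝ)^(dg 𝕜) * (1 + bv 𝕜 R / ν) := by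
    intro s hs
    have h1 : ∀ a ∈ s, ((4:ℝ)^(dg 𝕜))⁻¹ ≤ wt R 2 (σ a) := by
      intro a ha
      have h2 := hs ha
      rw [dg, ← Finset.prod_pow_eq_pow_sum, ← Finset.prod_inv_distrib]
      refine Finset.prod_le_prod (fun v _ => by positivity) fun v _ => ?_
      have := hR v
      have h3 : 1 + ‖σ a v‖ / R v ≤ 2 := by
        have : ‖σ a v‖ / R v ≤ 1 := (div_le_one (hR v)).2 (h2 v)
        linarith
      refine inv_anti₀ (by positivity) ?_
      rw [pow_mul]
      refine pow_le_pow_left₀ (by positivity) ?_ _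
      calc _ ≤ (2:ℝ)^2 := by gcongr
        _ = 4 := by norm_num
    have h4 := (Finset.sum_le_sum h1).trans (cnt' σ ν hν hσ R hR s)
    rw [Finset.sum_const, nsmul_eq_mul, ← div_eq_mul_inv, div_le_iff₀ (by positivity)] at h4
    refine h4.trans (le_of_eq ?_)
    have : (256:ℝ)^(dg 𝕜) = 64^(dg 𝕜) * 4^(dg 𝕜) := by rw [← mul_pow]; norm_num
    rw [this]; ring
  have hfin : {a | ∀ v, ‖σ a v‖ ≤ R v}.Finite := by
    by_contra hinf
    obtain ⟨N, hN⟩ := exists_nat_gt ((256:ℝ)^(dg 𝕜) * (1 + bv 𝕜 R / ν))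
    obtain ⟨s, hs, hc⟩ := Set.Infinite.exists_subset_card_eq hinf N
    have := key s hs
    rw [hc] at this
    linarith
  refine ⟨hfin, ?_⟩
  rw [Set.ncard_eq_toFinset_card _ hfin]
  exact key _ (by simp)

include hν hσ hR in
lemma summable_wt (g : A → ℂ) (K : ℝ) (hg : ∀ a, ‖g a‖ ≤ K * wt R 2 (σ a)) : Summable g := by
  have h1 : Summable fun a => wt R 2 (σ a) :=
    summable_of_sum_le (fun a => wt_nonneg R hR _ _) (cnt' σ ν hν hσ R hR)
  exact Summable.of_norm_bounded (h1.mul_left K) hg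

lemma tsum_sub_zero_le (g : A → ℂ) (hg : Summable g) (w : A → ℝ) (hw : ∀ a, 0 ≤ w a) (B : ℝ)
    (h : ∀ a, a ≠ 0 → ‖g a‖ ≤ w a) (hB : ∀ s : Finset A, 0 ∉ s → ∑ a ∈ s, w a ≤ B) :
    ‖∑' a, g a - g 0‖ ≤ B := by
  classical
  have h1 := hg.hasSum
  refine le_of_tendsto ((h1.sub_const (g 0)).norm) ?_
  filter_upwards [eventually_ge_atTop ({0} : Finset A)] with s hs
  have h0 : (0:A) ∈ s := hs (by simp)
  rw [← Finset.add_sum_erase s g h0, add_sub_cancel_left]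
  refine (norm_sum_le _ _).trans (le_trans ?_ (hB (s.erase 0) (by simp)))
  exact Finset.sum_le_sum fun a ha => h a (Finset.ne_of_mem_erase ha)

end glob
end DZ
end

section
open MeasureTheory Filter Topology
open scoped ContDiff

namespace DZ
set_option linter.unusedSectionVars false

section lat
variable {ι : Type*} [Fintype ι] {𝕜 : ι → Type*} [∀ v, RCLike (𝕜 v)]
  [∀ v, MeasurableSpace (𝕜 v)] [∀ v, BorelSpace (𝕜 v)]

/-- lattice data -/
structure Lat (κ : Type*) [Fintype κ] (μ : ∀ v, Measure (𝕜 v)) (ν c c2 X : ℝ) where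
  /-- lattice -/
  sig : (κ → ℤ) →+ ∀ v, 𝕜 v
  /-- dual lattice -/
  xi : (κ → ℤ) →+ ∀ v, 𝕜 v
  hsig : ∀ n, n ≠ 0 → ν / X ≤ nm (sig n)
  hxi : ∀ k, k ≠ 0 → ν * X ≤ nm (xi k)
  pois : ∀ f : ∀ v, 𝕜 v → ℂ, (∀ v, Continuous (f v)) → (∀ v, HasCompactSupport (f v)) →
    Summable (fun k : κ → ℤ => ∏ v, ∫ x, f v x * chr (xi k v) x ∂μ v) →
    ∑' n : κ → ℤ, ∏ v, f v (sig n v) =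
      (c * X : ℝ) * ∑' k : κ → ℤ, ∏ v, ∫ x, f v x * chr (xi k v) x ∂μ v
  blich : ∀ r : ι → ℝ, (∀ v, 0 < r v) →
    c2 * X * bv 𝕜 r ≤ ({n : κ → ℤ | ∀ v, ‖sig n v‖ ≤ r v}.ncard : ℝ)

variable (𝕜) in
/-- local degree as a real number -/
noncomputable def nv (v : ι) : ℝ := (Module.finrank ℝ (𝕜 v) : ℝ)

lemma nv_ge (v : ι) : 1 ≤ nv 𝕜 v := by
  unfold nv; exact_mod_cast finrank_pos' (𝕜 := 𝕜) v

lemma nv_le (v : ι) : nv 𝕜 v ≤ 2 := by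
  unfold nv; exact_mod_cast finrank_le_two (𝕜 := 𝕜 v)

lemma nv_mem (v : ι) {σ : ℝ} (hσ : σ ∈ Set.Icc (0:ℝ) 2) : nv 𝕜 v * σ ∈ Set.Icc (0:ℝ) 4 := by
  have := nv_ge (𝕜 := 𝕜) v
  have := nv_le (𝕜 := 𝕜) v
  have h1 := hσ.1
  have h2 := hσ.2
  constructor
  · positivity
  · nlinarith

/-- global test function -/
noncomputable def Ph (σ t : ℝ) (x : ∀ v, 𝕜 v) : ℂ := ∏ v, Fl (nv 𝕜 v * σ) (nv 𝕜 v * t) (x v)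

lemma Ph_norm_le {σ : ℝ} (hσ : σ ∈ Set.Icc (0:ℝ) 2) (t : ℝ) (x : ∀ v, 𝕜 v) :
    ‖Ph σ t x‖ ≤ 3 ^ Fintype.card ι := by
  rw [Ph, norm_prod]
  refine (Finset.prod_le_prod (g := fun _ => 3) (fun _ _ => norm_nonneg _) fun v _ => ?_).trans (by simp)
  rw [Fl_norm]
  exact phi_le (nv_mem v hσ).1 (nv_mem v hσ).2 _

lemma Ph_supp {σ t : ℝ} {x : ∀ v, 𝕜 v} (h : Ph σ t x ≠ 0) (v : ι) : x v ∈ Ann (𝕜 v) :=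
  Fl_supp (Finset.prod_ne_zero_iff.1 h v (Finset.mem_univ v))

lemma hcs_of_ann {F : Type*} [RCLike F] {f : F → ℂ} (h : ∀ x, f x ≠ 0 → x ∈ Ann F) : HasCompactSupport f :=
  HasCompactSupport.of_support_subset_isCompact ann_compact fun x hx => h x hx

/-- main constant -/
noncomputable def Am (μ : ∀ v, Measure (𝕜 v)) (σ t : ℝ) : ℂ :=
  ∏ v, ∫ x, Fl (nv 𝕜 v * σ) (nv 𝕜 v * t) x ∂μ v

variable {κ : Type*} [Fintype κ] (μ : ∀ v, Measure (𝕜 v)) [∀ v, (μ v).IsAddHaarMeasure]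
  {ν c c2 X : ℝ} [Nonempty ι]

/-- the smoothed sum -/
noncomputable def Lat.S (L : Lat κ μ ν c c2 X) (σ t : ℝ) : ℂ := ∑' n, Ph σ t (L.sig n)

lemma chr_zero' {F : Type*} [RCLike F] (x : F) : chr (0:F) x = 1 := by simp [chr]

lemma bv_const (r : ℝ) : bv 𝕜 (fun _ => r) = r ^ (dg 𝕜) := by
  rw [bv, dg, Finset.prod_pow_eq_pow_sum]

lemma bv_smul (r : ℝ) (R : ι → ℝ) : bv 𝕜 (fun v => r * R v) = r ^ (dg 𝕜) * bv 𝕜 R := by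
  rw [← bv_const (𝕜 := 𝕜), bv, bv, bv, ← Finset.prod_mul_distrib]
  exact Finset.prod_congr rfl fun v _ => mul_pow _ _ _

theorem Lat.triv (hν : 0 < ν) (hX : 0 < X) (L : Lat κ μ ν c c2 X) {σ : ℝ} (hσ : σ ∈ Set.Icc (0:ℝ) 2) (t : ℝ) :
    ‖L.S μ σ t‖ ≤ 3 ^ Fintype.card ι * ((256:ℝ)^(dg 𝕜) * (1 + 2^(dg 𝕜) * X / ν)) := by
  obtain ⟨hf, hc⟩ := box_card L.sig (ν / X) (by positivity) L.hsig (fun _ => 2) (fun _ => by norm_num)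
  rw [bv_const] at hc
  have hz : ∀ n ∉ hf.toFinset, Ph σ t (L.sig n) = 0 := by
    intro n hn
    by_contra h
    apply hn
    rw [Set.Finite.mem_toFinset]
    intro v
    have := (Ph_supp h v).2
    linarith
  rw [Lat.S, tsum_eq_sum hz]
  refine (norm_sum_le _ _).trans ?_
  refine (Finset.sum_le_sum (g := fun _ => (3:ℝ) ^ Fintype.card ι) fun n _ => Ph_norm_le hσ t _).trans ?_
  rw [Finset.sum_const, nsmul_eq_mul, mul_comm, ← Set.ncard_eq_toFinset_card _ hf]
  gcongr
  refine hc.trans (le_of_eq ?_)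
  field_simp

theorem loc_F (M : ℕ) : ∃ K, 0 ≤ K ∧ ∀ σ ∈ Set.Icc (0:ℝ) 2, ∀ t : ℝ, ∀ ξ : ∀ v, 𝕜 v,
    ‖∏ v, ∫ x, Fl (nv 𝕜 v * σ) (nv 𝕜 v * t) x * chr (ξ v) x ∂μ v‖ ≤
      K * wt (fun _ => 2 * (1 + |t|)) M ξ := by
  choose C hC using fun v => L0 (μ v) (M * Module.finrank ℝ (𝕜 v))
  refine ⟨∏ v, |C v|, Finset.prod_nonneg fun _ _ => abs_nonneg _, fun σ hσ t ξ => ?_⟩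
  rw [norm_prod, wt, ← Finset.prod_mul_distrib]
  refine Finset.prod_le_prod (fun _ _ => norm_nonneg _) fun v _ => ?_
  have ht := abs_nonneg t
  rw [← div_eq_mul_inv, le_div_iff₀ (by positivity), mul_comm]
  refine le_trans ?_ ((hC v _ (nv_mem (𝕜 := 𝕜) v hσ) (nv 𝕜 v * t) (ξ v)).trans (le_abs_self _))
  have h1 := nv_ge (𝕜 := 𝕜) v
  have h2 := nv_le (𝕜 := 𝕜) v
  gcongr
  rw [abs_mul, abs_of_nonneg (by linarith)]
  nlinarith

theorem Lat.tail (hν : 0 < ν) (hc : 0 < c) (M : ℕ) : ∃ C, 0 ≤ C ∧ ∀ X : ℝ, 0 < X → ∀ L : Lat κ μ ν c c2 X,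
    ∀ σ ∈ Set.Icc (0:ℝ) 2, ∀ t : ℝ,
    ‖L.S μ σ t - (c * X : ℝ) * Am μ σ t‖ ≤ C * X * ((1 + |t|)^(dg 𝕜) / X)^M * (1 + (1 + |t|)^(dg 𝕜) / X) := by
  obtain ⟨K, hK0, hK⟩ := loc_F μ (2 + M)
  obtain ⟨K2, hK20, hK2⟩ := loc_F μ 2
  set B : ℝ := 2^(dg 𝕜) / ν with hB
  have hB0 : 0 < B := by positivity
  refine ⟨c * K * B^M * (64^(dg 𝕜) * (1 + B)), by positivity, fun X hX L σ hσ t => ?_⟩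
  have ht := abs_nonneg t
  have hR : ∀ v : ι, 0 < 2 * (1 + |t|) := fun v => by positivity
  have hs := summable_wt L.xi (ν * X) (by positivity) L.hxi (fun _ => 2 * (1+|t|)) hR
    (fun k => ∏ v, ∫ x, Fl (nv 𝕜 v * σ) (nv 𝕜 v * t) x * chr (L.xi k v) x ∂μ v) K2
    (fun k => hK2 σ hσ t _)
  have hp := L.pois (fun v => Fl (nv 𝕜 v * σ) (nv 𝕜 v * t)) (fun v => Fl_continuous _ _)
    (fun v => hcs_of_ann fun x hx => Fl_supp hx) hs
  have h0 : Am μ σ t = ∏ v, ∫ x, Fl (nv 𝕜 v * σ) (nv 𝕜 v * t) x * chr (L.xi 0 v) x ∂μ v := by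
    simp [Am, chr_zero']
  have hbd := tsum_sub_zero_le _ hs (fun k => K * wt (fun _ => 2 * (1 + |t|)) (2+M) (L.xi k))
    (fun k => mul_nonneg hK0 (wt_nonneg _ hR _ _)) _ (fun k _ => hK σ hσ t _)
    (fun s hs => by
      rw [← Finset.mul_sum]
      exact mul_le_mul_of_nonneg_left (cnt_tail L.xi (ν*X) (by positivity) L.hxi _ hR M s hs) hK0)
  have hS : L.S μ σ t = (c * X : ℝ) * ∑' k, ∏ v, ∫ x, Fl (nv 𝕜 v * σ) (nv 𝕜 v * t) x * chr (L.xi k v) x ∂μ v := hp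
  rw [hS, ← mul_sub, norm_mul, Complex.norm_real, Real.norm_of_nonneg (by positivity), h0]
  have hbv : bv 𝕜 (fun _ => 2 * (1 + |t|)) / (ν * X) = B * ((1+|t|)^(dg 𝕜) / X) := by
    rw [bv_const, mul_pow, hB]; field_simp
  rw [hbv] at hbd
  set Y := (1+|t|)^(dg 𝕜) / X with hY
  have hY0 : 0 ≤ Y := by positivity
  calc _ ≤ c * X * (K * ((B * Y) ^ M * (64 ^ dg 𝕜 * (1 + B * Y)))) := by gcongr
    _ ≤ c * X * (K * ((B * Y) ^ M * (64 ^ dg 𝕜 * ((1 + B) * (1 + Y))))) := by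
        gcongr; nlinarith
    _ = _ := by rw [mul_pow]; ring

end lat
end DZ
end

section
open MeasureTheory Filter Topology
open scoped ContDiff

namespace DZ
set_option linter.unusedSectionVars false

section
variable {κ : Type*} [Fintype κ]

lemma count_setIntegral {E : Type*} [NormedAddCommGroup E] [NormedSpace ℝ E] [CompleteSpace E]
    (s : Finset (κ → ℤ)) (f : (κ → ℤ) → E) :
    ∫ x in (s : Set (κ → ℤ)), f x ∂Measure.count = ∑ x ∈ s, f x := by
  rw [setIntegral_finset]
  · refine Finset.sum_congr rfl fun x _ => ?_
    rw [measureReal_def, Measure.count_singleton]; simp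
  · have e : (s : Set (κ → ℤ)) = ⋃ x ∈ s, {x} := by ext y; simp
    rw [e, integrableOn_finset_iUnion]
    intro x _
    exact integrableOn_singleton (hx := by rw [Measure.count_singleton]; simp)

lemma count_integral {E : Type*} [NormedAddCommGroup E] [NormedSpace ℝ E] [CompleteSpace E]
    (s : Finset (κ → ℤ)) (f : (κ → ℤ) → E) (h : ∀ x ∉ s, f x = 0) :
    ∫ x, f x ∂Measure.count = ∑' x, f x := by
  rw [← setIntegral_eq_integral_of_forall_compl_eq_zero (s := (s : Set (κ → ℤ))) (fun x hx => h x (by simpa using hx)),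
    count_setIntegral, tsum_eq_sum h]

theorem vdc_sum (F : (κ → ℤ) → ℂ) (M : ℝ) (hM : ∀ a, ‖F a‖ ≤ M) (U W D : Finset (κ → ℤ))
    (hsupp : ∀ a, ∀ b ∈ U, F (a+b) ≠ 0 → a ∈ W) (hFW : ∀ a, F a ≠ 0 → a ∈ W)
    (hUD : ∀ b ∈ U, ∀ c ∈ U, b - c ∈ D) :
    ‖∑' a, F a‖^2 * (U.card : ℝ) ≤ W.card * ∑ b ∈ D, ‖∑' a, F (a+b) * (starRingEnd ℂ) (F a)‖ := by
  have hms : ∀ s : Set (κ → ℤ), MeasurableSet s := fun s => s.to_countable.measurableSet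
  have hct : ∀ s : Finset (κ → ℤ), (Measure.count (s : Set (κ → ℤ))) < ⊤ := fun s => by
    rw [Measure.count_apply_lt_top]; exact s.finite_toSet
  have hcr : ∀ s : Finset (κ → ℤ), (Measure.count : Measure (κ → ℤ)).real (s : Set (κ → ℤ)) = s.card := fun s => by
    rw [measureReal_def, Measure.count_apply_finset]; simp
  have := vdc (Measure.count : Measure (κ → ℤ)) F (measurable_of_countable F).stronglyMeasurable M hM U W D (hms _) (hms _) (hms _)
    (hct _) (hct _) (hct _) (fun a b hb => by simpa using hsupp a b hb) (fun b hb c hc => by simpa using hUD b hb c hc)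
  rw [hcr, hcr, count_setIntegral, count_integral W F (fun x hx => by by_contra h; exact hx (hFW x h))] at this
  refine this.trans (le_of_eq ?_)
  congr 1
  refine Finset.sum_congr rfl fun b _ => ?_
  rw [count_integral W]
  intro x hx
  have : F x = 0 := by by_contra h; exact hx (hFW x h)
  simp [this]

end
end DZ
end

section
open MeasureTheory Filter Topology
open scoped ContDiff

namespace DZ
set_option linter.unusedSectionVars false

section lat
variable {ι : Type*} [Fintype ι] {𝕜 : ι → Type*} [∀ v, RCLike (𝕜 v)]
  [∀ v, MeasurableSpace (𝕜 v)] [∀ v, BorelSpace (𝕜 v)]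
  {κ : Type*} [Fintype κ] (μ : ∀ v, Measure (𝕜 v)) [∀ v, (μ v).IsAddHaarMeasure]
  {ν c c2 X : ℝ} [Nonempty ι]

theorem loc_G0 : ∃ K, 0 ≤ K ∧ ∀ σ ∈ Set.Icc (0:ℝ) 2, ∀ t : ℝ, ∀ b : ∀ v, 𝕜 v, (∀ v, ‖b v‖ ≤ 1/10) →
    ‖∏ v, ∫ x, Gl (nv 𝕜 v * σ) (nv 𝕜 v * t) (b v) x ∂μ v‖ ≤ K * wt (fun _ => |t|⁻¹) 2 b := by
  choose C hC using fun v => L1 (μ v) (2 * Module.finrank ℝ (𝕜 v))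
  refine ⟨∏ v, |C v|, Finset.prod_nonneg fun _ _ => abs_nonneg _, fun σ hσ t b hb => ?_⟩
  rw [norm_prod, wt, ← Finset.prod_mul_distrib]
  refine Finset.prod_le_prod (fun _ _ => norm_nonneg _) fun v _ => ?_
  have ht := abs_nonneg t
  rw [← div_eq_mul_inv, le_div_iff₀ (by positivity), mul_comm]
  refine le_trans ?_ ((hC v _ (nv_mem (𝕜 := 𝕜) v hσ) (nv 𝕜 v * t) (b v) (hb v)).trans (le_abs_self _))
  have h1 := nv_ge (𝕜 := 𝕜) v
  gcongr
  rw [abs_mul, abs_of_nonneg (show (0:ℝ) ≤ nv 𝕜 v by linarith), div_inv_eq_mul, mul_comm]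
  gcongr
  nlinarith

/-- conductor-like quantity -/
noncomputable def mv (t : ℝ) (b : ∀ v, 𝕜 v) (v : ι) : ℝ := 1 + |nv 𝕜 v * t| * ‖b v‖

lemma mv_ge (t : ℝ) (b : ∀ v, 𝕜 v) (v : ι) : 1 ≤ mv t b v := by
  unfold mv
  have : 0 ≤ |nv 𝕜 v * t| * ‖b v‖ := by positivity
  linarith

/-- square root of the box volume -/
noncomputable def sb (t : ℝ) (b : ∀ v, 𝕜 v) : ℝ := ∏ v, √(mv t b v ^ (Module.finrank ℝ (𝕜 v)))

lemma sb_pos (t : ℝ) (b : ∀ v, 𝕜 v) : 0 < sb t b :=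
  Finset.prod_pos fun v _ => Real.sqrt_pos.2 (pow_pos (lt_of_lt_of_le one_pos (mv_ge t b v)) _)

lemma sb_sq (t : ℝ) (b : ∀ v, 𝕜 v) : sb t b * sb t b = bv 𝕜 (mv t b) := by
  rw [sb, ← Finset.prod_mul_distrib, bv]
  refine Finset.prod_congr rfl fun v _ => Real.mul_self_sqrt (pow_nonneg ?_ _)
  linarith [mv_ge t b v]

theorem loc_G : ∃ K, 0 ≤ K ∧ ∀ σ ∈ Set.Icc (0:ℝ) 2, ∀ t : ℝ, ∀ b : ∀ v, 𝕜 v, (∀ v, ‖b v‖ ≤ 1/10) →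
    ∀ ξ : ∀ v, 𝕜 v,
    sb t b * ‖∏ v, ∫ x, Gl (nv 𝕜 v * σ) (nv 𝕜 v * t) (b v) x * chr (ξ v) x ∂μ v‖ ≤ K * wt (mv t b) 3 ξ := by
  choose C hC0 hC using fun v => L2c (μ v) (3 * Module.finrank ℝ (𝕜 v))
  refine ⟨∏ v, √(C v), Finset.prod_nonneg fun _ _ => Real.sqrt_nonneg _, fun σ hσ t b hb ξ => ?_⟩
  rw [norm_prod, wt, ← Finset.prod_mul_distrib, sb, ← Finset.prod_mul_distrib]
  refine Finset.prod_le_prod (fun _ _ => by positivity) fun v _ => ?_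
  have hm := mv_ge t b v
  have hw : 0 ≤ ‖ξ v‖ / mv t b v := by positivity
  rw [← div_eq_mul_inv, le_div_iff₀ (by positivity)]
  have := hC v _ (nv_mem (𝕜 := 𝕜) v hσ) (nv 𝕜 v * t) (b v) (hb v) (ξ v)
  change mv t b v ^ _ * ((1 + ‖ξ v‖ / mv t b v)^_ * _)^2 ≤ _ at this
  have h2 := Real.sqrt_le_sqrt this
  rw [Real.sqrt_mul (by positivity), Real.sqrt_sq (by positivity)] at h2
  refine le_trans (le_of_eq ?_) h2
  ring

/-- the correlation sum -/
noncomputable def Lat.T (L : Lat κ μ ν c c2 X) (σ t : ℝ) (β : κ → ℤ) : ℂ :=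
  ∑' n, Ph σ t (L.sig (n + β)) * (starRingEnd ℂ) (Ph σ t (L.sig n))

theorem Lat.T_bound (hν : 0 < ν) (hc : 0 < c) : ∃ C, 0 ≤ C ∧ ∀ X : ℝ, 0 < X → ∀ L : Lat κ μ ν c c2 X,
    ∀ σ ∈ Set.Icc (0:ℝ) 2, ∀ t : ℝ, ∀ β : κ → ℤ, (∀ v, ‖L.sig β v‖ ≤ 1/10) →
    ‖L.T μ σ t β‖ ≤ C * (X * wt (fun _ => |t|⁻¹) 2 (L.sig β) + sb t (L.sig β)) := by
  obtain ⟨K0, hK00, hK0⟩ := loc_G0 μ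
  obtain ⟨K, hK0', hK⟩ := loc_G μ
  refine ⟨c * K0 + c * K * (2 * 64^(dg 𝕜) / ν), by positivity, fun X hX L σ hσ t β hβ => ?_⟩
  set b := L.sig β with hb
  have hR : ∀ v : ι, 0 < mv t b v := fun v => lt_of_lt_of_le one_pos (mv_ge t b v)
  have hsb := sb_pos t b
  set g : (κ → ℤ) → ℂ := fun k => ∏ v, ∫ x, Gl (nv 𝕜 v * σ) (nv 𝕜 v * t) (b v) x * chr (L.xi k v) x ∂μ v with hg
  have hgb : ∀ k, ‖g k‖ ≤ (K / sb t b) * wt (mv t b) 3 (L.xi k) := by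
    intro k
    have := hK σ hσ t b hβ (L.xi k)
    rw [div_mul_eq_mul_div, le_div_iff₀ hsb, mul_comm]; exact this
  have hs : Summable g := summable_wt L.xi (ν * X) (by positivity) L.hxi (mv t b) hR g (K / sb t b)
    (fun k => (hgb k).trans (mul_le_mul_of_nonneg_left (wt_anti _ hR (by norm_num) _) (by positivity)))
  have hp := L.pois (fun v => Gl (nv 𝕜 v * σ) (nv 𝕜 v * t) (b v)) (fun v => Gl_continuous _ _ _)
    (fun v => hcs_of_ann fun x hx => (Gl_supp hx).1) hs
  have hT : L.T μ σ t β = (c * X : ℝ) * ∑' k, g k := by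
    rw [← hp, Lat.T]
    refine tsum_congr fun n => ?_
    rw [Ph, Ph, map_prod, ← Finset.prod_mul_distrib]
    refine Finset.prod_congr rfl fun v _ => ?_
    rw [map_add]; rfl
  have hbd := tsum_sub_zero_le g hs (fun k => (K / sb t b) * wt (mv t b) 3 (L.xi k))
    (fun k => mul_nonneg (by positivity) (wt_nonneg _ hR _ _)) _ (fun k _ => hgb k)
    (fun s hs => by
      rw [← Finset.mul_sum]
      exact mul_le_mul_of_nonneg_left (cnt_one L.xi (ν*X) (by positivity) L.hxi _ hR s hs) (by positivity))
  have hg0 : ‖g 0‖ ≤ K0 * wt (fun _ => |t|⁻¹) 2 b := by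
    have := hK0 σ hσ t b hβ
    simpa [hg, chr_zero'] using this
  have hfin : ‖∑' k, g k‖ ≤ K0 * wt (fun _ => |t|⁻¹) 2 b + (K / sb t b) * (2 * 64 ^ dg 𝕜 * (bv 𝕜 (mv t b) / (ν * X))) := by
    have : ∑' k, g k = g 0 + (∑' k, g k - g 0) := by ring
    rw [this]
    exact (norm_add_le _ _).trans (add_le_add hg0 hbd)
  rw [hT, norm_mul, Complex.norm_real, Real.norm_of_nonneg (by positivity)]
  rw [← sb_sq] at hfin
  have hw0 : 0 ≤ wt (fun _ => |t|⁻¹) 2 b := Finset.prod_nonneg fun v _ => by positivity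
  calc _ ≤ c * X * (K0 * wt (fun _ => |t|⁻¹) 2 b + (K / sb t b) * (2 * 64 ^ dg 𝕜 * (sb t b * sb t b / (ν * X)))) := by gcongr
    _ = c * K0 * (X * wt (fun _ => |t|⁻¹) 2 b) + c * K * (2 * 64^(dg 𝕜) / ν) * sb t b := by
        field_simp
    _ ≤ _ := by
        have : 0 ≤ c * K * (2 * 64^(dg 𝕜) / ν) * (X * wt (fun _ => |t|⁻¹) 2 b) := by positivity
        have : 0 ≤ c * K0 * sb t b := by positivity
        linarith

theorem Lat.mid (hν : 0 < ν) (hc : 0 < c) (hc2 : 0 < c2) : ∃ C, 0 ≤ C ∧ ∀ X : ℝ, 0 < X → ∀ L : Lat κ μ ν c c2 X,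
    ∀ σ ∈ Set.Icc (0:ℝ) 2, ∀ t : ℝ, ∀ τ : ℝ, 1 ≤ τ → |t| = τ^3 → τ^(dg 𝕜) ≤ X →
    ‖L.S μ σ t‖^2 ≤ C * (X * τ^(dg 𝕜) + X^2 / τ^(2 * dg 𝕜)) := by
  obtain ⟨C, hC0, hC⟩ := Lat.T_bound (κ := κ) (c2 := c2) μ hν hc
  set d := dg 𝕜 with hd
  -- constants
  set A1 : ℝ := 256^d * (1 + 2^d / ν) with hA1
  set A2 : ℝ := 256^d * (20^d + 1 / ν) with hA2
  refine ⟨A1 * (40^d / c2) * (C * (64^d * (1 + 1/ν) + A2 * 2^d)), by positivity, fun X hX L σ hσ t τ hτ hτt hXτ => ?_⟩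
  have hτ0 : 0 < τ := by linarith
  have hX1 : 1 ≤ X := (one_le_pow₀ hτ).trans hXτ
  have ht0 : 0 < |t| := by rw [hτt]; positivity
  set Q : ℝ := (20 * τ)⁻¹ with hQ
  have hQ0 : 0 < Q := by positivity
  have hQ1 : Q ≤ 1/20 := by
    rw [hQ, mul_inv]
    have : τ⁻¹ ≤ 1 := inv_le_one_of_one_le₀ hτ
    linarith
  have hνX : 0 < ν / X := by positivity
  obtain ⟨hUf, -⟩ := box_card L.sig (ν / X) hνX L.hsig (fun _ => Q/2) (fun _ => by positivity)
  obtain ⟨hDf, hDc⟩ := box_card L.sig (ν / X) hνX L.hsig (fun _ => Q) (fun _ => by positivity)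
  obtain ⟨hWf, hWc⟩ := box_card L.sig (ν / X) hνX L.hsig (fun _ => 2) (fun _ => by norm_num)
  have hUl := L.blich (fun _ => Q/2) (fun _ => by positivity)
  rw [bv_const] at hDc hWc hUl
  rw [Set.ncard_eq_toFinset_card _ hUf] at hUl
  rw [Set.ncard_eq_toFinset_card _ hDf] at hDc
  rw [Set.ncard_eq_toFinset_card _ hWf] at hWc
  have hv := vdc_sum (fun n => Ph σ t (L.sig n)) _ (fun n => Ph_norm_le hσ t _) hUf.toFinset hWf.toFinset hDf.toFinset
    (by
      intro a b hb hne
      rw [Set.Finite.mem_toFinset] at hb ⊢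
      intro v
      have h1 := (Ph_supp hne v).2
      have h2 := hb v
      rw [map_add, Pi.add_apply] at h1
      have h3 := norm_sub_le (L.sig a v + L.sig b v) (L.sig b v)
      rw [add_sub_cancel_right] at h3
      linarith)
    (by
      intro a hne
      rw [Set.Finite.mem_toFinset]
      intro v
      have h1 := (Ph_supp hne v).2
      linarith)
    (by
      intro b hb e he
      rw [Set.Finite.mem_toFinset] at hb he ⊢
      intro v
      have h1 := hb v
      have h2 := he v
      rw [map_sub, Pi.sub_apply]
      refine (norm_sub_le _ _).trans ?_
      linarith)
  change ‖L.S μ σ t‖^2 * _ ≤ _ * ∑ b ∈ hDf.toFinset, ‖L.T μ σ t b‖ at hv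
  -- bound the correlation sum
  have hT : ∑ b ∈ hDf.toFinset, ‖L.T μ σ t b‖ ≤ C * (X * (64^d * (1 + X / (ν * τ^(3*d)))) + hDf.toFinset.card * (2 * τ)^d) := by
    have h1 : ∀ b ∈ hDf.toFinset, ‖L.T μ σ t b‖ ≤ C * (X * wt (fun _ => |t|⁻¹) 2 (L.sig b) + (2*τ)^d) := by
      intro b hb
      rw [Set.Finite.mem_toFinset] at hb
      have hb' : ∀ v, ‖L.sig b v‖ ≤ Q := hb
      refine (hC X hX L σ hσ t b (fun v => (hb' v).trans (by linarith))).trans ?_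
      gcongr
      rw [sb, hd, dg, ← Finset.prod_pow_eq_pow_sum]
      refine Finset.prod_le_prod (fun _ _ => Real.sqrt_nonneg _) fun v _ => ?_
      rw [Real.sqrt_le_left (by positivity), ← pow_mul, mul_comm (Module.finrank ℝ (𝕜 v)) 2, pow_mul]
      have h0 := mv_ge t (L.sig b) v
      refine pow_le_pow_left₀ (show (0:ℝ) ≤ mv t (L.sig b) v by linarith) ?_ _
      rw [mv, abs_mul, hτt, abs_of_nonneg (show (0:ℝ) ≤ nv 𝕜 v by linarith [nv_ge (𝕜 := 𝕜) v])]
      have h2 := nv_le (𝕜 := 𝕜) v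
      calc 1 + nv 𝕜 v * τ^3 * ‖L.sig b v‖ ≤ 1 + 2 * τ^3 * Q := by
            gcongr
            exact hb' v
        _ = 1 + τ^2 / 10 := by rw [hQ]; field_simp; ring
        _ ≤ _ := by nlinarith
    refine (Finset.sum_le_sum h1).trans ?_
    rw [← Finset.mul_sum, Finset.sum_add_distrib, ← Finset.mul_sum, Finset.sum_const, nsmul_eq_mul]
    gcongr
    have h3 := cnt' L.sig (ν / X) hνX L.hsig (fun _ => |t|⁻¹) (fun _ => by positivity) hDf.toFinset
    refine h3.trans (le_of_eq ?_)
    rw [bv_const, hτt, ← hd, inv_pow, ← pow_mul]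
    field_simp
  have hY : 20^d * (X * Q^d) = X / τ^d := by
    rw [hQ, inv_pow, mul_pow]; field_simp
  have hY1 : 1 ≤ X / τ^d := by rw [le_div_iff₀ (by positivity)]; linarith
  have hDc' : (hDf.toFinset.card : ℝ) ≤ A2 * (X / τ^d) := by
    refine hDc.trans ?_
    have e : Q^d / (ν/X) = (1/ν) * (X * Q^d) := by field_simp
    have h4 : X * Q^d ≤ X / τ^d := by
      rw [← hY]
      have : (1:ℝ) ≤ 20^d := one_le_pow₀ (by norm_num)
      have : 0 ≤ X * Q^d := by positivity
      nlinarith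
    rw [e, hA2, mul_assoc]
    gcongr
    have h20 : (1:ℝ) ≤ 20^d := one_le_pow₀ (by norm_num)
    have h5 : 1 ≤ 20^d * (X/τ^d) := one_le_mul_of_one_le_of_one_le h20 hY1
    have h6 : (1/ν) * (X * Q^d) ≤ (1/ν) * (X/τ^d) := by gcongr
    linarith
  have hWc' : (hWf.toFinset.card : ℝ) ≤ A1 * X := by
    refine hWc.trans ?_
    rw [hA1, mul_assoc]
    gcongr
    have : (2:ℝ)^dg 𝕜 / (ν / X) = 2^d / ν * X := by field_simp; rfl
    rw [this]; linarith
  have hU' : c2 / 40^d * (X / τ^d) ≤ hUf.toFinset.card := by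
    refine le_trans (le_of_eq ?_) hUl
    rw [← hY, ← hd, div_pow]
    have : (40:ℝ)^d = 20^d * 2^d := by rw [← mul_pow]; norm_num
    rw [this]; field_simp
  have hT2 : ∑ b ∈ hDf.toFinset, ‖L.T μ σ t b‖ ≤ C * (64^d * (1 + 1/ν) + A2 * 2^d) * (X + X^2 / τ^(3*d)) := by
    refine hT.trans ?_
    rw [mul_assoc C]
    gcongr
    have e1 : X * (64^d * (1 + X / (ν * τ^(3*d)))) = 64^d * (X + (1/ν) * (X^2/τ^(3*d))) := by field_simp
    have e2 : (hDf.toFinset.card : ℝ) * (2 * τ)^d ≤ A2 * 2^d * X := by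
      calc _ ≤ A2 * (X / τ^d) * (2 * τ)^d := by gcongr
        _ = _ := by rw [mul_pow]; field_simp
    have p1 : 0 ≤ X^2/τ^(3*d) := by positivity
    have p2 : 64^d * (X + (1/ν) * (X^2/τ^(3*d))) ≤ 64^d * ((1 + 1/ν) * (X + X^2/τ^(3*d))) := by
      gcongr
      have : 0 ≤ 1/ν * X := by positivity
      nlinarith
    have p3 : A2 * 2^d * X ≤ A2 * 2^d * (X + X^2/τ^(3*d)) := by gcongr; linarith
    rw [e1]
    linarith
  -- conclude
  set E := C * (64^d * (1 + 1/ν) + A2 * 2^d) with hE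
  have hE0 : 0 ≤ E := by positivity
  have h7 : ‖L.S μ σ t‖^2 * (c2 / 40^d * (X / τ^d)) ≤ A1 * X * (E * (X + X^2/τ^(3*d))) := by
    calc _ ≤ ‖L.S μ σ t‖^2 * hUf.toFinset.card := by gcongr
      _ ≤ _ := hv
      _ ≤ _ := by gcongr
  rw [← le_div_iff₀ (by positivity)] at h7
  refine h7.trans (le_of_eq ?_)
  have e3 : τ^(3*d) = τ^d * τ^(2*d) := by rw [← pow_add]; congr 1; ring
  rw [e3]
  field_simp

end lat
end DZ
end

section
open MeasureTheory Filter Topology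
open scoped ContDiff

namespace DZ
set_option linter.unusedSectionVars false

section lat
variable {ι : Type*} [Fintype ι] {𝕜 : ι → Type*} [∀ v, RCLike (𝕜 v)]
  [∀ v, MeasurableSpace (𝕜 v)] [∀ v, BorelSpace (𝕜 v)]
  {κ : Type*} [Fintype κ] (μ : ∀ v, Measure (𝕜 v)) [∀ v, (μ v).IsAddHaarMeasure] [Nonempty ι]

lemma nm_smul (y : ι → ℝ) (hy : ∀ v, 0 < y v) (x : ∀ v, 𝕜 v) : nm (fun v => y v • x v) = bv 𝕜 y * nm x := by
  rw [nm, bv, nm, ← Finset.prod_mul_distrib]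
  refine Finset.prod_congr rfl fun v _ => ?_
  rw [norm_smul, Real.norm_of_nonneg (hy v).le, mul_pow]

lemma bv_inv (y : ι → ℝ) : bv 𝕜 (fun v => (y v)⁻¹) = (bv 𝕜 y)⁻¹ := by
  simp only [bv, inv_pow, Finset.prod_inv_distrib]

lemma bv_mul (y z : ι → ℝ) : bv 𝕜 (fun v => y v * z v) = bv 𝕜 y * bv 𝕜 z := by
  simp only [bv, mul_pow, Finset.prod_mul_distrib]

lemma chr_smul {F : Type*} [RCLike F] (r : ℝ) (η x : F) : chr η (r • x) = chr (r • η) x := by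
  rw [chr, chr, mul_smul_comm, smul_mul_assoc]

/-- scaling a lattice -/
noncomputable def Lat.scale {ν c c2 X : ℝ} (L : Lat κ μ ν c c2 1) (y : ι → ℝ) (hy : ∀ v, 0 < y v)
    (hX : X = (bv 𝕜 y)⁻¹) : Lat κ μ ν c c2 X where
  sig := { toFun := fun n v => y v • L.sig n v
           map_zero' := by funext v; simp
           map_add' := by intro a b; funext v; simp }
  xi := { toFun := fun n v => (y v)⁻¹ • L.xi n v
          map_zero' := by funext v; simp
          map_add' := by intro a b; funext v; simp }
  hsig := by
    intro n hn
    have h := L.hsig n hn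
    have hb := bv_pos (𝕜 := 𝕜) y hy
    change _ ≤ nm (fun v => y v • L.sig n v)
    rw [nm_smul y hy, hX, div_inv_eq_mul, mul_comm]
    rw [div_one] at h
    gcongr
  hxi := by
    intro n hn
    have h := L.hxi n hn
    have hb := bv_pos (𝕜 := 𝕜) y hy
    change _ ≤ nm (fun v => (y v)⁻¹ • L.xi n v)
    rw [nm_smul _ (fun v => inv_pos.2 (hy v)), hX, bv_inv, mul_comm]
    rw [mul_one] at h
    gcongr
  pois := by
    intro f hf hc hs
    have key : ∀ (k : κ → ℤ) (v : ι), ∫ x, f v (y v • x) * chr (L.xi k v) x ∂μ v =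
        ((y v ^ Module.finrank ℝ (𝕜 v))⁻¹ : ℝ) * ∫ x, f v x * chr ((y v)⁻¹ • L.xi k v) x ∂μ v := by
      intro k v
      have h := Measure.integral_comp_smul (μ v) (fun x => f v x * chr ((y v)⁻¹ • L.xi k v) x) (y v)
      rw [abs_of_pos (inv_pos.2 (pow_pos (hy v) _)), Complex.real_smul] at h
      rw [← h]
      congr 1
      funext x
      rw [chr_smul, smul_smul, mul_inv_cancel₀ (hy v).ne', one_smul]
    have key2 : ∀ k : κ → ℤ, ∏ v, ∫ x, f v (y v • x) * chr (L.xi k v) x ∂μ v =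
        (X : ℂ) * ∏ v, ∫ x, f v x * chr ((y v)⁻¹ • L.xi k v) x ∂μ v := by
      intro k
      rw [Finset.prod_congr rfl fun v _ => key k v, Finset.prod_mul_distrib]
      congr 1
      rw [hX, bv, ← Finset.prod_inv_distrib]
      push_cast
      rfl
    have hs' : Summable (fun k : κ → ℤ => ∏ v, ∫ x, f v x * chr ((y v)⁻¹ • L.xi k v) x ∂μ v) := hs
    have h := L.pois (fun v x => f v (y v • x)) (fun v => (hf v).comp (continuous_const_smul _))
      (fun v => (hc v).comp_homeomorph (Homeomorph.smulOfNeZero (y v) (hy v).ne'))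
      (by simp only [key2]; exact hs'.mul_left _)
    simp only [key2, tsum_mul_left] at h
    refine h.trans ?_
    push_cast
    simp only [mul_one, mul_assoc]
    rfl
  blich := by
    intro r hr
    have hb := bv_pos (𝕜 := 𝕜) y hy
    have h := L.blich (fun v => (y v)⁻¹ * r v) (fun v => mul_pos (inv_pos.2 (hy v)) (hr v))
    rw [bv_mul, bv_inv, ← hX, mul_one, ← mul_assoc] at h
    refine h.trans (le_of_eq ?_)
    congr 3
    ext n
    refine forall_congr' fun v => ?_
    change _ ↔ ‖y v • L.sig n v‖ ≤ r v
    rw [norm_smul, Real.norm_of_nonneg (hy v).le, ← div_eq_inv_mul, le_div_iff₀ (hy v), mul_comm]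

lemma Lat.scale_sig {ν c c2 X : ℝ} (L : Lat κ μ ν c c2 1) (y : ι → ℝ) (hy : ∀ v, 0 < y v)
    (hX : X = (bv 𝕜 y)⁻¹) (n : κ → ℤ) (v : ι) : (L.scale μ y hy hX).sig n v = y v • L.sig n v := rfl

lemma haar_e (e : (κ → ℝ) ≃L[ℝ] (∀ v, 𝕜 v)) : ∃ c : ℝ, 0 < c ∧ ∀ f : ∀ v, 𝕜 v → ℂ,
    ∫ u, ∏ v, f v (e u v) = (c : ℂ) * ∏ v, ∫ x, f v x ∂μ v := by
  set m : Measure (∀ v, 𝕜 v) := Measure.map e volume with hm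
  have : m.IsAddHaarMeasure := ContinuousLinearEquiv.isAddHaarMeasure_map e volume
  have h1 := Measure.isAddLeftInvariant_eq_smul m (Measure.pi μ)
  refine ⟨(Measure.addHaarScalarFactor m (Measure.pi μ) : ℝ), ?_, fun f => ?_⟩
  · exact_mod_cast Measure.addHaarScalarFactor_pos_of_isAddHaarMeasure m (Measure.pi μ)
  · have h2 : ∫ u, ∏ v, f v (e u v) = ∫ x, ∏ v, f v (x v) ∂m := by
      exact (e.toHomeomorph.toMeasurableEquiv.measurableEmbedding.integral_map (μ := volume) (fun x : ∀ v, 𝕜 v => ∏ v, f v (x v))).symm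
    have h3 := congrArg (fun m' : Measure (∀ v, 𝕜 v) => ∫ x, ∏ v, f v (x v) ∂m') h1
    rw [h2, h3, integral_smul_nnreal_measure, integral_fintype_prod_eq_prod]
    rfl

include μ in
lemma blich_aux (sig : (κ → ℤ) →+ ∀ v, 𝕜 v) (e : (κ → ℝ) ≃L[ℝ] (∀ v, 𝕜 v)) (he : ∀ n, sig n = e (zr n)) {ν : ℝ}
    (hν : 0 < ν) (hsig : ∀ n, n ≠ 0 → ν ≤ nm (sig n)) :
    ∃ c2 : ℝ, 0 < c2 ∧ ∀ r : ι → ℝ, (∀ v, 0 < r v) →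
    c2 * bv 𝕜 r ≤ ({n : κ → ℤ | ∀ v, ‖sig n v‖ ≤ r v}.ncard : ℝ) := by
  obtain ⟨c, hc, hcf⟩ := haar_e μ e
  have hI : ∀ v, 0 < ∫ x, phi 0 x ∂μ v := by
    intro v
    refine (phi_continuous (𝕜 := 𝕜 v) 0).integral_pos_of_hasCompactSupport_nonneg_nonzero
      (HasCompactSupport.of_support_subset_isCompact ann_compact fun x hx => phi_supp hx) (phi_nonneg 0) (x := 1) ?_
    have : bmp 1 = 1 := bmp.one_of_mem_closedBall (by simp [bmp])
    simp [phi, this]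
  refine ⟨c * (∏ v, ∫ x, phi 0 x ∂μ v) * (5/12)^(dg 𝕜) / 3 ^ Fintype.card ι, ?_, fun r hr => ?_⟩
  · have := Finset.prod_pos fun v (_ : v ∈ Finset.univ) => hI v
    positivity
  set N := {n : κ → ℤ | ∀ v, ‖sig n v‖ ≤ r v} with hN
  have hNf : N.Finite := (box_card sig ν hν hsig r hr).1
  set f : (κ → ℝ) → ℂ := fun u => ∏ v, (phi 0 ((5/12 * r v)⁻¹ • e u v) : ℂ) with hf
  have hr' : ∀ v, 0 < 5/12 * r v := fun v => by have := hr v; positivity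
  have hsupp : ∀ u, f u ≠ 0 → ∀ v, ‖e u v‖ ≤ r v / 2 := by
    intro u hu v
    have h1 := (phi_supp (Complex.ofReal_ne_zero.1 (Finset.prod_ne_zero_iff.1 hu v (Finset.mem_univ v)))).2
    rw [norm_smul, Real.norm_of_nonneg (inv_pos.2 (hr' v)).le, ← div_eq_inv_mul, div_le_iff₀ (hr' v)] at h1
    linarith
  have hfc : Continuous f := by
    refine continuous_finsetProd _ fun v _ => Complex.continuous_ofReal.comp ((phi_continuous 0).comp ?_)
    have := (continuous_apply v).comp e.continuous
    exact this.const_smul _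
  have hfs : HasCompactSupport f := by
    have hK : IsCompact (Set.univ.pi fun v => Metric.closedBall (0 : 𝕜 v) (r v / 2)) :=
      isCompact_univ_pi fun v => isCompact_closedBall _ _
    refine HasCompactSupport.of_support_subset_isCompact (e.toHomeomorph.isCompact_preimage.2 hK) fun u hu => ?_
    intro v _
    simpa using hsupp u hu v
  have hfn : ∀ u, ‖f u‖ ≤ 3 ^ Fintype.card ι := by
    intro u
    rw [hf]; simp only
    rw [norm_prod]
    refine (Finset.prod_le_prod (g := fun _ => 3) (fun _ _ => norm_nonneg _) fun v _ => ?_).trans (by simp)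
    rw [Complex.norm_real, Real.norm_of_nonneg (phi_nonneg _ _)]
    exact phi_le le_rfl (by norm_num) _
  have hper : ∀ x, ‖perz f x‖ ≤ 3 ^ Fintype.card ι * N.ncard := by
    intro x
    by_cases hx : ∃ n0, f (x + zr n0) ≠ 0
    · obtain ⟨n0, hn0⟩ := hx
      have h1 : ∀ n, n ∉ hNf.toFinset → f (x + zr (n0 + n)) = 0 := by
        intro n hn
        by_contra h2
        apply hn
        rw [Set.Finite.mem_toFinset]
        intro v
        have h3 := hsupp _ h2 v
        have h4 := hsupp _ hn0 v
        have h5 : sig n v = e (x + zr (n0 + n)) v - e (x + zr n0) v := by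
          rw [he, zr_add, map_add, map_add, map_add]; simp
        rw [h5]
        exact (norm_sub_le _ _).trans (by linarith)
      rw [perz, ← (Equiv.addLeft n0).tsum_eq (fun n => f (x + zr n))]
      simp only [Equiv.coe_addLeft]
      rw [tsum_eq_sum h1]
      refine (norm_sum_le _ _).trans ((Finset.sum_le_sum fun n _ => hfn _).trans (le_of_eq ?_))
      rw [Finset.sum_const, nsmul_eq_mul, Set.ncard_eq_toFinset_card _ hNf, mul_comm]
    · push Not at hx
      rw [perz]
      simp only [hx, tsum_zero, norm_zero]
      positivity
  have hQ : volume {x : κ → ℝ | ∀ i, x i ∈ Set.Ioc (0:ℝ) (0 + 1)} = 1 := by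
    have := Real.volume_pi_Ioc (a := fun _ : κ => (0:ℝ)) (b := fun _ => 0 + 1)
    simp only [add_zero, zero_add, sub_zero, ENNReal.ofReal_one, Finset.prod_const_one] at this
    rw [← this]
    congr 1
    ext x; simp
  have h1 := norm_setIntegral_le_of_norm_le_const (μ := volume) (by rw [hQ]; simp) (fun x (_ : x ∈ {x : κ → ℝ | ∀ i, x i ∈ Set.Ioc (0:ℝ) (0 + 1)}) => hper x)
  rw [perz_unfold f hfc hfs, Measure.real, hQ, ENNReal.toReal_one, mul_one] at h1
  rw [hf, hcf (fun v x => (phi 0 ((5/12 * r v)⁻¹ • x) : ℂ))] at h1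
  have h2 : ∀ v, ∫ x, (phi 0 ((5/12 * r v)⁻¹ • x) : ℂ) ∂μ v =
      (((5/12 * r v)^(Module.finrank ℝ (𝕜 v)) * ∫ x, phi 0 x ∂μ v : ℝ) : ℂ) := by
    intro v
    rw [integral_complex_ofReal, Measure.integral_comp_inv_smul (μ v) (fun x => phi 0 x), abs_of_pos (pow_pos (hr' v) _), smul_eq_mul]
  simp only [h2] at h1
  rw [← Complex.ofReal_prod, ← Complex.ofReal_mul, Complex.norm_real, Finset.prod_mul_distrib] at h1
  have h3 := (le_abs_self _).trans h1
  rw [div_mul_eq_mul_div, div_le_iff₀ (by positivity)]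
  have h4 : ∏ v, (5/12 * r v)^(Module.finrank ℝ (𝕜 v)) = (5/12)^(dg 𝕜) * bv 𝕜 r := bv_smul (𝕜 := 𝕜) _ _
  rw [h4] at h3
  linarith

/-- base lattice from linear algebra data -/
theorem exists_lat (sig xi : (κ → ℤ) →+ ∀ v, 𝕜 v) (e : (κ → ℝ) ≃L[ℝ] (∀ v, 𝕜 v)) (he : ∀ n, sig n = e (zr n)) {ν : ℝ}
    (hν : 0 < ν) (hsig : ∀ n, n ≠ 0 → ν ≤ nm (sig n)) (hxi : ∀ n, n ≠ 0 → ν ≤ nm (xi n))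
    (hdual : ∀ (k : κ → ℤ) (u : κ → ℝ), ∑ v, RCLike.re (xi k v * e u v) = ∑ i, (k i : ℝ) * u i) :
    ∃ c c2 : ℝ, 0 < c ∧ 0 < c2 ∧ ∃ L : Lat κ μ ν c c2 1, L.sig = sig := by
  obtain ⟨c, hc, hcf⟩ := haar_e μ e
  obtain ⟨c2, hc2, hb⟩ := blich_aux μ sig e he hν hsig
  refine ⟨c, c2, hc, hc2, ⟨sig, xi, ?_, ?_, ?_, ?_⟩, rfl⟩
  · intro n hn; rw [div_one]; exact hsig n hn
  · intro n hn; rw [mul_one]; exact hxi n hn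
  · intro f hf hfc hs
    have hech : ∀ k u, ech k u = ∏ v, chr (xi k v) (e u v) := by
      intro k u
      simp only [ech, chr]
      rw [← Complex.exp_sum, ← Finset.sum_mul, ← hdual k u]
      congr 2
      push_cast
      rw [Finset.mul_sum, ← Finset.sum_neg_distrib]
    have hintg : ∀ k, ∫ u, (∏ v, f v (e u v)) * ech k u = (c : ℂ) * ∏ v, ∫ x, f v x * chr (xi k v) x ∂μ v := by
      intro k
      rw [← hcf (fun v x => f v x * chr (xi k v) x)]
      congr 1
      funext u
      rw [hech, Finset.prod_mul_distrib]
    have h := poisson (fun u => ∏ v, f v (e u v)) ?_ ?_ ?_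
    · simp only [hintg, tsum_mul_left] at h
      rw [mul_one, ← h]
      simp only [he]
    · exact continuous_finsetProd _ fun v _ => (hf v).comp ((continuous_apply v).comp e.continuous)
    · have hK : IsCompact (Set.univ.pi fun v => tsupport (f v)) :=
        isCompact_univ_pi fun v => hfc v
      refine HasCompactSupport.of_support_subset_isCompact (e.toHomeomorph.isCompact_preimage.2 hK) fun u hu => ?_
      intro v _
      exact subset_tsupport _ (Finset.prod_ne_zero_iff.1 hu v (Finset.mem_univ v))
    · simp only [hintg]
      exact hs.mul_left _
  · intro r hr
    rw [mul_one]; exact hb r hr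

end lat
end DZ
end

section
open MeasureTheory Filter Topology
open scoped ContDiff

namespace DZ
set_option linter.unusedSectionVars false

section nf
open NumberField

variable {K : Type} [Field K]

/-- realization of all archimedean completions -/
structure EmbD (𝕜 : InfinitePlace K → Type) [∀ w, RCLike (𝕜 w)] where
  /-- embedding -/
  emb : ∀ w, K →+* 𝕜 w
  norm_emb : ∀ w x, ‖emb w x‖ = w x
  re_emb : ∀ w x, RCLike.re (emb w x) = (w.embedding x).re
  fr : ∀ w, Module.finrank ℝ (𝕜 w) = w.mult

/-- real or complex field -/
def BF : Bool → Type
  | true => ℝ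
  | false => ℂ

/-- structure on `BF` -/
noncomputable def instBF (b : Bool) : RCLike (BF b) :=
  match b with
  | true => inferInstanceAs (RCLike ℝ)
  | false => inferInstanceAs (RCLike ℂ)

lemma exists_embB (b : Bool) (w : InfinitePlace K) (h : b = true ↔ w.IsReal) : letI := instBF b
    ∃ f : K →+* BF b, (∀ x, ‖f x‖ = w x) ∧ (∀ x, RCLike.re (f x) = (w.embedding x).re) ∧
      Module.finrank ℝ (BF b) = w.mult := by
  cases b
  · refine ⟨w.embedding, fun x => InfinitePlace.norm_embedding_eq w x, fun x => rfl, ?_⟩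
    have h1 : ¬ w.IsReal := fun hw => by simpa using h.2 hw
    rw [InfinitePlace.mult, if_neg h1]
    exact Complex.finrank_real_complex
  · have hw := h.1 rfl
    refine ⟨InfinitePlace.embedding_of_isReal hw, fun x => InfinitePlace.norm_embedding_of_isReal hw x, fun x => ?_, ?_⟩
    · rw [← InfinitePlace.embedding_of_isReal_apply hw, Complex.ofReal_re]
      rfl
    · rw [InfinitePlace.mult, if_pos hw]
      exact Module.finrank_self ℝ

variable (K) in
lemma exists_embD : ∃ (𝕜 : InfinitePlace K → Type) (_ : ∀ w, RCLike (𝕜 w)), Nonempty (EmbD 𝕜) := by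
  classical
  choose f hf using fun w : InfinitePlace K => exists_embB (decide w.IsReal) w (by simp)
  letI : ∀ w : InfinitePlace K, RCLike (BF (decide w.IsReal)) := fun w => instBF _
  exact ⟨fun w => BF (decide w.IsReal), this, ⟨⟨f, fun w => (hf w).1, fun w => (hf w).2.1, fun w => (hf w).2.2⟩⟩⟩

variable [NumberField K] {𝕜 : InfinitePlace K → Type} [∀ w, RCLike (𝕜 w)] (D : EmbD 𝕜)
  [∀ w, MeasurableSpace (𝕜 w)] [∀ w, BorelSpace (𝕜 w)] (μ : ∀ w, Measure (𝕜 w)) [∀ w, (μ w).IsAddHaarMeasure]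

lemma nm_emb (x : K) : nm (fun w : InfinitePlace K => D.emb w x) = |(Algebra.norm ℚ x : ℝ)| := by
  rw [nm]
  simp only [D.norm_emb, D.fr]
  rw [InfinitePlace.prod_eq_abs_norm]
  push_cast; rfl

include D in
lemma dg_KF : dg 𝕜 = Module.finrank ℚ K := by
  rw [dg, ← InfinitePlace.sum_mult_eq]
  exact Finset.sum_congr rfl fun w _ => D.fr w

lemma trace_emb (x : K) : ((Algebra.trace ℚ K x : ℚ) : ℝ) = ∑ w : InfinitePlace K, (w.mult : ℝ) * RCLike.re (D.emb w x) := by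
  classical
  have h1 := congrArg Complex.re (trace_eq_sum_embeddings (K := ℚ) (L := K) ℂ (x := x))
  have h0 : ((algebraMap ℚ ℂ) ((Algebra.trace ℚ K) x)).re = ((Algebra.trace ℚ K x : ℚ) : ℝ) := by
    simp
  rw [h0] at h1
  rw [h1, Complex.re_sum, ← (RingHom.equivRatAlgHom K ℂ).sum_comp]
  have h2 : ∀ φ : K →+* ℂ, ((RingHom.equivRatAlgHom K ℂ φ) x).re = RCLike.re (D.emb (InfinitePlace.mk φ) x) := by
    intro φ
    rw [D.re_emb]
    rcases InfinitePlace.embedding_mk_eq φ with h | h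
    · rw [h]; rfl
    · rw [h]; simp
  simp only [h2]
  rw [← Finset.sum_fiberwise Finset.univ (fun φ : K →+* ℂ => InfinitePlace.mk φ)]
  refine Finset.sum_congr rfl fun w _ => ?_
  rw [Finset.sum_congr rfl (g := fun _ => RCLike.re (D.emb w x)) (fun φ hφ => by rw [(Finset.mem_filter.1 hφ).2])]
  rw [Finset.sum_const, InfinitePlace.card_filter_mk_eq, nsmul_eq_mul]

lemma norm_ge_one {x : K} (hx : IsIntegral ℤ x) (h0 : x ≠ 0) : 1 ≤ |(Algebra.norm ℚ x : ℝ)| := by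
  have h := Algebra.isIntegral_norm ℚ hx
  obtain ⟨m, hm⟩ := IsIntegrallyClosed.isIntegral_iff.1 h
  have hne : Algebra.norm ℚ x ≠ 0 := Algebra.norm_ne_zero_iff.2 h0
  rw [← hm] at hne ⊢
  have : m ≠ 0 := by rintro rfl; simp at hne
  have h2 := Int.one_le_abs this
  simp only [eq_intCast, Rat.cast_intCast]
  exact_mod_cast h2

/-- lattices attached to ideals -/
theorem lat_ideal (J : Ideal (𝓞 K)) (hJ : J ≠ ⊥) :
    ∃ (κ : Type) (_ : Fintype κ) (ν c c2 : ℝ) (_ : 0 < ν) (_ : 0 < c) (_ : 0 < c2)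
      (L : Lat κ μ ν c c2 1) (g : (κ → ℤ) ≃ J), (g 0 = 0) ∧ ∀ n w, L.sig n w = D.emb w ((g n : 𝓞 K) : K) := by
  classical
  have hJ' : ((J : FractionalIdeal (nonZeroDivisors (𝓞 K)) K)) ≠ 0 := by
    rwa [Ne, FractionalIdeal.coeIdeal_eq_zero]
  set I := Units.mk0 _ hJ' with hI
  obtain ⟨κ, _, b, hb⟩ : ∃ (κ : Type) (_ : Fintype κ) (b : Module.Basis κ ℚ K), ∀ x,
      x ∈ Submodule.span ℤ (Set.range b) ↔ x ∈ (I : FractionalIdeal (nonZeroDivisors (𝓞 K)) K) :=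
    ⟨_, inferInstance, basisOfFractionalIdeal K I, fun x => mem_span_basisOfFractionalIdeal K⟩
  set β := (Algebra.traceForm ℚ K).dualBasis (traceForm_nondegenerate ℚ K) b with hβ
  have hdual : ∀ i j, Algebra.trace ℚ K (β i * b j) = if j = i then 1 else 0 := by
    intro i j
    have := LinearMap.BilinForm.apply_dualBasis_left (traceForm_nondegenerate ℚ K) b i j
    rwa [Algebra.traceForm_apply] at this
  -- combination maps
  have hcomb : ∀ (B : Module.Basis κ ℚ K), ∃ G : (κ → ℤ) →+ K, (∀ n, G n = ∑ i, (n i : ℚ) • B i) ∧ Function.Injective G := by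
    intro B
    refine ⟨{ toFun := fun n => ∑ i, (n i : ℚ) • B i
              map_zero' := by simp
              map_add' := by intro x y; simp [add_smul, Finset.sum_add_distrib] }, fun n => rfl, ?_⟩
    rw [injective_iff_map_eq_zero]
    intro n hn
    have h1 := Fintype.linearIndependent_iff.1 B.linearIndependent (fun i => (n i : ℚ)) hn
    funext i
    exact_mod_cast h1 i
  obtain ⟨G, hG, hGi⟩ := hcomb b
  obtain ⟨H, hH, hHi⟩ := hcomb β
  have hGmem : ∀ x : K, (∃ n, G n = x) ↔ ∃ y : J, ((y : 𝓞 K) : K) = x := by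
    intro x
    have h1 := hb x
    rw [Submodule.mem_span_range_iff_exists_fun] at h1
    have h2 : (∃ n, G n = x) ↔ ∃ c : κ → ℤ, ∑ i, c i • b i = x := by
      refine exists_congr fun n => ?_
      rw [hG]
      simp only [Int.cast_smul_eq_zsmul]
    rw [h2, h1]
    constructor
    · intro h
      obtain ⟨y, hy, hyx⟩ := (FractionalIdeal.mem_coeIdeal _).1 h
      exact ⟨⟨y, hy⟩, hyx⟩
    · rintro ⟨y, hy⟩
      exact (FractionalIdeal.mem_coeIdeal _).2 ⟨y, y.2, hy⟩
  choose g hg using fun n => (hGmem (G n)).1 ⟨n, rfl⟩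
  have hgb : Function.Bijective g := by
    constructor
    · intro m n h
      apply hGi
      rw [← hg, ← hg, h]
    · intro y
      obtain ⟨n, hn⟩ := (hGmem ((y : 𝓞 K) : K)).2 ⟨y, rfl⟩
      refine ⟨n, ?_⟩
      have := hg n
      rw [hn] at this
      exact Subtype.ext (RingOfIntegers.ext this)
  -- embeddings as additive maps
  set sig : (κ → ℤ) →+ ∀ w : InfinitePlace K, 𝕜 w :=
    { toFun := fun n w => D.emb w (G n)
      map_zero' := by funext w; simp
      map_add' := by intro x y; funext w; simp } with hsig
  set xi : (κ → ℤ) →+ ∀ w : InfinitePlace K, 𝕜 w :=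
    { toFun := fun n w => (w.mult : ℝ) • D.emb w (H n)
      map_zero' := by funext w; simp
      map_add' := by intro x y; funext w; simp } with hxi
  -- linear map
  set e0 : (κ → ℝ) →ₗ[ℝ] ∀ w : InfinitePlace K, 𝕜 w :=
    { toFun := fun u w => ∑ i, u i • D.emb w (b i)
      map_add' := by intro x y; funext w; simp [add_smul, Finset.sum_add_distrib]
      map_smul' := by intro r x; funext w; simp [Finset.smul_sum, smul_smul] } with he0
  have e0_apply : ∀ u w, e0 u w = ∑ i, u i • D.emb w (b i) := fun _ _ => rfl
  have hpair : ∀ i u, ∑ w : InfinitePlace K, (w.mult : ℝ) * RCLike.re (D.emb w (β i) * e0 u w) = u i := by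
    intro i u
    have h1 : ∀ w : InfinitePlace K, (w.mult : ℝ) * RCLike.re (D.emb w (β i) * e0 u w) =
        ∑ j, u j * ((w.mult : ℝ) * RCLike.re (D.emb w (β i * b j))) := by
      intro w
      rw [e0_apply, Finset.mul_sum, map_sum, Finset.mul_sum]
      refine Finset.sum_congr rfl fun j _ => ?_
      rw [mul_smul_comm, RCLike.smul_re, map_mul (D.emb w)]; ring
    simp only [h1]
    rw [Finset.sum_comm]
    have h2 : ∀ j, ∑ w : InfinitePlace K, u j * ((w.mult : ℝ) * RCLike.re (D.emb w (β i * b j))) =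
        u j * (if j = i then 1 else 0) := by
      intro j
      rw [← Finset.mul_sum, ← trace_emb D, hdual]
      split_ifs <;> simp
    rw [Finset.sum_congr rfl fun j _ => h2 j]
    simp
  have hinj : Function.Injective e0 := by
    intro u u' h
    funext i
    rw [← hpair i u, ← hpair i u', h]
  have hdim : Module.finrank ℝ (κ → ℝ) = Module.finrank ℝ (∀ w : InfinitePlace K, 𝕜 w) := by
    rw [Module.finrank_pi, Module.finrank_pi_fintype, ← Module.finrank_eq_card_basis b]
    exact (dg_KF D).symm
  set e := (LinearMap.linearEquivOfInjective e0 hinj hdim).toContinuousLinearEquiv with he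
  have e_apply : ∀ u w, e u w = ∑ i, u i • D.emb w (b i) := fun _ _ => rfl
  have hes : ∀ n, sig n = e (zr n) := by
    intro n
    funext w
    rw [e_apply]
    change D.emb w (G n) = _
    rw [hG, map_sum]
    refine Finset.sum_congr rfl fun i _ => ?_
    rw [Int.cast_smul_eq_zsmul, map_zsmul, zr, Int.cast_smul_eq_zsmul]
  have hdu : ∀ (k : κ → ℤ) (u : κ → ℝ), ∑ w, RCLike.re (xi k w * e u w) = ∑ i, (k i : ℝ) * u i := by
    intro k u
    have h1 : ∀ w : InfinitePlace K, RCLike.re (xi k w * e u w) =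
        ∑ i, (k i : ℝ) * ((w.mult : ℝ) * RCLike.re (D.emb w (β i) * e0 u w)) := by
      intro w
      change RCLike.re (((w.mult : ℝ) • D.emb w (H k)) * e0 u w) = _
      rw [hH, map_sum, smul_mul_assoc, RCLike.smul_re, Finset.sum_mul, map_sum, Finset.mul_sum]
      refine Finset.sum_congr rfl fun i _ => ?_
      have : D.emb w ((k i : ℚ) • β i) = (k i : ℝ) • D.emb w (β i) := by
        rw [Int.cast_smul_eq_zsmul, map_zsmul, Int.cast_smul_eq_zsmul]
      rw [this, smul_mul_assoc, RCLike.smul_re]; ring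
    simp only [h1]
    rw [Finset.sum_comm]
    simp only [← Finset.mul_sum, hpair]
  -- lower bounds
  obtain ⟨m, hm0, hm⟩ := exists_integral_multiples ℤ ℚ (Finset.univ.image β)
  have hm1 : (1:ℝ) ≤ |(m:ℝ)| := by exact_mod_cast Int.one_le_abs hm0
  set d := Module.finrank ℚ K with hd
  set ν : ℝ := (|(m:ℝ)| ^ d)⁻¹ with hν
  have hν0 : 0 < ν := by positivity
  have hν1 : ν ≤ 1 := inv_le_one_of_one_le₀ (one_le_pow₀ hm1)
  have hs1 : ∀ n, n ≠ 0 → ν ≤ nm (sig n) := by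
    intro n hn
    refine hν1.trans ?_
    change 1 ≤ nm (fun w => D.emb w (G n))
    rw [nm_emb]
    refine norm_ge_one ?_ ?_
    · rw [← hg]; exact RingOfIntegers.isIntegral_coe _
    · intro h; exact hn (hGi (by rw [h, map_zero]))
  have hx1 : ∀ n, n ≠ 0 → ν ≤ nm (xi n) := by
    intro n hn
    have h1 : nm (fun w => D.emb w (H n)) ≤ nm (xi n) := by
      refine Finset.prod_le_prod (fun _ _ => by positivity) fun w _ => ?_
      refine pow_le_pow_left₀ (norm_nonneg _) ?_ _
      change _ ≤ ‖(w.mult : ℝ) • D.emb w (H n)‖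
      rw [norm_smul, Real.norm_of_nonneg (by positivity)]
      have : (1:ℝ) ≤ w.mult := by exact_mod_cast InfinitePlace.mult_pos
      have := norm_nonneg (D.emb w (H n))
      nlinarith
    refine le_trans ?_ h1
    rw [nm_emb]
    have hintg : IsIntegral ℤ (m • H n) := by
      rw [hH, Finset.smul_sum]
      refine IsIntegral.sum _ fun i _ => ?_
      rw [Int.cast_smul_eq_zsmul, smul_comm]
      exact IsIntegral.zsmul (hm _ (Finset.mem_image_of_mem _ (Finset.mem_univ i))) _
    have hHn : H n ≠ 0 := fun h => hn (hHi (by rw [h, map_zero]))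
    have h2 := norm_ge_one hintg (smul_ne_zero hm0 hHn)
    have h3 : m • H n = algebraMap ℚ K m * H n := by simp
    rw [h3, map_mul, Algebra.norm_algebraMap] at h2
    push_cast at h2
    rw [abs_mul, abs_pow] at h2
    rw [hν, inv_le_iff_one_le_mul₀ (by positivity), mul_comm]
    exact h2
  obtain ⟨c, c2, hc, hc2, L, hL⟩ := exists_lat μ sig xi e hes hν0 hs1 hx1 hdu
  refine ⟨κ, inferInstance, ν, c, c2, hν0, hc, hc2, L, Equiv.ofBijective g hgb, ?_, ?_⟩
  · have := hg 0
    rw [map_zero] at this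
    exact Subtype.ext (RingOfIntegers.ext (by simpa using this))
  · intro n w
    rw [hL]
    change D.emb w (G n) = D.emb w ((g n : 𝓞 K) : K)
    rw [hg]

end nf
end DZ
end

section
open MeasureTheory Filter Topology
open scoped ContDiff

namespace DZ
set_option linter.unusedSectionVars false

section lat
variable {ι : Type*} [Fintype ι] {𝕜 : ι → Type*} [∀ v, RCLike (𝕜 v)]
  [∀ v, MeasurableSpace (𝕜 v)] [∀ v, BorelSpace (𝕜 v)]
  {κ : Type*} [Fintype κ] (μ : ∀ v, Measure (𝕜 v)) [∀ v, (μ v).IsAddHaarMeasure] [Nonempty ι]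
  {ν c c2 : ℝ}

theorem Lat.small (hν : 0 < ν) (hc : 0 < c) (hc2 : 0 < c2) (a0 ε : ℝ) (hε : 0 < ε) :
    ∃ C, 0 ≤ C ∧ ∀ X, 0 < X → ∀ L : Lat κ μ ν c c2 X, ∀ σ t : ℝ, 1/2 ≤ σ → σ ≤ 1 → 1 ≤ |t| →
      Real.exp a0 ≤ X → X ≤ Real.exp 16 * |t|^((dg 𝕜 : ℝ) + ε) →
      X^(-σ) * ‖L.S μ σ t‖ ≤ C * |t|^((dg 𝕜 : ℝ) / 3 * (1 - σ) + ε) := by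
  obtain ⟨C1, hC1, hmid⟩ := Lat.mid (κ := κ) μ hν hc hc2
  set d : ℝ := (dg 𝕜 : ℝ) with hd
  have hd0 : 0 ≤ d := by positivity
  set C0 : ℝ := 3^Fintype.card ι * (256^(dg 𝕜) * (Real.exp (-a0) + 2^(dg 𝕜)/ν)) with hC0
  have hC00 : 0 ≤ C0 := by positivity
  refine ⟨C0 + √C1 * (1 + Real.exp 16), by positivity, fun X hX L σ t hσ1 hσ2 ht hXa hXt => ?_⟩
  have hσ : σ ∈ Set.Icc (0:ℝ) 2 := ⟨by linarith, by linarith⟩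
  have ht0 : 0 < |t| := by linarith
  set u := |t| with hu
  have hmono : ∀ a b : ℝ, a ≤ b → u^a ≤ u^b := fun a b h => Real.rpow_le_rpow_of_exponent_le ht h
  set E := u^(d/3*(1-σ)+ε) with hE
  have hE0 : 0 < E := Real.rpow_pos_of_pos ht0 _
  have p1 : 0 ≤ d * (σ - 1/2) := mul_nonneg hd0 (by linarith)
  have p2 : 0 ≤ ε * σ := mul_nonneg hε.le (by linarith)
  have h1 : X^(-σ) * X = X^(1-σ) := by
    rw [← Real.rpow_add_one hX.ne']; ring_nf
  rcases le_total X (u^(d/3)) with hc1 | hc1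
  · have h := L.triv μ hν hX hσ t
    have h2 : ‖L.S μ σ t‖ ≤ C0 * X := by
      refine h.trans ?_
      rw [hC0, mul_assoc, mul_assoc]
      gcongr
      have : 1 ≤ Real.exp (-a0) * X := by
        calc (1:ℝ) = Real.exp (-a0) * Real.exp a0 := by rw [← Real.exp_add]; simp
          _ ≤ _ := by gcongr
      have e : 2^(dg 𝕜) * X / ν = 2^(dg 𝕜) / ν * X := by ring
      rw [e]; linarith
    calc X^(-σ) * ‖L.S μ σ t‖ ≤ X^(-σ) * (C0 * X) := by gcongr
      _ = C0 * X^(1-σ) := by rw [← h1]; ring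
      _ ≤ C0 * E := by
        gcongr
        calc X^(1-σ) ≤ (u^(d/3))^(1-σ) := Real.rpow_le_rpow hX.le hc1 (by linarith)
          _ = u^(d/3*(1-σ)) := by rw [← Real.rpow_mul ht0.le]
          _ ≤ _ := hmono _ _ (by linarith)
      _ ≤ _ := by
        gcongr
        have : 0 ≤ √C1 * (1 + Real.exp 16) := by positivity
        linarith
  · set τ := u^((1:ℝ)/3) with hτ
    have hτ0 : 0 < τ := Real.rpow_pos_of_pos ht0 _
    have hτ1 : 1 ≤ τ := Real.one_le_rpow ht (by norm_num)
    have hτ3 : u = τ^3 := by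
      rw [hτ, ← Real.rpow_natCast, ← Real.rpow_mul ht0.le]; norm_num
    have hτd : τ^(dg 𝕜) = u^(d/3) := by
      rw [hτ, ← Real.rpow_natCast, ← Real.rpow_mul ht0.le]; congr 1; rw [hd]; ring
    have h := hmid X hX L σ hσ t τ hτ1 hτ3 (by rw [hτd]; exact hc1)
    set A := X^((1:ℝ)/2) * u^(d/6) with hA
    set B := X * u^(-(d/3)) with hB
    have hA0 : 0 < A := mul_pos (Real.rpow_pos_of_pos hX _) (Real.rpow_pos_of_pos ht0 _)
    have hB0 : 0 < B := mul_pos hX (Real.rpow_pos_of_pos ht0 _)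
    have hA2 : A^2 = X * τ^(dg 𝕜) := by
      rw [hA, mul_pow, hτd, ← Real.rpow_natCast, ← Real.rpow_natCast, ← Real.rpow_mul hX.le, ← Real.rpow_mul ht0.le]
      norm_num
      left; congr 1; ring
    have hB2 : B^2 = X^2 / τ^(2 * dg 𝕜) := by
      rw [hB, mul_pow, mul_comm 2, pow_mul, hτd, Real.rpow_neg ht0.le, inv_pow]; rfl
    rw [← hA2, ← hB2] at h
    have h2 : ‖L.S μ σ t‖ ≤ √C1 * (A + B) := by
      refine abs_le_of_sq_le_sq' ?_ (by positivity) |>.2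
      rw [mul_pow, Real.sq_sqrt hC1]
      refine h.trans ?_
      gcongr
      nlinarith
    have hA3 : X^(-σ) * A ≤ E := by
      calc X^(-σ) * A = X^(1/2-σ) * u^(d/6) := by
            rw [hA, ← mul_assoc, ← Real.rpow_add hX]; ring_nf
        _ ≤ (u^(d/3))^(1/2-σ) * u^(d/6) := by
            gcongr ?_ * _
            exact Real.rpow_le_rpow_of_nonpos (Real.rpow_pos_of_pos ht0 _) hc1 (by linarith)
        _ = u^(d/3*(1/2-σ) + d/6) := by rw [← Real.rpow_mul ht0.le, ← Real.rpow_add ht0]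
        _ ≤ E := hmono _ _ (by linarith)
    have hB3 : X^(-σ) * B ≤ Real.exp 16 * E := by
      calc X^(-σ) * B = X^(1-σ) * u^(-(d/3)) := by rw [hB, ← mul_assoc, h1]
        _ ≤ (Real.exp 16 * u^(d+ε))^(1-σ) * u^(-(d/3)) := by
            gcongr ?_ * _
            exact Real.rpow_le_rpow hX.le hXt (by linarith)
        _ = Real.exp 16 ^(1-σ) * u^((d+ε)*(1-σ) + -(d/3)) := by
            rw [Real.mul_rpow (Real.exp_pos _).le (Real.rpow_pos_of_pos ht0 _).le, ← Real.rpow_mul ht0.le, mul_assoc, ← Real.rpow_add ht0]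
        _ ≤ Real.exp 16 * E := by
            gcongr
            · calc Real.exp 16 ^(1-σ) ≤ Real.exp 16 ^ (1:ℝ) :=
                  Real.rpow_le_rpow_of_exponent_le (Real.one_le_exp (by norm_num)) (by linarith)
                _ = _ := Real.rpow_one _
            · refine hmono _ _ ?_
              linarith
    calc X^(-σ) * ‖L.S μ σ t‖ ≤ X^(-σ) * (√C1 * (A + B)) := by gcongr
      _ = √C1 * (X^(-σ) * A + X^(-σ) * B) := by ring
      _ ≤ √C1 * (E + Real.exp 16 * E) := by gcongr
      _ = √C1 * (1 + Real.exp 16) * E := by ring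
      _ ≤ _ := by gcongr; linarith

theorem Lat.large (hν : 0 < ν) (hc : 0 < c) (ε : ℝ) (hε : 0 < ε) :
    ∃ C, 0 ≤ C ∧ ∀ X, 0 < X → ∀ L : Lat κ μ ν c c2 X, ∀ σ t : ℝ, 1/2 ≤ σ → σ ≤ 1 → 1 ≤ |t| →
      |t|^((dg 𝕜 : ℝ) + ε) ≤ X →
      X^(-σ) * ‖L.S μ σ t - (c * X : ℝ) * Am μ σ t‖ ≤ C * X⁻¹ := by
  set d : ℝ := (dg 𝕜 : ℝ) with hd
  have hd0 : 0 ≤ d := by positivity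
  obtain ⟨M, hM⟩ := exists_nat_ge (2 * (d + ε) / ε)
  obtain ⟨C1, hC1, htail⟩ := Lat.tail (κ := κ) (c2 := c2) μ hν hc M
  refine ⟨C1 * (2^(dg 𝕜))^M * (1 + 2^(dg 𝕜)), by positivity, fun X hX L σ t hσ1 hσ2 ht hXt => ?_⟩
  have hσ : σ ∈ Set.Icc (0:ℝ) 2 := ⟨by linarith, by linarith⟩
  have h := htail X hX L σ hσ t
  have ht0 : 0 < |t| := by linarith
  set u := |t| with hu
  have hX1 : 1 ≤ X := (Real.one_le_rpow ht (by positivity)).trans hXt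
  have h1 : (1+u)^(dg 𝕜)/X ≤ 2^(dg 𝕜) * X^(-(ε/(d+ε))) := by
    have a1 : u^d ≤ X^(d/(d+ε)) := by
      calc u^d = (u^(d+ε))^(d/(d+ε)) := by
            rw [← Real.rpow_mul ht0.le]; congr 1; field_simp
        _ ≤ _ := Real.rpow_le_rpow (by positivity) hXt (by positivity)
    have a2 : (1+u)^(dg 𝕜) ≤ 2^(dg 𝕜) * u^d := by
      rw [hd, Real.rpow_natCast, ← mul_pow]
      gcongr; linarith
    have a3 : X^(-(ε/(d+ε))) = X^(d/(d+ε)) / X := by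
      rw [← Real.rpow_sub_one hX.ne']; congr 1; field_simp; ring
    rw [a3, ← mul_div_assoc]
    gcongr
    exact a2.trans (by gcongr)
  have h2 : (1+u)^(dg 𝕜)/X ≤ 2^(dg 𝕜) := by
    refine h1.trans ?_
    have : X^(-(ε/(d+ε))) ≤ 1 := Real.rpow_le_one_of_one_le_of_nonpos hX1 (by rw [neg_nonpos]; positivity)
    have : (0:ℝ) < 2^(dg 𝕜) := by positivity
    nlinarith
  have h3 : ((1+u)^(dg 𝕜)/X)^M ≤ (2^(dg 𝕜))^M * X^(-2:ℝ) := by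
    calc _ ≤ (2^(dg 𝕜) * X^(-(ε/(d+ε))))^M := by gcongr
      _ = (2^(dg 𝕜))^M * X^(-(ε/(d+ε)) * M) := by
        rw [mul_pow, Real.rpow_mul hX.le, Real.rpow_natCast]
      _ ≤ _ := by
        gcongr
        · rw [div_le_iff₀ hε] at hM
          rw [neg_mul, neg_le_neg_iff, div_mul_eq_mul_div, le_div_iff₀ (by positivity)]
          linarith
  have h4 : X^(-σ) ≤ 1 := Real.rpow_le_one_of_one_le_of_nonpos hX1 (by linarith)
  have h5 : X * X^(-2:ℝ) = X⁻¹ := by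
    rw [show (-2:ℝ) = ((-2:ℤ):ℝ) by norm_num, Real.rpow_intCast]; field_simp
  calc _ ≤ 1 * (C1 * X * ((1 + u)^(dg 𝕜)/X)^M * (1 + (1+u)^(dg 𝕜)/X)) := by gcongr
    _ ≤ 1 * (C1 * X * ((2^(dg 𝕜))^M * X^(-2:ℝ)) * (1 + 2^(dg 𝕜))) := by gcongr
    _ = C1 * (2^(dg 𝕜))^M * (1 + 2^(dg 𝕜)) * (X * X^(-2:ℝ)) := by ring
    _ = _ := by rw [h5]

theorem Lat.crude (hν : 0 < ν) (hc : 0 < c) (a0 T : ℝ) :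
    ∃ C, 0 ≤ C ∧ ∀ X, 0 < X → ∀ L : Lat κ μ ν c c2 X, ∀ σ t : ℝ, 0 ≤ σ → σ ≤ 2 → |t| ≤ T →
      Real.exp a0 ≤ X →
      X^(-σ) * ‖L.S μ σ t - (c * X : ℝ) * Am μ σ t‖ ≤ C * X⁻¹ := by
  obtain ⟨C1, hC1, htail⟩ := Lat.tail (κ := κ) (c2 := c2) μ hν hc 2
  set P : ℝ := (1 + |T|)^(dg 𝕜) with hP
  set W : ℝ := Real.exp (-a0) with hW
  refine ⟨(1 + W^(2:ℝ)) * C1 * P^2 * (1 + P * W), by positivity, fun X hX L σ t hσ1 hσ2 ht hXa => ?_⟩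
  have h := htail X hX L σ ⟨hσ1, hσ2⟩ t
  have hXi : X⁻¹ ≤ W := by
    rw [hW, Real.exp_neg]; gcongr
  have h1 : X^(-σ) ≤ 1 + W^(2:ℝ) := by
    rw [Real.rpow_neg hX.le, ← Real.inv_rpow hX.le]
    have hW0 : 0 < W := Real.exp_pos _
    rcases le_total X⁻¹ 1 with h1 | h1
    · have : X⁻¹^σ ≤ 1 := Real.rpow_le_one (by positivity) h1 hσ1
      have : 0 ≤ W^(2:ℝ) := by positivity
      linarith
    · have : X⁻¹^σ ≤ W^(2:ℝ) :=
        (Real.rpow_le_rpow_of_exponent_le h1 hσ2).trans (Real.rpow_le_rpow (by positivity) hXi (by norm_num))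
      linarith
  have h2 : (1+|t|)^(dg 𝕜) ≤ P := by
    rw [hP]; exact pow_le_pow_left₀ (by positivity) (by linarith [ht.trans (le_abs_self T)]) _
  have h3 : P / X ≤ P * W := by rw [div_eq_mul_inv]; gcongr
  calc _ ≤ (1 + W^(2:ℝ)) * (C1 * X * ((1 + |t|)^(dg 𝕜)/X)^2 * (1 + (1+|t|)^(dg 𝕜)/X)) := by gcongr
    _ ≤ (1 + W^(2:ℝ)) * (C1 * X * (P/X)^2 * (1 + P * W)) := by
      have : (1+|t|)^(dg 𝕜)/X ≤ P / X := by gcongr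
      gcongr
      exact this.trans h3
    _ = _ := by field_simp

end lat
end DZ
end

section
open MeasureTheory Filter Topology
open scoped ContDiff

namespace DZ
set_option linter.unusedSectionVars false

section lat
variable {ι : Type*} [Fintype ι] {𝕜 : ι → Type*} [∀ v, RCLike (𝕜 v)]
  [∀ v, MeasurableSpace (𝕜 v)] [∀ v, BorelSpace (𝕜 v)]
  {κ : Type*} [Fintype κ] (μ : ∀ v, Measure (𝕜 v)) [∀ v, (μ v).IsAddHaarMeasure] [Nonempty ι]
  {ν c c2 : ℝ}

variable (𝕜) in
/-- log of the covolume scale -/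
noncomputable def rho (x : ι → ℝ) : ℝ := -∑ v, nv 𝕜 v * x v

lemma rho_add (x y : ι → ℝ) : rho 𝕜 (x + y) = rho 𝕜 x + rho 𝕜 y := by
  simp only [rho, Pi.add_apply, mul_add, Finset.sum_add_distrib]; ring

lemma rho_smul (r : ℝ) (x : ι → ℝ) : rho 𝕜 (r • x) = r * rho 𝕜 x := by
  simp only [rho, Pi.smul_apply, smul_eq_mul, mul_neg, Finset.mul_sum]
  congr 1; exact Finset.sum_congr rfl fun v _ => by ring

lemma rho_continuous : Continuous (rho 𝕜) := by unfold rho; fun_prop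

lemma exp_rho (x : ι → ℝ) : Real.exp (rho 𝕜 x) = (bv 𝕜 (fun v => Real.exp (x v)))⁻¹ := by
  rw [rho, Real.exp_neg, Real.exp_sum, bv]
  congr 2
  funext v
  rw [nv, mul_comm, mul_comm, Real.exp_nat_mul]

/-- rescaled lattice -/
noncomputable def Lat.at (L : Lat κ μ ν c c2 1) (x : ι → ℝ) : Lat κ μ ν c c2 (Real.exp (rho 𝕜 x)) :=
  L.scale μ (fun v => Real.exp (x v)) (fun _ => Real.exp_pos _) (exp_rho x)

/-- radial cutoff -/
noncomputable def P0 (x : ι → ℝ) (z : ∀ v, 𝕜 v) : ℝ := ∏ v, phi 0 (Real.exp (x v) • z v)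

lemma phi0 {F : Type*} [RCLike F] (z : F) : phi 0 z = bmp (‖z‖^2) := by simp [phi]

lemma P0_nonneg (x : ι → ℝ) (z : ∀ v, 𝕜 v) : 0 ≤ P0 x z := Finset.prod_nonneg fun _ _ => phi_nonneg _ _

lemma P0_continuous (z : ∀ v, 𝕜 v) : Continuous fun x : ι → ℝ => P0 x z := by
  refine continuous_finsetProd _ fun v _ => (phi_continuous 0).comp ?_
  fun_prop

lemma P0_supp {x : ι → ℝ} {z : ∀ v, 𝕜 v} (h : P0 x z ≠ 0) (v : ι) :
    4/5 ≤ Real.exp (x v) * ‖z v‖ ∧ Real.exp (x v) * ‖z v‖ ≤ 6/5 := by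
  have := phi_supp (Finset.prod_ne_zero_iff.1 h v (Finset.mem_univ v))
  have h2 : ‖Real.exp (x v) • z v‖ = Real.exp (x v) * ‖z v‖ := by
    rw [norm_smul, Real.norm_of_nonneg (Real.exp_pos _).le]
  rw [← h2]; exact this

lemma P0_supp' {x : ι → ℝ} {z : ∀ v, 𝕜 v} (h : P0 x z ≠ 0) (v : ι) : 0 < ‖z v‖ := by
  have h1 := (P0_supp h v).1
  by_contra h2
  have : ‖z v‖ = 0 := le_antisymm (not_lt.1 h2) (norm_nonneg _)
  rw [this] at h1; norm_num at h1

lemma nm_pos_of {z : ∀ v, 𝕜 v} (h : ∀ v, 0 < ‖z v‖) : 0 < nm z := Finset.prod_pos fun v _ => pow_pos (h v) _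

lemma Fl_eq {F : Type*} [RCLike F] (n σ t x : ℝ) {z : F} (hz : 0 < ‖z‖) :
    Fl (n * σ) (n * t) (Real.exp x • z) = (phi 0 (Real.exp x • z) : ℂ) *
      (Complex.exp (-((σ:ℂ) + t * Complex.I) * (n * x : ℝ)) *
        Complex.exp (-((σ:ℂ) + t * Complex.I) * (n * Real.log ‖z‖ : ℝ))) := by
  have h2 : ‖Real.exp x • z‖ = Real.exp x * ‖z‖ := by
    rw [norm_smul, Real.norm_of_nonneg (Real.exp_pos _).le]
  rw [Fl, phi0, phi, h2, Real.log_pow, Real.log_mul (Real.exp_pos _).ne' hz.ne', Real.log_exp]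
  push_cast
  rw [mul_assoc, ← Complex.exp_add, ← Complex.exp_add]
  congr 2
  ring

lemma Ph_eq (σ t : ℝ) (x : ι → ℝ) (z : ∀ v, 𝕜 v) :
    Ph σ t (fun v => Real.exp (x v) • z v) =
      (P0 x z : ℂ) * (nm z : ℂ) ^ (-((σ:ℂ) + t * Complex.I)) * Complex.exp (((σ:ℂ) + t * Complex.I) * rho 𝕜 x) := by
  by_cases h : P0 x z = 0
  · rw [h]
    simp only [Complex.ofReal_zero, zero_mul]
    rw [P0, Finset.prod_eq_zero_iff] at h
    obtain ⟨v, _, hv⟩ := h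
    rw [Ph]
    refine Finset.prod_eq_zero (Finset.mem_univ v) ?_
    rw [← norm_eq_zero, Fl_norm, phi, ← phi0, hv, zero_mul]
  · have hz := fun v => P0_supp' h v
    rw [Ph]
    rw [Finset.prod_congr rfl fun v _ => Fl_eq (nv 𝕜 v) σ t (x v) (hz v), Finset.prod_mul_distrib,
      Finset.prod_mul_distrib, ← Complex.exp_sum, ← Complex.exp_sum, ← Finset.mul_sum, ← Finset.mul_sum,
      P0, Complex.ofReal_prod, mul_assoc]
    congr 1
    have hn := nm_pos_of hz
    rw [Complex.cpow_def_of_ne_zero (by exact_mod_cast hn.ne'), ← Complex.ofReal_log hn.le]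
    have e1 : Real.log (nm z) = ∑ v, nv 𝕜 v * Real.log ‖z v‖ := by
      rw [nm, Real.log_prod (fun v _ => (pow_pos (hz v) _).ne')]
      exact Finset.sum_congr rfl fun v _ => by rw [Real.log_pow, nv]
    rw [e1, rho, mul_comm]
    congr 2
    · push_cast; ring
    · push_cast; ring

/-- cone-like domain -/
structure Dom (𝕜 : ι → Type*) [∀ v, RCLike (𝕜 v)] (B : Set (ι → ℝ)) (η : ι → ℝ) : Prop where
  meas : MeasurableSet B
  rho_eta : rho 𝕜 η = 1
  shift : ∀ (r : ℝ) (x : ι → ℝ), x + r • η ∈ B ↔ x ∈ B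
  bdd : ∀ a b : ℝ, Bornology.IsBounded {x | x ∈ B ∧ a < rho 𝕜 x ∧ rho 𝕜 x ≤ b}

variable (𝕜) in
/-- slab -/
def sl (B : Set (ι → ℝ)) (a b : ℝ) : Set (ι → ℝ) := {x | x ∈ B ∧ a < rho 𝕜 x ∧ rho 𝕜 x ≤ b}

variable {B : Set (ι → ℝ)} {η : ι → ℝ} (HB : Dom 𝕜 B η)

include HB in
lemma sl_meas (a b : ℝ) : MeasurableSet (sl 𝕜 B a b) :=
  HB.meas.inter ((rho_continuous.measurable measurableSet_Ioi).inter (rho_continuous.measurable measurableSet_Iic))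

include HB in
lemma sl_vol (a b : ℝ) : volume (sl 𝕜 B a b) < ⊤ := (HB.bdd a b).measure_lt_top

include HB in
lemma sl_integrable (a b : ℝ) {E : Type*} [NormedAddCommGroup E] (f : (ι → ℝ) → E) (hf : Continuous f) :
    IntegrableOn f (sl 𝕜 B a b) := by
  obtain ⟨R, hR⟩ := (HB.bdd a b).subset_closedBall 0
  exact (hf.continuousOn.integrableOn_compact (isCompact_closedBall 0 R)).mono_set hR

include HB in
lemma sl_shift (a b r : ℝ) : (fun x : ι → ℝ => x + r • η) ⁻¹' (sl 𝕜 B (a + r) (b + r)) = sl 𝕜 B a b := by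
  ext x
  simp only [Set.mem_preimage, sl]
  change _ ∧ _ ∧ _ ↔ _ ∧ _ ∧ _
  rw [HB.shift, rho_add, rho_smul, HB.rho_eta]
  simp

include HB in
lemma sl_integral_shift (a b r : ℝ) (f : (ι → ℝ) → ℂ) :
    ∫ x in sl 𝕜 B (a + r) (b + r), f x = ∫ x in sl 𝕜 B a b, f (x + r • η) := by
  rw [← sl_shift HB a b r]
  exact ((measurePreserving_add_right volume (r • η)).setIntegral_preimage_emb
    (MeasurableEquiv.addRight (r • η)).measurableEmbedding f _).symm

include HB in
lemma sl_vol_le : ∃ V : ℝ, 0 ≤ V ∧ ∀ a b : ℝ, b ≤ a + 8 → volume.real (sl 𝕜 B a b) ≤ V := by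
  refine ⟨volume.real (sl 𝕜 B 0 8), measureReal_nonneg, fun a b hab => ?_⟩
  have h1 : volume (sl 𝕜 B (0 + a) (8 + a)) = volume (sl 𝕜 B 0 8) := by
    rw [← sl_shift HB 0 8 a]
    exact ((measurePreserving_add_right volume (a • η)).measure_preimage_emb
      (MeasurableEquiv.addRight (a • η)).measurableEmbedding _).symm
  rw [Measure.real, Measure.real, ← h1]
  refine ENNReal.toReal_mono (sl_vol HB _ _).ne (measure_mono ?_)
  rintro x ⟨h2, h3, h4⟩
  exact ⟨h2, by linarith, by linarith⟩

/-- local weight -/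
noncomputable def Lat.m (L : Lat κ μ ν c c2 1) (B : Set (ι → ℝ)) (a b : ℝ) (n : κ → ℤ) : ℝ :=
  ∫ x in sl 𝕜 B a b, P0 x (L.sig n)

/-- smoothed partial sums -/
noncomputable def Lat.I (L : Lat κ μ ν c c2 1) (B : Set (ι → ℝ)) (a b : ℝ) (s : ℂ) : ℂ :=
  ∑' n : κ → ℤ, (L.m μ B a b n : ℂ) * (nm (L.sig n) : ℂ) ^ (-s)

include HB in
lemma Lat.fin (hν : 0 < ν) (L : Lat κ μ ν c c2 1) (a b : ℝ) : ∃ F : Finset (κ → ℤ), ∀ n ∉ F, ∀ x ∈ sl 𝕜 B a b,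
    P0 x (L.sig n) = 0 := by
  obtain ⟨R, hR⟩ := (HB.bdd a b).exists_norm_le
  have hf := (box_card L.sig (ν / 1) (by positivity) L.hsig (fun _ => 6/5 * Real.exp R) (fun _ => by positivity)).1
  refine ⟨hf.toFinset, fun n hn x hx => ?_⟩
  by_contra h
  apply hn
  rw [Set.Finite.mem_toFinset]
  intro v
  have h1 := (P0_supp h v).2
  have h2 : -R ≤ x v := by
    have := (norm_le_pi_norm x v).trans (hR x hx)
    rw [Real.norm_eq_abs] at this
    exact (abs_le.1 this).1
  have h3 : Real.exp (-R) ≤ Real.exp (x v) := Real.exp_le_exp.2 h2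
  have h4 : Real.exp (-R) * ‖L.sig n v‖ ≤ 6/5 := (mul_le_mul_of_nonneg_right h3 (norm_nonneg _)).trans h1
  rw [Real.exp_neg, ← div_eq_inv_mul, div_le_iff₀ (Real.exp_pos _)] at h4
  exact h4

lemma Lat.at_Ph (L : Lat κ μ ν c c2 1) (x : ι → ℝ) (σ t : ℝ) (n : κ → ℤ) :
    Ph σ t ((L.at μ x).sig n) = (P0 x (L.sig n) : ℂ) * (nm (L.sig n) : ℂ) ^ (-((σ:ℂ) + t * Complex.I)) *
      Complex.exp (((σ:ℂ) + t * Complex.I) * rho 𝕜 x) := Ph_eq σ t x (L.sig n)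

lemma Lat.m_zero (L : Lat κ μ ν c c2 1) {a b : ℝ} {n : κ → ℤ} (HB : Dom 𝕜 B η)
    (h : ∀ x ∈ sl 𝕜 B a b, P0 x (L.sig n) = 0) : L.m μ B a b n = 0 := by
  rw [Lat.m, setIntegral_congr_fun (sl_meas HB a b) h]; simp

include HB in
/-- integral representation -/
lemma Lat.I_eq (hν : 0 < ν) (L : Lat κ μ ν c c2 1) (a b σ t : ℝ) :
    L.I μ B a b ((σ:ℂ) + t * Complex.I) =
      ∫ x in sl 𝕜 B a b, Complex.exp (-((σ:ℂ) + t * Complex.I) * rho 𝕜 x) * (L.at μ x).S μ σ t ∧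
    IntegrableOn (fun x => Complex.exp (-((σ:ℂ) + t * Complex.I) * rho 𝕜 x) * (L.at μ x).S μ σ t) (sl 𝕜 B a b) := by
  obtain ⟨F, hF⟩ := Lat.fin μ HB hν L a b
  set s := (σ:ℂ) + t * Complex.I with hs
  have h1 : ∀ x ∈ sl 𝕜 B a b, Complex.exp (-s * rho 𝕜 x) * (L.at μ x).S μ σ t =
      ∑ n ∈ F, (P0 x (L.sig n) : ℂ) * (nm (L.sig n) : ℂ) ^ (-s) := by
    intro x hx
    rw [Lat.S, tsum_eq_sum (s := F), Finset.mul_sum]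
    · refine Finset.sum_congr rfl fun n _ => ?_
      rw [Lat.at_Ph, ← hs, mul_comm, mul_assoc, ← Complex.exp_add]
      simp
    · intro n hn
      rw [Lat.at_Ph, hF n hn x hx]; simp
  have hintg : ∀ n ∈ F, Integrable (fun x => (P0 x (L.sig n) : ℂ) * (nm (L.sig n) : ℂ) ^ (-s)) (volume.restrict (sl 𝕜 B a b)) := by
    intro n _
    exact (sl_integrable HB a b _ (Complex.continuous_ofReal.comp (P0_continuous _))).mul_const _
  constructor
  · rw [setIntegral_congr_fun (sl_meas HB a b) h1, integral_finset_sum _ hintg, Lat.I, tsum_eq_sum (s := F)]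
    · refine Finset.sum_congr rfl fun n _ => ?_
      rw [integral_mul_const, integral_complex_ofReal]; rfl
    · intro n hn
      rw [Lat.m_zero μ L HB (hF n hn)]; simp
  · exact Integrable.congr (integrable_finset_sum _ hintg)
      ((ae_restrict_iff' (sl_meas HB a b)).2 (Eventually.of_forall fun x hx => (h1 x hx).symm))

include HB in
lemma Lat.I_diff (hν : 0 < ν) (L : Lat κ μ ν c c2 1) (a b : ℝ) : Differentiable ℂ (L.I μ B a b) := by
  obtain ⟨F, hF⟩ := Lat.fin μ HB hν L a b
  have h1 : L.I μ B a b = fun s => ∑ n ∈ F, (L.m μ B a b n : ℂ) * (nm (L.sig n) : ℂ) ^ (-s) := by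
    funext s
    rw [Lat.I, tsum_eq_sum (s := F)]
    intro n hn
    rw [Lat.m_zero μ L HB (hF n hn)]; simp
  rw [h1]
  refine Differentiable.fun_sum fun n _ => ?_
  by_cases h : L.m μ B a b n = 0
  · rw [h]; simp
  · have h2 : ∃ x ∈ sl 𝕜 B a b, P0 x (L.sig n) ≠ 0 := by
      by_contra h3
      push Not at h3
      exact h (Lat.m_zero μ L HB h3)
    obtain ⟨x, _, hx⟩ := h2
    have h3 : (nm (L.sig n) : ℂ) ≠ 0 := by exact_mod_cast (nm_pos_of fun v => P0_supp' hx v).ne'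
    intro s
    refine DifferentiableAt.const_mul ?_ _
    exact (differentiableAt_id.neg).const_cpow (Or.inl h3)

lemma Lat.rho_ge (hν : 0 < ν) (L : Lat κ μ ν c c2 1) (n : κ → ℤ) (x : ι → ℝ) (h : P0 x (L.sig n) ≠ 0) :
    Real.log ν - dg 𝕜 ≤ rho 𝕜 x := by
  have hz := fun v => P0_supp' h v
  have hn : n ≠ 0 := by
    rintro rfl
    obtain ⟨v⟩ : Nonempty ι := inferInstance
    have := hz v
    rw [map_zero] at this; simp at this
  have h2 := L.hsig n hn
  rw [div_one] at h2
  have h3 : nm (fun v => Real.exp (x v) • L.sig n v) ≤ Real.exp (dg 𝕜) := by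
    have : Real.exp (dg 𝕜) = ∏ v, (Real.exp 1)^(Module.finrank ℝ (𝕜 v)) := by
      rw [Finset.prod_pow_eq_pow_sum, ← Real.exp_nat_mul, mul_one]; rfl
    rw [this, nm]
    refine Finset.prod_le_prod (fun _ _ => by positivity) fun v _ => ?_
    refine pow_le_pow_left₀ (norm_nonneg _) ?_ _
    rw [norm_smul, Real.norm_of_nonneg (Real.exp_pos _).le]
    refine (P0_supp h v).2.trans ?_
    have := Real.add_one_le_exp 1
    linarith
  rw [nm_smul _ (fun _ => Real.exp_pos _)] at h3
  have h4 : bv 𝕜 (fun v => Real.exp (x v)) = Real.exp (-rho 𝕜 x) := by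
    rw [Real.exp_neg, exp_rho, inv_inv]
  rw [h4] at h3
  have h5 : Real.exp (-rho 𝕜 x) * ν ≤ Real.exp (dg 𝕜) := le_trans (by gcongr) h3
  have h6 := Real.log_le_log (by positivity) h5
  rw [Real.log_mul (Real.exp_pos _).ne' hν.ne', Real.log_exp, Real.log_exp] at h6
  linarith

include HB in
lemma Lat.I_zero (hν : 0 < ν) (L : Lat κ μ ν c c2 1) (a b : ℝ) (hb : b < Real.log ν - dg 𝕜) (s : ℂ) : L.I μ B a b s = 0 := by
  have h1 : ∀ n, L.m μ B a b n = 0 := by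
    intro n
    refine Lat.m_zero μ L HB fun x hx => ?_
    by_contra h
    have := L.rho_ge μ hν n x h
    linarith [hx.2.2]
  rw [Lat.I]; simp [h1]

include HB in
lemma Lat.I_hasSum (hν : 0 < ν) (L : Lat κ μ ν c c2 1) (a b : ℝ) (s : ℂ) :
    HasSum (fun n : κ → ℤ => (L.m μ B a b n : ℂ) * (nm (L.sig n) : ℂ) ^ (-s)) (L.I μ B a b s) := by
  obtain ⟨F, hF⟩ := Lat.fin μ HB hν L a b
  refine Summable.hasSum (summable_of_ne_finset_zero (s := F) fun n hn => ?_)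
  rw [Lat.m_zero μ L HB (hF n hn)]; simp

end lat
end DZ
end

section
open MeasureTheory Filter Topology
open scoped ContDiff

namespace DZ
set_option linter.unusedSectionVars false

section lat
variable {ι : Type*} [Fintype ι] {𝕜 : ι → Type*} [∀ v, RCLike (𝕜 v)]
  [∀ v, MeasurableSpace (𝕜 v)] [∀ v, BorelSpace (𝕜 v)]
  {κ : Type*} [Fintype κ] (μ : ∀ v, Measure (𝕜 v)) [∀ v, (μ v).IsAddHaarMeasure] [Nonempty ι]
  {ν c c2 : ℝ}
variable {B : Set (ι → ℝ)} {η : ι → ℝ} (HB : Dom 𝕜 B η)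

lemma norm_cexp_rho (σ t r : ℝ) : ‖Complex.exp (-((σ:ℂ) + t * Complex.I) * r)‖ = (Real.exp r)^(-σ) := by
  rw [Complex.norm_exp, ← Real.exp_mul]
  congr 1
  simp
  ring

/-- main term -/
noncomputable def mainT (c : ℝ) (B : Set (ι → ℝ)) (a b σ t : ℝ) : ℂ :=
  c * Am μ σ t * ∫ x in sl 𝕜 B a b, Complex.exp ((1 - ((σ:ℂ) + t * Complex.I)) * rho 𝕜 x)

include HB in
lemma mainT_shift (a b h σ t : ℝ) : mainT μ c B (a + h) (b + h) σ t =
    Complex.exp (h * (1 - ((σ:ℂ) + t * Complex.I))) * mainT μ c B a b σ t := by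
  rw [mainT, mainT, sl_integral_shift HB]
  have : ∀ x : ι → ℝ, Complex.exp ((1 - ((σ:ℂ) + t * Complex.I)) * rho 𝕜 (x + h • η)) =
      Complex.exp (h * (1 - ((σ:ℂ) + t * Complex.I))) * Complex.exp ((1 - ((σ:ℂ) + t * Complex.I)) * rho 𝕜 x) := by
    intro x
    rw [rho_add, rho_smul, HB.rho_eta, ← Complex.exp_add]
    congr 1; push_cast; ring
  simp only [this]
  rw [integral_const_mul]
  ring

include HB in
lemma Lat.I_small (hν : 0 < ν) (L : Lat κ μ ν c c2 1) (a b σ t M : ℝ)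
    (hM : ∀ x ∈ sl 𝕜 B a b, (Real.exp (rho 𝕜 x))^(-σ) * ‖(L.at μ x).S μ σ t‖ ≤ M) :
    ‖L.I μ B a b ((σ:ℂ) + t * Complex.I)‖ ≤ M * volume.real (sl 𝕜 B a b) := by
  rw [(L.I_eq μ HB hν a b σ t).1]
  refine norm_setIntegral_le_of_norm_le_const (sl_vol HB a b) fun x hx => ?_
  rw [norm_mul, norm_cexp_rho]
  exact hM x hx

include HB in
lemma Lat.I_large (hν : 0 < ν) (L : Lat κ μ ν c c2 1) (a b σ t M : ℝ)
    (hM : ∀ x ∈ sl 𝕜 B a b, (Real.exp (rho 𝕜 x))^(-σ) *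
      ‖(L.at μ x).S μ σ t - (c * Real.exp (rho 𝕜 x) : ℝ) * Am μ σ t‖ ≤ M) :
    ‖L.I μ B a b ((σ:ℂ) + t * Complex.I) - mainT μ c B a b σ t‖ ≤ M * volume.real (sl 𝕜 B a b) := by
  have h0 : Continuous fun x : ι → ℝ => Complex.exp ((1 - ((σ:ℂ) + t * Complex.I)) * rho 𝕜 x) := by
    have := rho_continuous (𝕜 := 𝕜)
    fun_prop
  rw [(L.I_eq μ HB hν a b σ t).1, mainT, ← integral_const_mul, ← integral_sub (L.I_eq μ HB hν a b σ t).2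
    ((sl_integrable HB a b _ h0).const_mul _)]
  refine norm_setIntegral_le_of_norm_le_const (sl_vol HB a b) fun x hx => ?_
  have : Complex.exp (-((σ:ℂ) + t * Complex.I) * rho 𝕜 x) * (L.at μ x).S μ σ t -
      c * Am μ σ t * Complex.exp ((1 - ((σ:ℂ) + t * Complex.I)) * rho 𝕜 x) =
      Complex.exp (-((σ:ℂ) + t * Complex.I) * rho 𝕜 x) *
       ((L.at μ x).S μ σ t - (c * Real.exp (rho 𝕜 x) : ℝ) * Am μ σ t) := by
    have e : Complex.exp ((1 - ((σ:ℂ) + t * Complex.I)) * rho 𝕜 x) =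
        Complex.exp (-((σ:ℂ) + t * Complex.I) * rho 𝕜 x) * Complex.exp (rho 𝕜 x) := by
      rw [← Complex.exp_add]; congr 1; ring
    rw [e]; push_cast; ring
  rw [this, norm_mul, norm_cexp_rho]
  exact hM x hx

/-- regularised difference -/
noncomputable def Lat.gg (L : Lat κ μ ν c c2 1) (B : Set (ι → ℝ)) (h a : ℝ) (s : ℂ) : ℂ :=
  L.I μ B (a + h) (a + h + h) s - Complex.exp (h * (1 - s)) * L.I μ B a (a + h) s

lemma norm_cexp_h {h σ : ℝ} (t : ℝ) (h0 : 0 ≤ h) (h8 : h ≤ 8) (hσ : 0 ≤ σ) :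
    ‖Complex.exp (h * (1 - ((σ:ℂ) + t * Complex.I)))‖ ≤ Real.exp 8 := by
  rw [Complex.norm_exp]
  refine Real.exp_le_exp.2 ?_
  simp
  nlinarith

include HB in
lemma Lat.gg_small (hν : 0 < ν) : ∃ V : ℝ, 0 ≤ V ∧ ∀ (L : Lat κ μ ν c c2 1) (h a σ t M : ℝ), 0 ≤ M →
    1 ≤ h → h ≤ 8 → 0 ≤ σ →
    (∀ x, a < rho 𝕜 x → rho 𝕜 x ≤ a + 16 → (Real.exp (rho 𝕜 x))^(-σ) * ‖(L.at μ x).S μ σ t‖ ≤ M) →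
    ‖L.gg μ B h a ((σ:ℂ) + t * Complex.I)‖ ≤ V * M := by
  obtain ⟨V, hV, hV2⟩ := sl_vol_le HB
  refine ⟨V * (1 + Real.exp 8), by positivity, fun L h a σ t M hM0 h1 h8 hσ hM => ?_⟩
  have e1 := L.I_small μ HB hν (a + h) (a + h + h) σ t M (fun x hx => hM x (by linarith [hx.2.1]) (by linarith [hx.2.2]))
  have e2 := L.I_small μ HB hν a (a + h) σ t M (fun x hx => hM x (by linarith [hx.2.1]) (by linarith [hx.2.2]))
  have e3 := mul_le_mul_of_nonneg_left (hV2 (a + h) (a + h + h) (by linarith)) hM0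
  have e4 := mul_le_mul_of_nonneg_left (hV2 a (a + h) (by linarith)) hM0
  have e5 := norm_cexp_h t (by linarith) h8 hσ
  rw [Lat.gg]
  refine (norm_sub_le _ _).trans ?_
  rw [norm_mul]
  have e6 := mul_le_mul e5 (e2.trans e4) (norm_nonneg _) (by positivity)
  linarith

include HB in
lemma Lat.gg_large (hν : 0 < ν) : ∃ V : ℝ, 0 ≤ V ∧ ∀ (L : Lat κ μ ν c c2 1) (h a σ t M : ℝ), 0 ≤ M →
    1 ≤ h → h ≤ 8 → 0 ≤ σ →
    (∀ x, a < rho 𝕜 x → rho 𝕜 x ≤ a + 16 → (Real.exp (rho 𝕜 x))^(-σ) *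
      ‖(L.at μ x).S μ σ t - (c * Real.exp (rho 𝕜 x) : ℝ) * Am μ σ t‖ ≤ M) →
    ‖L.gg μ B h a ((σ:ℂ) + t * Complex.I)‖ ≤ V * M := by
  obtain ⟨V, hV, hV2⟩ := sl_vol_le HB
  refine ⟨V * (1 + Real.exp 8), by positivity, fun L h a σ t M hM0 h1 h8 hσ hM => ?_⟩
  have e1 := L.I_large μ HB hν (a + h) (a + h + h) σ t M (fun x hx => hM x (by linarith [hx.2.1]) (by linarith [hx.2.2]))
  have e2 := L.I_large μ HB hν a (a + h) σ t M (fun x hx => hM x (by linarith [hx.2.1]) (by linarith [hx.2.2]))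
  have e3 := mul_le_mul_of_nonneg_left (hV2 (a + h) (a + h + h) (by linarith)) hM0
  have e4 := mul_le_mul_of_nonneg_left (hV2 a (a + h) (by linarith)) hM0
  have e5 := norm_cexp_h t (by linarith) h8 hσ
  have e7 := mainT_shift μ (c := c) HB a (a + h) h σ t
  have e8 : L.gg μ B h a ((σ:ℂ) + t * Complex.I) =
      (L.I μ B (a + h) (a + h + h) ((σ:ℂ) + t * Complex.I) - mainT μ c B (a + h) (a + h + h) σ t)
      - Complex.exp (h * (1 - ((σ:ℂ) + t * Complex.I))) *
        (L.I μ B a (a + h) ((σ:ℂ) + t * Complex.I) - mainT μ c B a (a + h) σ t) := by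
    rw [e7, Lat.gg]; ring
  rw [e8]
  refine (norm_sub_le _ _).trans ?_
  rw [norm_mul]
  have e6 := mul_le_mul e5 (e2.trans e4) (norm_nonneg _) (by positivity)
  linarith

include HB in
/-- locally uniform majorant -/
lemma Lat.gg_crude (hν : 0 < ν) (hc : 0 < c) (a0 T : ℝ) : ∃ C : ℝ, 0 ≤ C ∧ ∀ (L : Lat κ μ ν c c2 1) (h a σ t : ℝ),
    1 ≤ h → h ≤ 8 → 0 ≤ σ → σ ≤ 2 → |t| ≤ T → a0 ≤ a →
    ‖L.gg μ B h a ((σ:ℂ) + t * Complex.I)‖ ≤ C * Real.exp (-a) := by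
  obtain ⟨V, hV, hV2⟩ := Lat.gg_large (κ := κ) (c := c) (c2 := c2) μ HB hν
  obtain ⟨C, hC, hC2⟩ := Lat.crude (κ := κ) (c2 := c2) μ hν hc a0 T
  refine ⟨V * C, by positivity, fun L h a σ t h1 h8 hσ hσ2 ht ha => ?_⟩
  rw [mul_assoc]
  refine hV2 L h a σ t _ (by positivity) h1 h8 hσ fun x hx _ => ?_
  refine (hC2 _ (Real.exp_pos _) (L.at μ x) σ t hσ hσ2 ht (Real.exp_le_exp.2 (by linarith))).trans ?_
  rw [← Real.exp_neg]
  gcongr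

include HB in
/-- uniform subconvex majorant -/
lemma Lat.gg_sub (hν : 0 < ν) (hc : 0 < c) (hc2 : 0 < c2) (a0 ε : ℝ) (hε : 0 < ε) : ∃ C δ : ℝ, 0 ≤ C ∧ 0 < δ ∧
    ∀ (L : Lat κ μ ν c c2 1) (h a σ t : ℝ),
    1 ≤ h → h ≤ 8 → 1/2 ≤ σ → σ ≤ 1 → 1 ≤ |t| → a0 ≤ a →
    ‖L.gg μ B h a ((σ:ℂ) + t * Complex.I)‖ ≤ C * |t|^((dg 𝕜 : ℝ) / 3 * (1 - σ) + ε) * Real.exp (-δ * (a - a0)) := by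
  obtain ⟨V1, hV1, hV12⟩ := Lat.gg_large (κ := κ) (c := c) (c2 := c2) μ HB hν
  obtain ⟨V2, hV2, hV22⟩ := Lat.gg_small (κ := κ) (c := c) (c2 := c2) μ HB hν
  obtain ⟨C1, hC1, hC12⟩ := Lat.large (κ := κ) (c2 := c2) μ hν hc (ε/2) (half_pos hε)
  obtain ⟨C2, hC2, hC22⟩ := Lat.small (κ := κ) μ hν hc hc2 a0 (ε/2) (half_pos hε)
  set D : ℝ := (dg 𝕜 : ℝ) + ε/2 with hD
  have hD0 : 0 < D := by positivity
  set δ : ℝ := min 1 (ε / 2 / D) with hδ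
  have hδ0 : 0 < δ := lt_min one_pos (by positivity)
  have hδ1 : δ ≤ 1 := min_le_left _ _
  have hδD : δ * D ≤ ε / 2 := by
    have := min_le_right 1 (ε / 2 / D)
    rwa [← hδ, le_div_iff₀ hD0] at this
  set E : ℝ := (dg 𝕜 : ℝ) / 3 with hE
  have hE0 : 0 ≤ E := by positivity
  refine ⟨V1 * C1 * Real.exp (-a0) + V2 * C2 * Real.exp |δ * a0|, δ, by positivity, hδ0, fun L h a σ t h1 h8 hσ hσ1 ht ha => ?_⟩
  have ht0 : 0 < |t| := by linarith
  have hl : 0 ≤ Real.log |t| := Real.log_nonneg ht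
  by_cases hcase : D * Real.log |t| ≤ a
  · have b1 : ‖L.gg μ B h a ((σ:ℂ) + t * Complex.I)‖ ≤ V1 * (C1 * Real.exp (-a)) := by
      refine hV12 L h a σ t _ (by positivity) h1 h8 (by linarith) fun x hx _ => ?_
      refine (hC12 _ (Real.exp_pos _) (L.at μ x) σ t (by linarith) (by linarith) ht ?_).trans ?_
      · rw [Real.rpow_def_of_pos ht0]
        exact Real.exp_le_exp.2 (by linarith)
      · rw [← Real.exp_neg]; gcongr
    have b2 : Real.exp (-a) ≤ Real.exp (-a0) * Real.exp (-δ * (a - a0)) := by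
      rw [← Real.exp_add]
      refine Real.exp_le_exp.2 ?_
      nlinarith
    have b3 : 1 ≤ |t|^(E * (1 - σ) + ε) := Real.one_le_rpow ht (by
      have := mul_nonneg hE0 (sub_nonneg.2 hσ1); linarith)
    calc _ ≤ V1 * (C1 * Real.exp (-a)) := b1
      _ ≤ V1 * (C1 * (Real.exp (-a0) * Real.exp (-δ * (a - a0)))) := by gcongr
      _ = V1 * C1 * Real.exp (-a0) * 1 * Real.exp (-δ * (a - a0)) := by ring
      _ ≤ V1 * C1 * Real.exp (-a0) * |t|^(E * (1 - σ) + ε) * Real.exp (-δ * (a - a0)) := by gcongr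
      _ ≤ _ := by
        gcongr
        have : 0 ≤ V2 * C2 * Real.exp |δ * a0| := by positivity
        linarith
  · push Not at hcase
    have b1 : ‖L.gg μ B h a ((σ:ℂ) + t * Complex.I)‖ ≤ V2 * (C2 * |t|^(E * (1 - σ) + ε/2)) := by
      refine hV22 L h a σ t _ (by positivity) h1 h8 (by linarith) fun x hx hx2 => ?_
      refine (hC22 _ (Real.exp_pos _) (L.at μ x) σ t (by linarith) (by linarith) ht ?_ ?_)
      · exact Real.exp_le_exp.2 (by linarith)
      · rw [Real.rpow_def_of_pos ht0, ← Real.exp_add]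
        exact Real.exp_le_exp.2 (by linarith)
    have b2 : |t|^(E * (1 - σ) + ε/2) ≤ Real.exp |δ * a0| * (|t|^(E * (1 - σ) + ε) * Real.exp (-δ * (a - a0))) := by
      rw [Real.rpow_def_of_pos ht0, Real.rpow_def_of_pos ht0, ← Real.exp_add, ← Real.exp_add]
      refine Real.exp_le_exp.2 ?_
      have q1 : δ * a ≤ δ * (D * Real.log |t|) := by gcongr
      have q2 : δ * D * Real.log |t| ≤ ε/2 * Real.log |t| := by gcongr
      have q3 := neg_abs_le (δ * a0)
      nlinarith
    calc _ ≤ V2 * (C2 * |t|^(E * (1 - σ) + ε/2)) := b1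
      _ ≤ V2 * (C2 * (Real.exp |δ * a0| * (|t|^(E * (1 - σ) + ε) * Real.exp (-δ * (a - a0))))) := by gcongr
      _ = V2 * C2 * Real.exp |δ * a0| * |t|^(E * (1 - σ) + ε) * Real.exp (-δ * (a - a0)) := by ring
      _ ≤ _ := by
        gcongr
        have : 0 ≤ V1 * C1 * Real.exp (-a0) := by positivity
        linarith

variable (ν 𝕜) in
/-- starting point -/
noncomputable def aa : ℝ := Real.log ν - dg 𝕜 - 9

/-- regularised series -/
noncomputable def Lat.G (L : Lat κ μ ν c c2 1) (B : Set (ι → ℝ)) (h : ℝ) (s : ℂ) : ℂ :=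
  ∑' k : ℕ, L.gg μ B h (aa 𝕜 ν + k * h) s

lemma geo_summable {δ h : ℝ} (hδ : 0 < δ) (h1 : 1 ≤ h) : Summable fun k : ℕ => Real.exp (-δ * (k * h)) := by
  have : (fun k : ℕ => Real.exp (-δ * (k * h))) = fun k : ℕ => (Real.exp (-δ * h))^k := by
    funext k; rw [← Real.exp_nat_mul]; congr 1; ring
  rw [this]
  refine summable_geometric_of_lt_one (Real.exp_pos _).le ?_
  rw [Real.exp_lt_one_iff]
  nlinarith

include HB in
lemma Lat.G_diff (hν : 0 < ν) (hc : 0 < c) (L : Lat κ μ ν c c2 1) {h : ℝ} (h1 : 1 ≤ h) (h8 : h ≤ 8) :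
    DifferentiableOn ℂ (L.G μ B h) {s | 0 < s.re ∧ s.re < 2} := by
  intro s hs
  obtain ⟨C, hC, hC2⟩ := Lat.gg_crude (κ := κ) (c2 := c2) μ HB hν hc (aa 𝕜 ν) (|s.im| + 1)
  set U : Set ℂ := {s' | 0 < s'.re ∧ s'.re < 2 ∧ |s'.im| < |s.im| + 1} with hU
  have hUo : IsOpen U := by
    refine (isOpen_lt continuous_const Complex.continuous_re).inter
      ((isOpen_lt Complex.continuous_re continuous_const).inter
        (isOpen_lt Complex.continuous_im.abs continuous_const))
  have hsU : s ∈ U := ⟨hs.1, hs.2, by linarith⟩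
  have hd : DifferentiableOn ℂ (L.G μ B h) U := by
    refine Complex.differentiableOn_tsum_of_summable_norm (u := fun k : ℕ => C * Real.exp (-aa 𝕜 ν) * Real.exp (-1 * (k * h)))
      ((geo_summable one_pos h1).mul_left _) (fun k => ?_) hUo ?_
    · refine Differentiable.differentiableOn ?_
      unfold Lat.gg
      have i1 := L.I_diff μ HB hν (aa 𝕜 ν + k * h + h) (aa 𝕜 ν + k * h + h + h)
      have i2 := L.I_diff μ HB hν (aa 𝕜 ν + k * h) (aa 𝕜 ν + k * h + h)
      fun_prop
    · intro k w hw
      have := hC2 L h (aa 𝕜 ν + k * h) w.re w.im h1 h8 hw.1.le hw.2.1.le hw.2.2.le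
        (by have : 0 ≤ k * h := by positivity
            linarith)
      rw [Complex.re_add_im] at this
      refine this.trans (le_of_eq ?_)
      rw [mul_assoc, ← Real.exp_add]; congr 2; ring
  exact ((hd s hsU).differentiableAt (hUo.mem_nhds hsU)).differentiableWithinAt

include HB in
lemma Lat.G_eq (hν : 0 < ν) (L : Lat κ μ ν c c2 1) {h : ℝ} (h8 : h ≤ 8) (s V : ℂ)
    (hV : HasSum (fun k : ℕ => L.I μ B (aa 𝕜 ν + k * h) (aa 𝕜 ν + (k + 1 : ℕ) * h) s) V) :
    L.G μ B h s = (1 - Complex.exp (h * (1 - s))) * V := by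
  have h0 : L.I μ B (aa 𝕜 ν + (0:ℕ) * h) (aa 𝕜 ν + (0 + 1 : ℕ) * h) s = 0 := by
    refine L.I_zero μ HB hν _ _ ?_ s
    unfold aa; push_cast; linarith
  have hS := (hasSum_nat_add_iff' 1).2 hV
  rw [Finset.sum_range_one, h0, sub_zero] at hS
  have := hS.sub (hV.mul_left (Complex.exp (h * (1 - s))))
  rw [Lat.G, sub_mul, one_mul, ← this.tsum_eq]
  refine tsum_congr fun k => ?_
  rw [Lat.gg]
  have q1 : aa 𝕜 ν + ((k + 1 : ℕ) : ℝ) * h = aa 𝕜 ν + k * h + h := by push_cast; ring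
  have q2 : aa 𝕜 ν + ((k + 1 + 1 : ℕ) : ℝ) * h = aa 𝕜 ν + k * h + h + h := by push_cast; ring
  rw [q1, q2]

include HB in
lemma Lat.G_bd (hν : 0 < ν) (hc : 0 < c) (hc2 : 0 < c2) (L : Lat κ μ ν c c2 1) (ε : ℝ) (hε : 0 < ε) :
    ∃ C : ℝ, 0 ≤ C ∧ ∀ h σ t : ℝ, 1 ≤ h → h ≤ 8 → 1/2 ≤ σ → σ ≤ 1 → 1 ≤ |t| →
      ‖L.G μ B h ((σ:ℂ) + t * Complex.I)‖ ≤ C * |t|^((dg 𝕜 : ℝ) / 3 * (1 - σ) + ε) := by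
  obtain ⟨C, δ, hC, hδ, hC2⟩ := Lat.gg_sub (κ := κ) μ HB hν hc hc2 (aa 𝕜 ν) ε hε
  have hs := geo_summable hδ le_rfl
  refine ⟨C * ∑' k : ℕ, Real.exp (-δ * (k * 1)), mul_nonneg hC (tsum_nonneg fun _ => (Real.exp_pos _).le),
    fun h σ t h1 h8 hσ hσ1 ht => ?_⟩
  rw [Lat.G]
  have hs2 := (hs.mul_left (C * |t|^((dg 𝕜 : ℝ) / 3 * (1 - σ) + ε))).hasSum
  have := tsum_of_norm_bounded (f := fun k : ℕ => L.gg μ B h (aa 𝕜 ν + k * h) ((σ:ℂ) + t * Complex.I)) hs2 (fun k => ?_)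
  · refine this.trans (le_of_eq ?_)
    rw [tsum_mul_left]; ring
  · refine (hC2 L h _ σ t h1 h8 hσ hσ1 ht (by
      have : 0 ≤ k * h := by positivity
      linarith)).trans ?_
    have : (k:ℝ) * 1 ≤ k * h := by gcongr
    have h3 : -δ * (aa 𝕜 ν + k * h - aa 𝕜 ν) ≤ -δ * (k * 1) := by nlinarith
    gcongr

end lat
end DZ
end

section
open MeasureTheory Filter Topology
open scoped ContDiff

namespace DZ
set_option linter.unusedSectionVars false

section nf
open NumberField NumberField.Units NumberField.Units.dirichletUnitTheorem Module
open scoped Classical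

variable {K : Type} [Field K] [NumberField K] {𝕜 : InfinitePlace K → Type} [∀ w, RCLike (𝕜 w)] (D : EmbD 𝕜)

/-- product bump in logarithmic coordinates -/
noncomputable def Qb (x : InfinitePlace K → ℝ) : ℝ := ∏ w, bmp (Real.exp (x w) ^ 2)

/-- log vector -/
noncomputable def ll (α : K) : InfinitePlace K → ℝ := fun w => Real.log (w α)

lemma ll_mul {α β : K} (hα : α ≠ 0) (hβ : β ≠ 0) : ll (α * β) = ll α + ll β := by
  funext w
  simp only [ll, map_mul, Pi.add_apply]
  exact Real.log_mul ((map_ne_zero w).2 hα) ((map_ne_zero w).2 hβ)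

lemma P0_emb (x : InfinitePlace K → ℝ) {α : K} (hα : α ≠ 0) :
    P0 x (fun w => D.emb w α) = Qb (x + ll α) := by
  rw [P0, Qb]
  refine Finset.prod_congr rfl fun w _ => ?_
  have hw : 0 < w α := InfinitePlace.pos_iff.2 hα
  rw [phi0, norm_smul, D.norm_emb, Real.norm_of_nonneg (Real.exp_pos _).le, Pi.add_apply, Real.exp_add, ll,
    Real.exp_log hw]

lemma Qb_continuous : Continuous (Qb (K := K)) := by
  unfold Qb
  refine continuous_finsetProd _ fun w _ => ?_
  exact bmp.continuous.comp (by fun_prop)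

lemma Qb_nonneg (x : InfinitePlace K → ℝ) : 0 ≤ Qb x := Finset.prod_nonneg fun _ _ => bmp.nonneg

lemma Qb_zero : Qb (0 : InfinitePlace K → ℝ) = 1 := by
  have : bmp 1 = 1 := bmp.one_of_mem_closedBall (by simp [bmp])
  simp [Qb, this]

lemma Qb_supp {x : InfinitePlace K → ℝ} (h : Qb x ≠ 0) : ‖x‖ ≤ 1 := by
  rw [pi_norm_le_iff_of_nonneg zero_le_one]
  intro w
  have h1 := bmp_supp (Finset.prod_ne_zero_iff.1 h w (Finset.mem_univ w))
  rw [Real.norm_eq_abs, abs_le]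
  constructor
  · by_contra h2
    push Not at h2
    have h3 : Real.exp (x w) < Real.exp (-1) := Real.exp_lt_exp.2 h2
    have h4 : Real.exp (-1) < 1/2 := by
      have := Real.exp_neg_one_lt_d9; linarith
    have h5 := Real.exp_pos (x w)
    nlinarith [h1.1]
  · by_contra h2
    push Not at h2
    have h3 : 1 + 1 < Real.exp (x w) := lt_of_le_of_lt (Real.add_one_le_exp 1) (Real.exp_lt_exp.2 h2)
    nlinarith [h1.2]

/-- total mass -/
noncomputable def Q0 (K : Type) [Field K] [NumberField K] : ENNReal :=
  ∫⁻ x : InfinitePlace K → ℝ, ENNReal.ofReal (Qb x)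

lemma Q0_lt_top : Q0 K < ⊤ := by
  have hc : HasCompactSupport (Qb (K := K)) := by
    refine HasCompactSupport.intro (isCompact_closedBall 0 1) fun x hx => ?_
    by_contra h
    exact hx (by simpa using Qb_supp h)
  have := (Qb_continuous.integrable_of_hasCompactSupport hc (μ := (volume : Measure (InfinitePlace K → ℝ))))
  exact this.lintegral_lt_top

lemma Q0_pos : 0 < Q0 K := by
  rw [Q0, lintegral_pos_iff_support (Qb_continuous.measurable.ennreal_ofReal)]
  refine IsOpen.measure_pos volume ?_ ⟨0, ?_⟩
  · have : Continuous fun x : InfinitePlace K → ℝ => ENNReal.ofReal (Qb x) := ENNReal.continuous_ofReal.comp Qb_continuous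
    exact this.isOpen_support
  · simp [Qb_zero]

variable (K) in
/-- basis of log space -/
noncomputable def bZ : Basis (Fin (rank K)) ℝ (logSpace K) := (basisUnitLattice K).ofZLatticeBasis ℝ

/-- projection to log space -/
noncomputable def pj (x : InfinitePlace K → ℝ) : logSpace K := fun w => (w.1.mult : ℝ) * x w.1

lemma pj_add (x y : InfinitePlace K → ℝ) : pj (x + y) = pj x + pj y := by
  funext w; simp [pj, mul_add]

lemma pj_sub (x y : InfinitePlace K → ℝ) : pj (x - y) = pj x - pj y := by
  funext w; simp [pj, mul_sub]

lemma pj_continuous : Continuous (pj (K := K)) := by unfold pj; fun_prop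

lemma pj_ll (u : (𝓞 K)ˣ) : pj (ll ((u : 𝓞 K) : K)) = logEmbedding K (Additive.ofMul u) := by
  funext w; rw [logEmbedding_component]; rfl

variable (K) in
/-- fundamental cone in log coordinates -/
def BB : Set (InfinitePlace K → ℝ) := {x | pj x ∈ ZSpan.fundamentalDomain (bZ K)}

/-- direction -/
noncomputable def et : InfinitePlace K → ℝ := Pi.single w₀ (-(1 / (w₀ (K := K)).mult : ℝ))

lemma nv_eq (w : InfinitePlace K) (D : EmbD 𝕜) : nv 𝕜 w = w.mult := by rw [nv, D.fr]

include D in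
lemma rho_split (x : InfinitePlace K → ℝ) :
    rho 𝕜 x = -((w₀ (K := K)).mult * x w₀ + ∑ w, pj x w) := by
  rw [rho, Fintype.sum_eq_add_sum_subtype_ne _ (w₀ (K := K))]
  simp only [nv_eq _ D, pj]

lemma mem_BB {x : InfinitePlace K → ℝ} : x ∈ BB K ↔ pj x ∈ ZSpan.fundamentalDomain (bZ K) := Iff.rfl

lemma BB_meas : MeasurableSet (BB K) :=
  pj_continuous.measurable (ZSpan.fundamentalDomain_measurableSet (bZ K))

lemma pj_et (r : ℝ) : pj (r • et (K := K)) = 0 := by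
  funext w
  simp [pj, et, w.2]

include D in
theorem dom_BB : Dom 𝕜 (BB K) (et (K := K)) where
  meas := BB_meas
  rho_eta := by
    rw [rho_split D]
    have := pj_et (K := K) 1
    rw [one_smul] at this
    rw [this]
    have h2 : ((w₀ (K := K)).mult : ℝ) ≠ 0 := InfinitePlace.mult_coe_ne_zero
    simp [et, h2]
  shift := fun r x => by
    rw [mem_BB, mem_BB, pj_add, pj_et, add_zero]
  bdd := fun a b => by
    obtain ⟨R, hR⟩ := (ZSpan.fundamentalDomain_isBounded (bZ K)).exists_norm_le
    have hone : ∀ w : InfinitePlace K, (1:ℝ) ≤ w.mult := fun w => by exact_mod_cast InfinitePlace.one_le_mult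
    refine isBounded_iff_forall_norm_le.2 ⟨|R| + (|a| + |b| + Fintype.card {w : InfinitePlace K // w ≠ w₀} * |R|), ?_⟩
    rintro x ⟨hx, hxa, hxb⟩
    have hp : ∀ w, |pj x w| ≤ |R| := fun w => by
      have := (norm_le_pi_norm (pj x) w).trans (hR _ hx)
      exact this.trans (le_abs_self R)
    rw [pi_norm_le_iff_of_nonneg (by positivity)]
    intro w
    rw [Real.norm_eq_abs]
    have h0 : |x w| ≤ |w.mult * x w| := by
      rw [abs_mul]
      have := hone w
      rw [abs_of_nonneg (show (0:ℝ) ≤ w.mult by linarith)]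
      have := abs_nonneg (x w)
      nlinarith
    by_cases hw : w = w₀
    · have h1 := rho_split D x
      have h2 : |∑ w, pj x w| ≤ Fintype.card {w : InfinitePlace K // w ≠ w₀} * |R| := by
        refine (Finset.abs_sum_le_sum_abs _ _).trans ?_
        refine (Finset.sum_le_sum fun w _ => hp w).trans ?_
        simp
      have h3 : |rho 𝕜 x| ≤ |a| + |b| := by
        rw [abs_le]
        constructor
        · linarith [neg_abs_le a, abs_nonneg b]
        · linarith [le_abs_self b, abs_nonneg a]
      have h4 : (w.mult : ℝ) * x w = -rho 𝕜 x - ∑ w, pj x w := by rw [hw]; linarith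
      have h5 : |(w.mult : ℝ) * x w| ≤ |rho 𝕜 x| + |∑ w, pj x w| := by
        rw [h4]
        refine (abs_sub _ _).trans ?_
        rw [abs_neg]
      linarith [abs_nonneg R]
    · have h1 := hp ⟨w, hw⟩
      have h2 : pj x ⟨w, hw⟩ = w.mult * x w := rfl
      rw [h2] at h1
      have : 0 ≤ |a| + |b| + Fintype.card {w : InfinitePlace K // w ≠ w₀} * |R| := by positivity
      linarith

instance cntU : Countable (𝓞 K)ˣ := by
  have : Countable (𝓞 K) := (RingOfIntegers.basis K).equivFun.toEquiv.countable_iff.2 inferInstance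
  exact Function.Injective.countable (f := fun u : (𝓞 K)ˣ => (u : 𝓞 K)) Units.val_injective

lemma unit_count (y : InfinitePlace K → ℝ) :
    ∑' u : (𝓞 K)ˣ, (BB K).indicator (fun _ => (1 : ENNReal)) (y - ll ((u : 𝓞 K) : K)) = torsionOrder K := by
  obtain ⟨v, hv, hv2⟩ := ZSpan.exist_unique_vadd_mem_fundamentalDomain (bZ K) (pj y)
  have hspan : Submodule.span ℤ (Set.range (bZ K)) = unitLattice K := (basisUnitLattice K).ofZLatticeBasis_span ℝ
  have hvm : (v : logSpace K) ∈ unitLattice K := hspan ▸ v.2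
  obtain ⟨u0', hu0⟩ : ∃ u0 : Additive (𝓞 K)ˣ, logEmbedding K u0 = v := by
    obtain ⟨a, _, ha⟩ := hvm
    exact ⟨a, ha⟩
  set u0 := u0'.toMul with hu0'
  have key : ∀ u : (𝓞 K)ˣ, y - ll ((u : 𝓞 K) : K) ∈ BB K ↔ u * u0 ∈ torsion K := by
    intro u
    rw [← logEmbedding_eq_zero_iff, ofMul_mul, map_add]
    rw [mem_BB, pj_sub, pj_ll]
    have e0 : logEmbedding K (Additive.ofMul u0) = v := hu0
    rw [e0]
    constructor
    · intro h
      have hm : -logEmbedding K (Additive.ofMul u) ∈ Submodule.span ℤ (Set.range (bZ K)) := by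
        rw [hspan]
        refine neg_mem ?_
        exact AddSubgroup.mem_map_of_mem _ (AddSubgroup.mem_top _)
      have := hv2 ⟨_, hm⟩ (by
        change -logEmbedding K (Additive.ofMul u) + pj y ∈ _
        rwa [neg_add_eq_sub])
      rw [← this]; simp
    · intro h
      have : logEmbedding K (Additive.ofMul u) = -v := eq_neg_of_add_eq_zero_left h
      rw [this, sub_neg_eq_add, add_comm]
      exact hv
  have h2 : ∀ u : (𝓞 K)ˣ, (BB K).indicator (fun _ => (1 : ENNReal)) (y - ll ((u : 𝓞 K) : K)) =
      (torsion K : Set (𝓞 K)ˣ).indicator (fun _ => (1 : ENNReal)) (u * u0) := by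
    intro u
    simp only [Set.indicator, key u, SetLike.mem_coe]
  have h3 := (Equiv.mulRight u0).tsum_eq (fun u => (torsion K : Set (𝓞 K)ˣ).indicator (fun _ => (1 : ENNReal)) u)
  simp only [Equiv.coe_mulRight] at h3
  rw [tsum_congr h2, h3, ← tsum_subtype]
  have hf : Fintype (torsion K) := Fintype.ofFinite _
  change ∑' _ : torsion K, (1 : ENNReal) = _
  rw [tsum_fintype]
  simp [torsionOrder, Nat.card_eq_fintype_card]

/-- sum over units of the cone integrals -/
theorem unit_sum {α : K} (hα : α ≠ 0) :
    ∑' u : (𝓞 K)ˣ, ∫⁻ x in BB K, ENNReal.ofReal (Qb (x + ll (((u : 𝓞 K) : K) * α))) = torsionOrder K * Q0 K := by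
  have hQm : Measurable fun x : InfinitePlace K → ℝ => ENNReal.ofReal (Qb x) := Qb_continuous.measurable.ennreal_ofReal
  have h1 : ∀ u : (𝓞 K)ˣ, ∫⁻ x in BB K, ENNReal.ofReal (Qb (x + ll (((u : 𝓞 K) : K) * α))) =
      ∫⁻ y, (BB K).indicator (fun _ => (1 : ENNReal)) (y - ll ((u : 𝓞 K) : K)) * ENNReal.ofReal (Qb (y + ll α)) := by
    intro u
    have hu : ((u : 𝓞 K) : K) ≠ 0 := by simp
    rw [← lintegral_indicator BB_meas, ← lintegral_add_right_eq_self (fun y => (BB K).indicator (fun _ => (1 : ENNReal)) (y - ll ((u : 𝓞 K) : K)) * ENNReal.ofReal (Qb (y + ll α))) (ll ((u : 𝓞 K) : K))]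
    refine lintegral_congr fun x => ?_
    rw [ll_mul hu hα, add_sub_cancel_right]
    by_cases hx : x ∈ BB K <;> simp [hx, add_assoc]
  rw [tsum_congr h1, ← lintegral_tsum]
  · have h2 : ∀ y : InfinitePlace K → ℝ, ∑' u : (𝓞 K)ˣ,
        (BB K).indicator (fun _ => (1 : ENNReal)) (y - ll ((u : 𝓞 K) : K)) * ENNReal.ofReal (Qb (y + ll α)) =
        torsionOrder K * ENNReal.ofReal (Qb (y + ll α)) := by
      intro y
      rw [ENNReal.tsum_mul_right, unit_count]
    rw [lintegral_congr h2, lintegral_const_mul _ (show Measurable fun y : InfinitePlace K → ℝ => ENNReal.ofReal (Qb (y + ll α)) from hQm.comp (measurable_id.add_const _)), Q0]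
    congr 1
    exact lintegral_add_right_eq_self (fun x => ENNReal.ofReal (Qb x)) (ll α)
  · intro u
    refine Measurable.aemeasurable ?_
    refine Measurable.mul ?_ (hQm.comp (measurable_id.add_const _))
    exact (measurable_const.indicator BB_meas).comp (measurable_id.sub_const _)

end nf
end DZ
end

section
open MeasureTheory Filter Topology
open scoped ContDiff

namespace DZ
set_option linter.unusedSectionVars false

lemma abs_sum {T U : Type*} (q : T → ℕ → U → ℝ) (a : T → ℂ) (w : ℝ) (X : ℕ → ℂ)
    (hq0 : ∀ I k u, 0 ≤ q I k u) (hqs : ∀ I, HasSum (fun p : ℕ × U => q I p.1 p.2) w)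
    (hs : Summable fun I => ‖a I‖)
    (hk : ∀ k, HasSum (fun p : T × U => (q p.1 k p.2 : ℂ) * a p.1) (X k)) :
    HasSum X (w * ∑' I, a I) := by
  set F : T × (ℕ × U) → ℂ := fun p => (q p.1 p.2.1 p.2.2 : ℂ) * a p.1 with hF
  have hn : ∀ p, ‖F p‖ = q p.1 p.2.1 p.2.2 * ‖a p.1‖ := fun p => by
    rw [hF, norm_mul, Complex.norm_real, Real.norm_of_nonneg (hq0 _ _ _)]
  have hsum : Summable F := by
    refine Summable.of_norm ?_
    simp only [hn]
    refine (summable_prod_of_nonneg (f := fun p : T × (ℕ × U) => q p.1 p.2.1 p.2.2 * ‖a p.1‖)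
      (fun p => mul_nonneg (hq0 _ _ _) (norm_nonneg _))).2 ⟨fun I => (hqs I).summable.mul_right ‖a I‖, ?_⟩
    have : ∀ I, ∑' y : ℕ × U, q I y.1 y.2 * ‖a I‖ = w * ‖a I‖ := fun I => ((hqs I).mul_right ‖a I‖).tsum_eq
    simp only [this]
    exact hs.mul_left w
  have hX := hsum.hasSum
  have hf1 : ∀ I, HasSum (fun p : ℕ × U => F (I, p)) (w * a I) := fun I => by
    have : HasSum (fun p : ℕ × U => (q I p.1 p.2 : ℂ)) (w : ℂ) := by exact_mod_cast hqs I
    exact this.mul_right (a I)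
  have hX1 := (hX.prod_fiberwise hf1).tsum_eq
  rw [tsum_mul_left] at hX1
  rw [hX1]
  let e : ℕ × (T × U) ≃ T × (ℕ × U) :=
    ⟨fun p => (p.2.1, (p.1, p.2.2)), fun p => (p.2.1, (p.1, p.2.2)), fun _ => rfl, fun _ => rfl⟩
  have hX2 : HasSum (F ∘ e) (∑' p, F p) := e.hasSum_iff.2 hX
  exact hX2.prod_fiberwise fun k => hk k

section lat
variable {ι : Type*} [Fintype ι] {𝕜 : ι → Type*} [∀ v, RCLike (𝕜 v)]
  [∀ v, MeasurableSpace (𝕜 v)] [∀ v, BorelSpace (𝕜 v)]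
  {κ : Type*} [Fintype κ] (μ : ∀ v, Measure (𝕜 v)) [∀ v, (μ v).IsAddHaarMeasure] [Nonempty ι]
  {ν c c2 : ℝ}
variable {B : Set (ι → ℝ)} {η : ι → ℝ} (HB : Dom 𝕜 B η)

include HB in
lemma Lat.m_eq (L : Lat κ μ ν c c2 1) (a b : ℝ) (n : κ → ℤ) :
    L.m μ B a b n = (∫⁻ x in sl 𝕜 B a b, ENNReal.ofReal (P0 x (L.sig n))).toReal := by
  rw [Lat.m, integral_eq_lintegral_of_nonneg_ae (Eventually.of_forall fun x => P0_nonneg x _)]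
  exact (P0_continuous _).aestronglyMeasurable

include HB in
lemma Lat.m_tsum (hν : 0 < ν) (L : Lat κ μ ν c c2 1) {h : ℝ} (h1 : 1 ≤ h) (n : κ → ℤ) :
    ∑' k : ℕ, ∫⁻ x in sl 𝕜 B (aa 𝕜 ν + k * h) (aa 𝕜 ν + (k + 1 : ℕ) * h), ENNReal.ofReal (P0 x (L.sig n)) =
      ∫⁻ x in B, ENNReal.ofReal (P0 x (L.sig n)) := by
  have hdis : Pairwise (Function.onFun Disjoint fun k : ℕ => sl 𝕜 B (aa 𝕜 ν + k * h) (aa 𝕜 ν + (k + 1 : ℕ) * h)) := by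
    have aux : ∀ k l : ℕ, k < l → Disjoint (sl 𝕜 B (aa 𝕜 ν + k * h) (aa 𝕜 ν + (k + 1 : ℕ) * h))
        (sl 𝕜 B (aa 𝕜 ν + l * h) (aa 𝕜 ν + (l + 1 : ℕ) * h)) := by
      intro k l hkl
      rw [Set.disjoint_left]
      rintro x ⟨_, _, h2⟩ ⟨_, h3, _⟩
      have : ((k + 1 : ℕ) : ℝ) ≤ l := by exact_mod_cast hkl
      nlinarith
    intro k l hkl
    rcases lt_or_gt_of_ne hkl with h | h
    · exact aux k l h
    · exact (aux l k h).symm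
  rw [← lintegral_iUnion (fun k => sl_meas HB _ _) hdis, ← lintegral_indicator HB.meas,
    ← lintegral_indicator (MeasurableSet.iUnion fun k => sl_meas HB _ _)]
  refine lintegral_congr fun x => ?_
  by_cases hx : x ∈ B
  · rw [Set.indicator_of_mem hx]
    by_cases hr : aa 𝕜 ν < rho 𝕜 x
    · rw [Set.indicator_of_mem]
      rw [Set.mem_iUnion]
      set y := (rho 𝕜 x - aa 𝕜 ν) / h with hy
      have hy0 : 0 < y := div_pos (by linarith) (by linarith)
      have hyh : y * h = rho 𝕜 x - aa 𝕜 ν := by rw [hy]; field_simp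
      have c1 : 0 < ⌈y⌉₊ := Nat.ceil_pos.2 hy0
      have c2' := Nat.ceil_lt_add_one hy0.le
      have c3 := Nat.le_ceil y
      obtain ⟨k, hk⟩ := Nat.exists_eq_succ_of_ne_zero c1.ne'
      rw [hk] at c2' c3
      push_cast at c2' c3
      refine ⟨k, hx, ?_, ?_⟩
      · nlinarith
      · push_cast; nlinarith
    · have h0 : P0 x (L.sig n) = 0 := by
        by_contra hne
        have := L.rho_ge μ hν n x hne
        unfold aa at hr
        linarith
      classical
      rw [Set.indicator_apply]
      simp [h0]
  · rw [Set.indicator_of_notMem hx, Set.indicator_of_notMem]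
    rw [Set.mem_iUnion]
    rintro ⟨k, hk⟩
    exact hx hk.1

end lat

section nf
open NumberField NumberField.Units

variable {K : Type} [Field K] [NumberField K] {𝕜 : InfinitePlace K → Type} [∀ w, RCLike (𝕜 w)] (D : EmbD 𝕜)
  [∀ v, MeasurableSpace (𝕜 v)] [∀ v, BorelSpace (𝕜 v)]
  {κ : Type} [Fintype κ] (μ : ∀ v, Measure (𝕜 v)) [∀ v, (μ v).IsAddHaarMeasure]
  {ν c c2 : ℝ}

/-- ideals in the class opposite to `J` -/
abbrev TJ (J : Ideal (𝓞 K)) : Type := {I : Ideal (𝓞 K) // I ≠ ⊥ ∧ ∃ x : 𝓞 K, x ≠ 0 ∧ I * J = Ideal.span {x}}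

variable (K) in
/-- normalising constant -/
noncomputable def wc : ℝ := (torsionOrder K * Q0 K).toReal

lemma wc_pos : 0 < wc K := by
  refine ENNReal.toReal_pos (mul_ne_zero ?_ Q0_pos.ne') (ENNReal.mul_ne_top (by simp) Q0_lt_top.ne)
  exact_mod_cast (torsionOrder_pos K).ne'

/-- chosen generator -/
noncomputable def gen {J : Ideal (𝓞 K)} (I : TJ J) : 𝓞 K := I.2.2.choose

lemma gen_ne {J : Ideal (𝓞 K)} (I : TJ J) : gen I ≠ 0 := I.2.2.choose_spec.1

lemma gen_span {J : Ideal (𝓞 K)} (I : TJ J) : I.1 * J = Ideal.span {gen I} := I.2.2.choose_spec.2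

lemma span_unit {J : Ideal (𝓞 K)} (I : TJ J) (u : (𝓞 K)ˣ) : Ideal.span {(u : 𝓞 K) * gen I} = I.1 * J := by
  rw [gen_span, Ideal.span_singleton_mul_left_unit u.isUnit]

lemma mem_unit {J : Ideal (𝓞 K)} (I : TJ J) (u : (𝓞 K)ˣ) : (u : 𝓞 K) * gen I ∈ J := by
  have h2 : I.1 * J ≤ J := Ideal.mul_le_right
  rw [← span_unit I u] at h2
  exact h2 (Ideal.mem_span_singleton_self _)

/-- parametrisation -/
noncomputable def Phi {J : Ideal (𝓞 K)} (g : (κ → ℤ) ≃ J) (p : TJ J × (𝓞 K)ˣ) : κ → ℤ :=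
  g.symm ⟨(p.2 : 𝓞 K) * gen p.1, mem_unit p.1 p.2⟩

lemma Phi_inj {J : Ideal (𝓞 K)} (hJ : J ≠ ⊥) (g : (κ → ℤ) ≃ J) : Function.Injective (Phi g) := by
  rintro ⟨I, u⟩ ⟨I', u'⟩ h
  have h1 : (u : 𝓞 K) * gen I = u' * gen I' := by
    have := g.symm.injective h
    exact congrArg Subtype.val this
  have h2 : I.1 * J = I'.1 * J := by rw [← span_unit I u, ← span_unit I' u', h1]
  have h3 : I = I' := Subtype.ext (mul_right_cancel₀ hJ h2)
  subst h3
  have h4 : (u : 𝓞 K) = u' := mul_right_cancel₀ (gen_ne I) h1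
  rw [Units.ext h4]

lemma Phi_range {J : Ideal (𝓞 K)} (g : (κ → ℤ) ≃ J) (g0 : g 0 = 0) {n : κ → ℤ}
    (hn : n ∉ Set.range (Phi g)) : n = 0 := by
  by_contra h0
  apply hn
  have hb : (g n : 𝓞 K) ≠ 0 := by
    intro h
    apply h0
    apply g.injective
    rw [g0]; exact Subtype.ext h
  have hd : J ∣ Ideal.span {(g n : 𝓞 K)} := Ideal.dvd_span_singleton.2 (g n).2
  obtain ⟨I, hI⟩ := hd
  have hI0 : I ≠ ⊥ := by
    rintro rfl
    rw [Ideal.mul_bot, Ideal.span_singleton_eq_bot] at hI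
    exact hb hI
  let I' : TJ J := ⟨I, hI0, (g n : 𝓞 K), hb, by rw [hI, mul_comm]⟩
  have h2 : Ideal.span {gen I'} = Ideal.span {(g n : 𝓞 K)} := by
    rw [← gen_span I', hI, mul_comm]
  obtain ⟨u, hu⟩ := Ideal.span_singleton_eq_span_singleton.1 h2
  refine ⟨(I', u), ?_⟩
  rw [Phi, Equiv.symm_apply_eq]
  refine Subtype.ext ?_
  change (u : 𝓞 K) * gen I' = g n
  rw [mul_comm, hu]

variable {J : Ideal (𝓞 K)} (hJ : J ≠ ⊥) (L : Lat κ μ ν c c2 1) (g : (κ → ℤ) ≃ J) (g0 : g 0 = 0)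
  (hg : ∀ n w, L.sig n w = D.emb w ((g n : 𝓞 K) : K))

include D hg in
lemma sig_Phi (p : TJ J × (𝓞 K)ˣ) : L.sig (Phi g p) = fun w => D.emb w (((p.2 : 𝓞 K) : K) * (gen p.1 : K)) := by
  funext w
  rw [hg, Phi, Equiv.apply_symm_apply]
  simp

include D hg in
lemma nm_Phi (p : TJ J × (𝓞 K)ˣ) : nm (L.sig (Phi g p)) = (p.1.1.absNorm * J.absNorm : ℕ) := by
  have h0 : p.1.1.absNorm * J.absNorm = (Algebra.norm ℤ ((p.2 : 𝓞 K) * gen p.1)).natAbs := by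
    rw [← Ideal.absNorm_span_singleton, span_unit p.1 p.2, map_mul]
  have h1 : (((p.2 : 𝓞 K) : K) * (gen p.1 : K)) = (((p.2 : 𝓞 K) * gen p.1 : 𝓞 K) : K) := by simp
  rw [sig_Phi D μ L g hg, nm_emb, h0, h1, ← Algebra.coe_norm_int, Nat.cast_natAbs]
  simp

include D hg in
lemma ku_sum (hν : 0 < ν) {h : ℝ} (h1 : 1 ≤ h) (I : TJ J) :
    HasSum (fun p : ℕ × (𝓞 K)ˣ => L.m μ (BB K) (aa 𝕜 ν + p.1 * h) (aa 𝕜 ν + (p.1 + 1 : ℕ) * h) (Phi g (I, p.2)))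
      (wc K) := by
  have hα : ((gen I : 𝓞 K) : K) ≠ 0 := by simpa using gen_ne I
  have e : ∑' p : ℕ × (𝓞 K)ˣ, ∫⁻ x in sl 𝕜 (BB K) (aa 𝕜 ν + p.1 * h) (aa 𝕜 ν + (p.1 + 1 : ℕ) * h),
      ENNReal.ofReal (P0 x (L.sig (Phi g (I, p.2)))) = torsionOrder K * Q0 K := by
    rw [ENNReal.tsum_prod', ENNReal.tsum_comm, ← unit_sum hα]
    refine tsum_congr fun u => ?_
    refine (L.m_tsum μ (dom_BB D) hν h1 (Phi g (I, u))).trans ?_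
    refine lintegral_congr fun x => ?_
    rw [sig_Phi D μ L g hg, P0_emb D]
    exact mul_ne_zero (by simp) hα
  simp only [L.m_eq μ (dom_BB D)]
  have ht : (torsionOrder K : ENNReal) * Q0 K ≠ ⊤ := ENNReal.mul_ne_top (by simp) Q0_lt_top.ne
  rw [← e] at ht
  rw [wc, ← e]
  have := ENNReal.hasSum_toReal ht
  rwa [← ENNReal.tsum_toReal_eq (ENNReal.ne_top_of_tsum_ne_top ht)] at this

include D hJ g0 hg in
theorem hasSum_I (hν : 0 < ν) {h : ℝ} (h1 : 1 ≤ h) (s : ℂ)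
    (hs : Summable fun I : TJ J => ‖((I.1.absNorm * J.absNorm : ℕ) : ℂ)^(-s)‖) :
    HasSum (fun k : ℕ => L.I μ (BB K) (aa 𝕜 ν + k * h) (aa 𝕜 ν + (k + 1 : ℕ) * h) s)
      (wc K * ∑' I : TJ J, ((I.1.absNorm * J.absNorm : ℕ) : ℂ)^(-s)) := by
  refine abs_sum (fun I k u => L.m μ (BB K) (aa 𝕜 ν + k * h) (aa 𝕜 ν + (k + 1 : ℕ) * h) (Phi g (I, u)))
    (fun I => ((I.1.absNorm * J.absNorm : ℕ) : ℂ)^(-s)) (wc K) _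
    (fun I k u => integral_nonneg fun x => P0_nonneg x _) (fun I => ku_sum D μ L g hg hν h1 I) hs fun k => ?_
  have hk := L.I_hasSum μ (dom_BB D) hν (aa 𝕜 ν + k * h) (aa 𝕜 ν + (k + 1 : ℕ) * h) s
  rw [← (Phi_inj hJ g).hasSum_iff] at hk
  · have e : ((fun n => (L.m μ (BB K) (aa 𝕜 ν + k * h) (aa 𝕜 ν + (k + 1 : ℕ) * h) n : ℂ) * (nm (L.sig n) : ℂ)^(-s)) ∘ Phi g) =
        fun p : TJ J × (𝓞 K)ˣ => (L.m μ (BB K) (aa 𝕜 ν + k * h) (aa 𝕜 ν + (k + 1 : ℕ) * h) (Phi g (p.1, p.2)) : ℂ) *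
          ((p.1.1.absNorm * J.absNorm : ℕ) : ℂ)^(-s) := by
      funext p
      simp only [Function.comp]
      rw [nm_Phi D μ L g hg p]
      norm_cast
    rw [e] at hk
    exact hk
  · intro n hn
    rw [Phi_range g g0 hn, Lat.m_zero μ L (dom_BB D)]
    · simp
    · intro x _
      by_contra h
      obtain ⟨v⟩ : Nonempty (InfinitePlace K) := inferInstance
      have := P0_supp' h v
      rw [map_zero] at this; simp at this

end nf
end DZ
end

section
open MeasureTheory Filter Topology
open scoped ContDiff

namespace DZ
set_option linter.unusedSectionVars false

section nf
open NumberField NumberField.Units Ideal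

variable (K : Type) [Field K] [NumberField K]

lemma aN_bigO : (fun n : ℕ => ∑ k ∈ Finset.Icc 1 n, (Nat.card {I : Ideal (𝓞 K) // absNorm I = k} : ℝ)) =O[atTop]
    fun n : ℕ => (n : ℝ) ^ (1 : ℝ) := by
  have key : Tendsto (fun n : ℕ => (∑ k ∈ Finset.Icc 1 n, (Nat.card {I : Ideal (𝓞 K) // absNorm I = k} : ℝ)) / n) atTop
      (𝓝 (dedekindZeta_residue K)) := by
    refine ((Ideal.tendsto_norm_le_div_atTop₀ K).comp tendsto_natCast_atTop_atTop).congr fun n ↦ ?_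
    simp only [Function.comp_apply, Nat.cast_le, ← Nat.cast_sum]
    congr
    rw [← add_left_inj 1, ← card_norm_le_eq_card_norm_le_add_one,
      show Finset.Icc 1 n = Finset.Ioc 0 n from Finset.Icc_succ_left_eq_Ioc _ _,
      show 1 = Nat.card {I : Ideal (𝓞 K) // absNorm I = 0} by simp [Ideal.absNorm_eq_zero_iff],
      Finset.sum_Ioc_add_eq_sum_Icc (n.zero_le),
      ← Finset.card_preimage_eq_sum_card_image_eq (fun k _ ↦ finite_setOfPred_absNorm_eq k)]
    simp [Set.coe_eq_subtype]
  have h2 := key.isBigO_one ℝ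
  have h3 := h2.mul (Asymptotics.isBigO_refl (fun n : ℕ => (n : ℝ)) atTop)
  refine (h3.congr' ?_ ?_)
  · filter_upwards [eventually_gt_atTop 0] with n hn
    have : (n : ℝ) ≠ 0 := by positivity
    field_simp
  · filter_upwards with n
    simp

/-- nonzero ideals -/
abbrev NZ : Type := {I : Ideal (𝓞 K) // I ≠ ⊥}

lemma NZ_card {n : ℕ} (hn : n ≠ 0) : Nat.card {I : NZ K // absNorm I.1 = n} = Nat.card {I : Ideal (𝓞 K) // absNorm I = n} := by
  refine Nat.card_congr ⟨fun x => ⟨x.1.1, x.2⟩, fun x => ⟨⟨x.1, ?_⟩, x.2⟩, fun _ => rfl, fun _ => rfl⟩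
  rintro h
  have := x.2
  rw [h, Ideal.absNorm_bot] at this
  exact hn this.symm

lemma NZ_card' (n : ℕ) : Nat.card {I : NZ K // absNorm I.1 = n} = Nat.card {I : Ideal (𝓞 K) // I ≠ ⊥ ∧ absNorm I = n} :=
  Nat.card_congr ⟨fun x => ⟨x.1.1, x.1.2, x.2⟩, fun x => ⟨⟨x.1, x.2.1⟩, x.2.2⟩, fun _ => rfl, fun _ => rfl⟩

instance NZ_fin (n : ℕ) : Finite {I : NZ K // absNorm I.1 = n} := by
  have : Finite {I : Ideal (𝓞 K) // absNorm I = n} := (Ideal.finite_setOfPred_absNorm_eq (S := 𝓞 K) n).to_subtype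
  exact Finite.of_injective (fun x => (⟨x.1.1, x.2⟩ : {I : Ideal (𝓞 K) // absNorm I = n}))
    fun x y h => by
      have h2 := Subtype.ext_iff.1 h
      exact Subtype.ext (Subtype.ext h2)

lemma fib_sum (s : ℂ) (n : ℕ) : ∑' I : {I : NZ K // absNorm I.1 = n}, ((absNorm I.1.1 : ℕ) : ℂ)^(-s) =
    LSeries.term (fun n => (Nat.card {I : NZ K // absNorm I.1 = n} : ℂ)) s n := by
  have := Fintype.ofFinite {I : NZ K // absNorm I.1 = n}
  have e : ∀ I : {I : NZ K // absNorm I.1 = n}, ((absNorm I.1.1 : ℕ) : ℂ)^(-s) = (n : ℂ)^(-s) := fun I => by rw [I.2]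
  rw [tsum_congr e, tsum_fintype, Finset.sum_const, Finset.card_univ, ← Nat.card_eq_fintype_card, nsmul_eq_mul]
  rcases eq_or_ne n 0 with rfl | hn
  · rw [LSeries.term_zero]
    have : IsEmpty {I : NZ K // absNorm I.1 = 0} := ⟨fun I => I.1.2 (Ideal.absNorm_eq_zero_iff.1 I.2)⟩
    simp
  · rw [LSeries.term_of_ne_zero hn, Complex.cpow_neg, div_eq_mul_inv]

lemma LSum {s : ℂ} (hs : 1 < s.re) : LSeriesSummable (fun n => (Nat.card {I : NZ K // absNorm I.1 = n} : ℂ)) s := by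
  have := LSeriesSummable_of_sum_norm_bigO_and_nonneg (aN_bigO K) (fun n => Nat.cast_nonneg _) zero_le_one hs
  refine (LSeriesSummable_congr s fun {n} hn => ?_).1 this
  rw [NZ_card K hn]
  simp

lemma NZ_summable {s : ℂ} (hs : 1 < s.re) : Summable fun I : NZ K => ‖((absNorm I.1 : ℕ) : ℂ)^(-s)‖ := by
  rw [← (Equiv.sigmaFiberEquiv (fun I : NZ K => absNorm I.1)).summable_iff]
  refine (summable_sigma_of_nonneg fun x => norm_nonneg _).2 ⟨fun n => Summable.of_finite, ?_⟩
  have h := (LSum K (s := (s.re : ℂ)) (by simpa using hs)).norm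
  refine h.congr fun n => ?_
  rw [← fib_sum K]
  have e : ∀ I : {I : NZ K // absNorm I.1 = n}, ((absNorm I.1.1 : ℕ) : ℂ)^(-(s.re : ℂ)) = ((‖((absNorm I.1.1 : ℕ) : ℂ)^(-s)‖ : ℝ) : ℂ) := fun I => by
    have hp : 0 < absNorm I.1.1 := Nat.pos_of_ne_zero fun h => I.1.2 (Ideal.absNorm_eq_zero_iff.1 h)
    rw [Complex.norm_natCast_cpow_of_pos hp, Complex.ofReal_cpow (by positivity)]
    simp
  rw [tsum_congr e, ← Complex.ofReal_tsum, Complex.norm_real, Real.norm_of_nonneg (tsum_nonneg fun _ => norm_nonneg _)]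
  rfl

lemma LSeries_NZ {s : ℂ} (hs : 1 < s.re) :
    LSeries (fun n => (Nat.card {I : Ideal (𝓞 K) // I ≠ ⊥ ∧ absNorm I = n} : ℂ)) s =
      ∑' I : NZ K, ((absNorm I.1 : ℕ) : ℂ)^(-s) := by
  simp only [← NZ_card']
  have h := (NZ_summable K hs).of_norm
  rw [← (Equiv.sigmaFiberEquiv (fun I : NZ K => absNorm I.1)).tsum_eq]
  rw [← (Equiv.sigmaFiberEquiv (fun I : NZ K => absNorm I.1)).summable_iff] at h
  refine Eq.trans ?_ (Summable.tsum_sigma' (fun n => Summable.of_finite) h).symm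
  exact tsum_congr fun n => (fib_sum K s n).symm

/-- a representative of the inverse class -/
noncomputable def JC (C : ClassGroup (𝓞 K)) : nonZeroDivisors (Ideal (𝓞 K)) := (ClassGroup.mk0_surjective C).choose

variable {K}
lemma JC_spec (C : ClassGroup (𝓞 K)) : ClassGroup.mk0 (JC K C) = C := (ClassGroup.mk0_surjective C).choose_spec

lemma JC_ne (C : ClassGroup (𝓞 K)) : (JC K C : Ideal (𝓞 K)) ≠ ⊥ := nonZeroDivisors.coe_ne_zero _

/-- the class -/
noncomputable def cls (I : NZ K) : ClassGroup (𝓞 K) := (ClassGroup.mk0 ⟨I.1, mem_nonZeroDivisors_iff_ne_zero.2 I.2⟩)⁻¹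

/-- fibres -/
noncomputable def fibE (C : ClassGroup (𝓞 K)) : {I : NZ K // cls I = C} ≃ TJ (JC K C : Ideal (𝓞 K)) where
  toFun x := ⟨x.1.1, x.1.2, by
    have h := x.2.trans (JC_spec C).symm
    rw [cls, inv_eq_iff_eq_inv, ClassGroup.mk0_eq_mk0_inv_iff] at h
    obtain ⟨y, hy, h⟩ := h
    exact ⟨y, hy, h⟩⟩
  invFun x := ⟨⟨x.1, x.2.1⟩, by
    have h := x.2.2
    conv_rhs => rw [← JC_spec C]
    rw [cls, inv_eq_iff_eq_inv, ClassGroup.mk0_eq_mk0_inv_iff]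
    obtain ⟨y, hy, h⟩ := h
    exact ⟨y, hy, h⟩⟩
  left_inv _ := rfl
  right_inv _ := rfl

lemma TJ_summable (C : ClassGroup (𝓞 K)) {s : ℂ} (hs : 1 < s.re) :
    Summable fun I : TJ (JC K C : Ideal (𝓞 K)) => ‖((I.1.absNorm * (JC K C : Ideal (𝓞 K)).absNorm : ℕ) : ℂ)^(-s)‖ := by
  have h := (NZ_summable K hs).comp_injective (i := fun I : TJ (JC K C : Ideal (𝓞 K)) => (⟨I.1, I.2.1⟩ : NZ K))
    fun x y h => by
      have h2 := Subtype.ext_iff.1 h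
      exact Subtype.ext h2
  have h2 := h.mul_right ‖(((JC K C : Ideal (𝓞 K)).absNorm : ℕ) : ℂ)^(-s)‖
  refine h2.congr fun I => ?_
  rw [Nat.cast_mul, Complex.natCast_mul_natCast_cpow, norm_mul]
  rfl

lemma LSeries_TJ {s : ℂ} (hs : 1 < s.re) :
    LSeries (fun n => (Nat.card {I : Ideal (𝓞 K) // I ≠ ⊥ ∧ absNorm I = n} : ℂ)) s =
      ∑ C : ClassGroup (𝓞 K), (((JC K C : Ideal (𝓞 K)).absNorm : ℕ) : ℂ)^s *
        ∑' I : TJ (JC K C : Ideal (𝓞 K)), ((I.1.absNorm * (JC K C : Ideal (𝓞 K)).absNorm : ℕ) : ℂ)^(-s) := by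
  rw [LSeries_NZ K hs]
  have h := (NZ_summable K hs).of_norm
  rw [← (Equiv.sigmaFiberEquiv (cls (K := K))).tsum_eq]
  rw [← (Equiv.sigmaFiberEquiv (cls (K := K))).summable_iff] at h
  refine h.tsum_sigma.trans ?_
  rw [tsum_fintype]
  refine Finset.sum_congr rfl fun C _ => ?_
  have hN : (((JC K C : Ideal (𝓞 K)).absNorm : ℕ) : ℂ) ≠ 0 := by
    have := JC_ne C
    rw [Nat.cast_ne_zero]
    exact fun h => this (Ideal.absNorm_eq_zero_iff.1 h)
  rw [← tsum_mul_left, ← (fibE C).tsum_eq]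
  refine tsum_congr fun I => ?_
  rw [Nat.cast_mul, Complex.natCast_mul_natCast_cpow, mul_comm (_ ^ (-s)), ← mul_assoc, ← Complex.cpow_add _ _ hN]
  simp [fibE]

end nf
end DZ
end

section
open MeasureTheory Filter Topology
open scoped ContDiff

namespace DZ
set_option linter.unusedSectionVars false

section nf
open NumberField NumberField.Units Ideal

variable (K : Type) [Field K] [NumberField K]

lemma class_fun (C : ClassGroup (𝓞 K)) : ∃ G : ℝ → ℂ → ℂ,
    (∀ h, 1 ≤ h → h ≤ 8 → DifferentiableOn ℂ (G h) {s | 0 < s.re ∧ s.re < 2}) ∧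
    (∀ h, 1 ≤ h → h ≤ 8 → ∀ s : ℂ, 1 < s.re → G h s = (1 - Complex.exp (h * (1 - s))) * (wc K *
      ∑' I : TJ (JC K C : Ideal (𝓞 K)), ((I.1.absNorm * (JC K C : Ideal (𝓞 K)).absNorm : ℕ) : ℂ)^(-s))) ∧
    ∀ ε : ℝ, 0 < ε → ∃ A : ℝ, 0 ≤ A ∧ ∀ h σ t : ℝ, 1 ≤ h → h ≤ 8 → 1/2 ≤ σ → σ ≤ 1 → 1 ≤ |t| →
      ‖G h (σ + t * Complex.I)‖ ≤ A * |t| ^ ((Module.finrank ℚ K : ℝ) / 3 * (1 - σ) + ε) := by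
  obtain ⟨𝕜, hR, ⟨D⟩⟩ := exists_embD K
  letI : ∀ w, MeasurableSpace (𝕜 w) := fun w => borel (𝕜 w)
  haveI : ∀ w, BorelSpace (𝕜 w) := fun w => ⟨rfl⟩
  let μ : ∀ w, Measure (𝕜 w) := fun w => Measure.addHaar
  obtain ⟨κ, hκ, ν, c, c2, hν, hc, hc2, L, g, g0, hg⟩ := lat_ideal D μ (JC K C : Ideal (𝓞 K)) (JC_ne C)
  refine ⟨fun h s => L.G μ (BB K) h s, ?_, ?_, ?_⟩
  · intro h h1 h8
    exact L.G_diff μ (dom_BB D) hν hc h1 h8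
  · intro h h1 h8 s hs
    exact L.G_eq μ (dom_BB D) hν h8 s _
      (hasSum_I D μ (JC_ne C) L g g0 hg hν h1 s (TJ_summable C hs))
  · intro ε hε
    obtain ⟨A, hA, H⟩ := L.G_bd μ (dom_BB D) hν hc hc2 ε hε
    refine ⟨A, hA, fun h σ t h1 h8 s1 s2 ht => ?_⟩
    have := H h σ t h1 h8 s1 s2 ht
    rwa [dg_KF D] at this

lemma exists_h {t : ℝ} (ht : 1 ≤ |t|) : ∃ h : ℝ, 1 ≤ h ∧ h ≤ 8 ∧ ∃ n : ℤ, -(h * t) = Real.pi + n * (2 * Real.pi) := by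
  have hp := Real.pi_pos
  have hp4 := Real.pi_lt_d2
  have ht0 : 0 < |t| := by linarith
  set x := (|t| / Real.pi - 1) / 2 with hx
  set m := ⌈x⌉ with hm
  have m1 : x ≤ m := Int.le_ceil x
  have m2 : (m : ℝ) < x + 1 := Int.ceil_lt_add_one x
  have hxt : (2 * x + 1) * Real.pi = |t| := by rw [hx]; field_simp; ring
  have hh : (2 * m + 1) * Real.pi / |t| * |t| = (2 * m + 1) * Real.pi := by field_simp
  refine ⟨(2 * m + 1) * Real.pi / |t|, ?_, ?_, ?_⟩
  · rw [le_div_iff₀ ht0]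
    nlinarith
  · rw [div_le_iff₀ ht0]
    nlinarith
  · rcases abs_cases t with ⟨h1, h2⟩ | ⟨h1, h2⟩
    · refine ⟨-m - 1, ?_⟩
      rw [h1] at hh ⊢
      rw [hh]; push_cast; ring
    · refine ⟨m, ?_⟩
      rw [← mul_neg, ← h1, hh]; ring

lemma factor_ge {h t σ : ℝ} {n : ℤ} (hn : -(h * t) = Real.pi + n * (2 * Real.pi)) :
    1 ≤ ‖1 - Complex.exp (h * (1 - (σ + t * Complex.I)))‖ := by
  have e : (h : ℂ) * (1 - (σ + t * Complex.I)) = ((h * (1 - σ) : ℝ) : ℂ) + (Real.pi * Complex.I + n * (2 * Real.pi * Complex.I)) := by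
    have : (-(h * t) : ℂ) = Real.pi + n * (2 * Real.pi) := by exact_mod_cast hn
    push_cast
    linear_combination Complex.I * this
  rw [e, Complex.exp_add, Complex.exp_add, Complex.exp_pi_mul_I, Complex.exp_int_mul_two_pi_mul_I, ← Complex.ofReal_exp]
  have : (1 : ℂ) - (Real.exp (h * (1 - σ)) : ℂ) * (-1 * 1) = ((1 + Real.exp (h * (1 - σ)) : ℝ) : ℂ) := by push_cast; ring
  rw [this, Complex.norm_real, Real.norm_of_nonneg (by positivity)]
  linarith [Real.exp_pos (h * (1 - σ))]

theorem main_bound (Z : ℂ → ℂ) (hd : ∀ s : ℂ, s ≠ 1 → DifferentiableAt ℂ Z s)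
    (he : ∀ s : ℂ, 1 < s.re → Z s = LSeries (fun n => (Nat.card {I : Ideal (𝓞 K) // I ≠ ⊥ ∧ absNorm I = n} : ℂ)) s)
    (ε : ℝ) (hε : 0 < ε) : ∃ A : ℝ, ∀ σ t : ℝ, 1/2 ≤ σ → σ ≤ 1 → 1 ≤ |t| →
      ‖Z (σ + t * Complex.I)‖ ≤ A * (1 + |t|) ^ ((Module.finrank ℚ K : ℝ) / 3 * (1 - σ) + ε) := by
  choose G Gd Ge Gb using class_fun K
  choose A hA HA using fun C => Gb C ε hε
  have hw := wc_pos (K := K)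
  have hwC : (wc K : ℂ) ≠ 0 := by exact_mod_cast hw.ne'
  have hN : ∀ C : ClassGroup (𝓞 K), 0 < (JC K C : Ideal (𝓞 K)).absNorm := fun C =>
    Nat.pos_of_ne_zero fun h => JC_ne C (Ideal.absNorm_eq_zero_iff.1 h)
  have key : ∀ h : ℝ, 1 ≤ h → h ≤ 8 → ∀ σ t : ℝ, 1/2 ≤ σ → σ ≤ 1 → 1 ≤ |t| →
      (1 - Complex.exp (h * (1 - (σ + t * Complex.I)))) * Z (σ + t * Complex.I) =
      ∑ C : ClassGroup (𝓞 K), (wc K : ℂ)⁻¹ * ((((JC K C : Ideal (𝓞 K)).absNorm : ℕ) : ℂ)^(σ + t * Complex.I) *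
        G C h (σ + t * Complex.I)) := by
    intro h h1 h8 σ t s1 s2 ht
    have htn : t ≠ 0 := fun h0 => by rw [h0] at ht; norm_num at ht
    set U : Set ℂ := {s | (0 < s.re ∧ s.re < 2) ∧ 0 < s.im * t} with hU
    have Uo : IsOpen U := by
      refine IsOpen.inter (IsOpen.inter ?_ ?_) ?_
      · exact isOpen_lt continuous_const Complex.continuous_re
      · exact isOpen_lt Complex.continuous_re continuous_const
      · exact isOpen_lt continuous_const (Complex.continuous_im.mul continuous_const)
    have Uc : Convex ℝ U := by
      intro x hx y hy a b ha hb hab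
      obtain ⟨⟨x1, x2⟩, x3⟩ := hx
      obtain ⟨⟨y1, y2⟩, y3⟩ := hy
      simp only [hU, Set.mem_ofPred_eq, Complex.add_re, Complex.add_im, Complex.real_smul, Complex.re_ofReal_mul, Complex.im_ofReal_mul]
      have hb' : b = 1 - a := by linarith
      rcases eq_or_lt_of_le ha with h0 | h0
      · rw [← h0] at hab ⊢
        have : b = 1 := by linarith
        rw [this]
        refine ⟨⟨by linarith, by linarith⟩, by linarith⟩
      · have p1 := mul_pos h0 x1
        have p2 := mul_nonneg hb y1.le
        have p3 : a * x.re < a * 2 := by gcongr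
        have p4 : b * y.re ≤ b * 2 := by gcongr
        have p5 := mul_pos h0 x3
        have p6 := mul_nonneg hb y3.le
        refine ⟨⟨by linarith, by linarith⟩, by linarith⟩
    have Un : ∀ s ∈ U, s ≠ 1 := by
      rintro s ⟨_, hs⟩ rfl
      simp at hs
    have fa : AnalyticOnNhd ℂ (fun s => (1 - Complex.exp (h * (1 - s))) * Z s) U := by
      refine DifferentiableOn.analyticOnNhd (fun s hs => ?_) Uo
      refine DifferentiableAt.differentiableWithinAt ?_
      exact DifferentiableAt.mul (by fun_prop) (hd s (Un s hs))
    have ga : AnalyticOnNhd ℂ (fun s => ∑ C : ClassGroup (𝓞 K), (wc K : ℂ)⁻¹ *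
        ((((JC K C : Ideal (𝓞 K)).absNorm : ℕ) : ℂ)^s * G C h s)) U := by
      refine DifferentiableOn.analyticOnNhd ?_ Uo
      refine DifferentiableOn.fun_sum fun C _ => ?_
      refine DifferentiableOn.const_mul ?_ _
      refine DifferentiableOn.mul ?_ ((Gd C h h1 h8).mono fun s hs => hs.1)
      intro s hs
      refine DifferentiableAt.differentiableWithinAt ?_
      refine DifferentiableAt.const_cpow differentiableAt_id (Or.inl ?_)
      exact_mod_cast (hN C).ne'
    have hs1 : ((3 / 2 : ℝ) + t * Complex.I : ℂ) ∈ U := by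
      refine ⟨⟨?_, ?_⟩, ?_⟩
      · simp
      · simp; norm_num
      · simpa using mul_self_pos.2 htn
    have hev : (fun s => (1 - Complex.exp (h * (1 - s))) * Z s) =ᶠ[𝓝 ((3 / 2 : ℝ) + t * Complex.I : ℂ)]
        (fun s => ∑ C : ClassGroup (𝓞 K), (wc K : ℂ)⁻¹ *
        ((((JC K C : Ideal (𝓞 K)).absNorm : ℕ) : ℂ)^s * G C h s)) := by
      have ho : IsOpen {s : ℂ | 1 < s.re} := isOpen_lt continuous_const Complex.continuous_re
      filter_upwards [ho.mem_nhds (show ((3 / 2 : ℝ) + t * Complex.I : ℂ) ∈ {s : ℂ | 1 < s.re} by simp; norm_num)] with s hs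
      rw [he s hs, LSeries_TJ hs, Finset.mul_sum]
      refine Finset.sum_congr rfl fun C _ => ?_
      rw [Ge C h h1 h8 s hs]
      field_simp
    have hz : (σ + t * Complex.I : ℂ) ∈ U := by
      refine ⟨⟨?_, ?_⟩, ?_⟩
      · simp; linarith
      · simp; linarith
      · simpa using mul_self_pos.2 htn
    exact fa.eqOn_of_preconnected_of_eventuallyEq ga Uc.isPreconnected hs1 hev hz
  refine ⟨∑ C : ClassGroup (𝓞 K), (wc K)⁻¹ * ((((JC K C : Ideal (𝓞 K)).absNorm : ℕ) : ℝ) * A C), ?_⟩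
  intro σ t s1 s2 ht
  obtain ⟨h, h1, h8, n, hn⟩ := exists_h ht
  have hf := factor_ge (σ := σ) hn
  have hk := key h h1 h8 σ t s1 s2 ht
  have hex : 0 ≤ (Module.finrank ℚ K : ℝ) / 3 * (1 - σ) + ε := by
    have := mul_nonneg (show (0:ℝ) ≤ (Module.finrank ℚ K : ℝ) / 3 by positivity) (sub_nonneg.2 s2)
    linarith
  calc ‖Z (σ + t * Complex.I)‖ ≤ ‖1 - Complex.exp (h * (1 - (σ + t * Complex.I)))‖ * ‖Z (σ + t * Complex.I)‖ :=
        le_mul_of_one_le_left (norm_nonneg _) hf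
    _ = _ := by rw [← norm_mul, hk]
    _ ≤ _ := norm_sum_le _ _
    _ ≤ _ := by
      rw [Finset.sum_mul]
      refine Finset.sum_le_sum fun C _ => ?_
      rw [norm_mul, norm_mul, norm_inv, Complex.norm_real, Real.norm_of_nonneg hw.le, mul_assoc, mul_assoc]
      refine mul_le_mul_of_nonneg_left ?_ (inv_nonneg.2 hw.le)
      refine mul_le_mul ?_ ?_ (norm_nonneg _) (Nat.cast_nonneg _)
      · rw [Complex.norm_natCast_cpow_of_pos (hN C)]
        have h1 : (1 : ℝ) ≤ (((JC K C : Ideal (𝓞 K)).absNorm : ℕ) : ℝ) := by exact_mod_cast hN C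
        calc _ ≤ (((JC K C : Ideal (𝓞 K)).absNorm : ℕ) : ℝ) ^ (1 : ℝ) := Real.rpow_le_rpow_of_exponent_le h1 (by simpa using s2)
          _ = _ := Real.rpow_one _
      · refine (HA C h σ t h1 h8 s1 s2 ht).trans ?_
        refine mul_le_mul_of_nonneg_left ?_ (hA C)
        exact Real.rpow_le_rpow (abs_nonneg _) (by linarith) hex

end nf
end DZ
end

/-- **Convexity bound for the Dedekind zeta function in the critical strip.**
Let `K` be a number field of degree `d` and let `Z` be the meromorphic continuation of its
Dedekind zeta function, i.e. `Z` is differentiable away from `s = 1` and agrees with the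
Dirichlet series `∑ a_K(n) n^{-s}` for `Re s > 1`. Then for every `ε > 0` there is a
constant `C` such that `|ζ_K(σ + it)| ≤ C (1 + |t|)^{(d/3)(1-σ) + ε}` for all
`1/2 ≤ σ ≤ 1` and `|t| ≥ 1`. -/
theorem dedekind_zeta_convexity_bound
    (K : Type) [Field K] [NumberField K]
    (d : ℕ) (hd : d = Module.finrank ℚ K)
    (Z : ℂ → ℂ)
    (hZdiff : ∀ s : ℂ, s ≠ 1 → DifferentiableAt ℂ Z s)
    (hZeq : ∀ s : ℂ, 1 < s.re → Z s = LSeries (fun n => (aK K n : ℂ)) s) :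
    ∀ ε : ℝ, 0 < ε → ∃ C : ℝ,
      ∀ σ t : ℝ, 1 / 2 ≤ σ → σ ≤ 1 → 1 ≤ |t| →
        ‖Z (σ + t * Complex.I)‖ ≤ C * (1 + |t|) ^ ((d : ℝ) / 3 * (1 - σ) + ε) := by
  subst hd
  intro ε hε
  exact DZ.main_bound K Z hZdiff hZeq ε hε
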